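/- arXiv:2603.22202 — 3 statements merged into one kernel-verified Lean document; each statement's English description precedes it below -/
import Mathlib

section
/- Let b be an odd, positive definite, unimodular symmetric bilinear form over ℤ on ℤ^h, and let u be the standard dot product on ℤ^h (so the exterior submodule of u is D_h := {x | ∑ i, x i is even}). Then there exists a ℤ-linear equivalence e : D_h × (Fin 2 → ℤ) ≃ K_b × (Fin 2 → ℤ) such that for all v, w: 2 * (∑ i, v.1 i * w.1 i) + H v.2 w.2 = 2 * b (e v).1 (e w).1 + H (e v).2 (e w).2. In words: the forms 2·u^nd_ext ⊕ H and 2·b^nd_ext ⊕ H are isometric over ℤ. -/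
/-- The hyperbolic form `H` over `ℤ` on `ℤ² = Fin 2 → ℤ`. -/
def hypForm (x y : Fin 2 → ℤ) : ℤ := x 0 * y 1 + x 1 * y 0

/-- The exterior submodule `K_b = {x | Even (b x x)}` of a symmetric bilinear form `b`. -/
def extSub {h : ℕ} (b : (Fin h → ℤ) →ₗ[ℤ] (Fin h → ℤ) →ₗ[ℤ] ℤ)
    (hsymm : ∀ x y, b x y = b y x) : Submodule ℤ (Fin h → ℤ) where
  carrier := {x | Even (b x x)}
  zero_mem' := by simp
  add_mem' := by
    intro x y hx hy
    have e : b (x + y) (x + y) = (b x x + b y y) + 2 * b x y := by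
      simp only [map_add, LinearMap.add_apply]
      rw [hsymm y x]; ring
    simp only [Set.mem_setOf_eq] at *
    rw [e]
    exact (hx.add hy).add (even_two_mul _)
  smul_mem' := by
    intro c x hx
    have e : b (c • x) (c • x) = c * (c * b x x) := by
      simp only [map_smul, LinearMap.smul_apply, smul_eq_mul]
    simp only [Set.mem_setOf_eq] at *
    rw [e]
    exact (hx.mul_left c).mul_left c

/-- The exterior submodule `D_h = {x | Even (∑ i, x i)}` of the standard dot product. -/
def Dsub (h : ℕ) : Submodule ℤ (Fin h → ℤ) where
  carrier := {x | Even (∑ i, x i)}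
  zero_mem' := by simp
  add_mem' := by
    intro a b ha hb
    simp only [Set.mem_setOf_eq, Pi.add_apply, Finset.sum_add_distrib] at *
    exact ha.add hb
  smul_mem' := by
    intro c x hx
    simp only [Set.mem_setOf_eq, Pi.smul_apply, smul_eq_mul, ← Finset.mul_sum] at *
    exact hx.mul_left c

/-- The Gram matrix of a bilinear form on `ℤ^h` with respect to the standard basis. -/
def gram {h : ℕ} (b : (Fin h → ℤ) →ₗ[ℤ] (Fin h → ℤ) →ₗ[ℤ] ℤ) :
    Matrix (Fin h) (Fin h) ℤ :=
  Matrix.of fun i j => b (Pi.single i 1) (Pi.single j 1)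


section Generic
variable {R : Type} [CommRing R] {U U1 U2 U3 U4 : Type}
  [AddCommGroup U] [Module R U] [AddCommGroup U1] [Module R U1] [AddCommGroup U2] [Module R U2]
  [AddCommGroup U3] [Module R U3] [AddCommGroup U4] [Module R U4]

/-- Isometry of bilinear forms. -/
def Isom (B1 : U1 →ₗ[R] U1 →ₗ[R] R) (B2 : U2 →ₗ[R] U2 →ₗ[R] R) : Prop :=
  ∃ e : U1 ≃ₗ[R] U2, ∀ x y, B2 (e x) (e y) = B1 x y

/-- Orthogonal sum. -/
def dsum (B1 : U1 →ₗ[R] U1 →ₗ[R] R) (B2 : U2 →ₗ[R] U2 →ₗ[R] R) :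
    (U1 × U2) →ₗ[R] (U1 × U2) →ₗ[R] R :=
  B1.compl₁₂ (LinearMap.fst R U1 U2) (LinearMap.fst R U1 U2) +
    B2.compl₁₂ (LinearMap.snd R U1 U2) (LinearMap.snd R U1 U2)

@[simp] theorem dsum_apply (B1 : U1 →ₗ[R] U1 →ₗ[R] R) (B2 : U2 →ₗ[R] U2 →ₗ[R] R)
    (x y : U1 × U2) : dsum B1 B2 x y = B1 x.1 y.1 + B2 x.2 y.2 := by
  simp [dsum]

/-- Rank one form. -/
def sc (a : R) : R →ₗ[R] R →ₗ[R] R := a • LinearMap.mul R R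

@[simp] theorem sc_apply (a x y : R) : sc a x y = a * (x * y) := by simp [sc]

/-- Diagonal form. -/
def dg {ι : Type} [Fintype ι] (v : ι → R) : (ι → R) →ₗ[R] (ι → R) →ₗ[R] R :=
  ∑ i, v i • (LinearMap.mul R R).compl₁₂ (LinearMap.proj i) (LinearMap.proj i)

@[simp] theorem dg_apply {ι : Type} [Fintype ι] (v : ι → R) (x y : ι → R) :
    dg v x y = ∑ i, v i * (x i * y i) := by
  simp [dg, LinearMap.sum_apply]

theorem Isom.refl (B : U →ₗ[R] U →ₗ[R] R) : Isom B B := ⟨LinearEquiv.refl R U, by simp⟩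

theorem Isom.symm {B1 : U1 →ₗ[R] U1 →ₗ[R] R} {B2 : U2 →ₗ[R] U2 →ₗ[R] R} (h : Isom B1 B2) :
    Isom B2 B1 := by
  obtain ⟨e, he⟩ := h
  exact ⟨e.symm, fun x y => by rw [← he]; simp⟩

theorem Isom.trans {B1 : U1 →ₗ[R] U1 →ₗ[R] R} {B2 : U2 →ₗ[R] U2 →ₗ[R] R}
    {B3 : U3 →ₗ[R] U3 →ₗ[R] R} (h : Isom B1 B2) (h' : Isom B2 B3) : Isom B1 B3 := by
  obtain ⟨e, he⟩ := h
  obtain ⟨f, hf⟩ := h'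
  exact ⟨e.trans f, fun x y => by simp [hf, he]⟩

theorem Isom.dsum {B1 : U1 →ₗ[R] U1 →ₗ[R] R} {B2 : U2 →ₗ[R] U2 →ₗ[R] R}
    {B3 : U3 →ₗ[R] U3 →ₗ[R] R} {B4 : U4 →ₗ[R] U4 →ₗ[R] R} (h : Isom B1 B2) (h' : Isom B3 B4) :
    Isom (dsum B1 B3) (_root_.dsum B2 B4) := by
  obtain ⟨e, he⟩ := h
  obtain ⟨f, hf⟩ := h'
  exact ⟨e.prodCongr f, fun x y => by simp [hf, he]⟩

theorem dsum_comm (B1 : U1 →ₗ[R] U1 →ₗ[R] R) (B2 : U2 →ₗ[R] U2 →ₗ[R] R) :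
    Isom (dsum B1 B2) (dsum B2 B1) :=
  ⟨LinearEquiv.prodComm R U1 U2, fun x y => by simp [add_comm]⟩

theorem dsum_assoc (B1 : U1 →ₗ[R] U1 →ₗ[R] R) (B2 : U2 →ₗ[R] U2 →ₗ[R] R)
    (B3 : U3 →ₗ[R] U3 →ₗ[R] R) :
    Isom (dsum (dsum B1 B2) B3) (dsum B1 (dsum B2 B3)) :=
  ⟨LinearEquiv.prodAssoc R U1 U2 U3, fun x y => by simp [add_assoc]⟩

theorem dg_sum {ι κ : Type} [Fintype ι] [Fintype κ] (v : ι → R) (w : κ → R) :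
    Isom (dg (Sum.elim v w)) (dsum (dg v) (dg w)) :=
  ⟨LinearEquiv.sumArrowLequivProdArrow ι κ R R, fun x y => by simp⟩

theorem dg_reindex {ι κ : Type} [Fintype ι] [Fintype κ] (v : ι → R) (w : κ → R) (e : ι ≃ κ)
    (h : ∀ i, w (e i) = v i) : Isom (dg v) (dg w) := by
  refine ⟨LinearEquiv.funCongrLeft R R e.symm, fun x y => ?_⟩
  simp only [dg_apply, LinearEquiv.funCongrLeft_apply, LinearMap.funLeft_apply]
  rw [← e.sum_comp]
  simp [h]

theorem dg_cons {n : ℕ} (v : Fin (n + 1) → R) :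
    Isom (dg v) (dsum (sc (v 0)) (dg (fun i => v (Fin.succ i)))) := by
  refine ⟨(Fin.consLinearEquiv R (fun _ => R)).symm, fun x y => ?_⟩
  simp [Fin.sum_univ_succ, Fin.consLinearEquiv, Fin.tail]

end Generic

section Witt
variable {K : Type} [Field K] [CharZero K] {U U1 U2 : Type}
  [AddCommGroup U] [Module K U] [AddCommGroup U1] [Module K U1] [AddCommGroup U2] [Module K U2]

theorem refl_exists (C : U →ₗ[K] U →ₗ[K] K) (hC : ∀ x y, C x y = C y x) (d : U) (hd : C d d ≠ 0) :
    ∃ s : U ≃ₗ[K] U, (∀ x y, C (s x) (s y) = C x y) ∧ ∀ z, s z = z - (2 * C z d / C d d) • d := by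
  have h2 : ((2 / C d d) • C d) d = 2 := by simp [hd]
  refine ⟨Module.reflection h2, ?_, ?_⟩
  · intro x y
    simp only [Module.reflection_apply, map_sub, LinearMap.sub_apply, map_smul,
      LinearMap.smul_apply, smul_eq_mul]
    rw [hC x d]
    field_simp
    ring
  · intro z
    simp only [Module.reflection_apply, LinearMap.smul_apply, smul_eq_mul]
    rw [hC z d]
    congr 2
    ring

theorem witt_transitive (C : U →ₗ[K] U →ₗ[K] K) (hC : ∀ x y, C x y = C y x) (x y : U)
    (hxy : C x x = C y y) (hx : C x x ≠ 0) :
    ∃ s : U ≃ₗ[K] U, (∀ x y, C (s x) (s y) = C x y) ∧ s x = y := by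
  by_cases h : C (x - y) (x - y) = 0
  · have h' : C (x + y) (x + y) ≠ 0 := by
      intro h'
      apply hx
      simp only [map_sub, LinearMap.sub_apply, map_add, LinearMap.add_apply] at h h'
      have : 4 * C x x = 0 := by linear_combination h + h' + 2 * hxy
      simpa using this
    obtain ⟨s, hs, hs'⟩ := refl_exists C hC _ h'
    refine ⟨s.trans (LinearEquiv.neg K), by simp [hs], ?_⟩
    have : (2 * C x (x + y) / C (x + y) (x + y)) = 1 := by
      rw [div_eq_one_iff_eq h']
      simp only [map_add, LinearMap.add_apply]
      rw [hC y x]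
      linear_combination hxy
    rw [LinearEquiv.trans_apply, hs', this]
    simp
  · obtain ⟨s, hs, hs'⟩ := refl_exists C hC _ h
    refine ⟨s, hs, ?_⟩
    have : (2 * C x (x - y) / C (x - y) (x - y)) = 1 := by
      rw [div_eq_one_iff_eq h]
      simp only [map_sub, LinearMap.sub_apply]
      rw [hC y x]
      linear_combination hxy
    rw [hs', this]
    simp

theorem witt_cancel_one {B1 : U1 →ₗ[K] U1 →ₗ[K] K} {B2 : U2 →ₗ[K] U2 →ₗ[K] K}
    (h2 : ∀ x y, B2 x y = B2 y x) (a : K) (ha : a ≠ 0)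
    (h : Isom (dsum (sc a) B1) (dsum (sc a) B2)) : Isom B1 B2 := by
  obtain ⟨e, he⟩ := h
  obtain ⟨s, hs, hs'⟩ := witt_transitive (dsum (sc a) B2)
    (fun x y => by simp [h2 x.2 y.2, mul_comm]) (e (1, 0)) (1, 0) (by rw [he]; simp)
    (by rw [he]; simpa using ha)
  let f := e.trans s
  have hf : ∀ x y, dsum (sc a) B2 (f x) (f y) = dsum (sc a) B1 x y := fun x y => by
    simp only [f, LinearEquiv.trans_apply, hs, he]
  have hf1 : f (1, 0) = (1, 0) := by simp [f, hs']
  have k1 : ∀ u, f (0, u) = (0, (f (0, u)).2) := by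
    intro u
    have := hf (0, u) (1, 0)
    rw [hf1] at this
    simp [ha] at this
    exact Prod.ext this rfl
  have k2 : ∀ u, f.symm (0, u) = (0, (f.symm (0, u)).2) := by
    intro u
    have := hf (f.symm (0, u)) (1, 0)
    rw [hf1] at this
    simp [ha] at this
    exact Prod.ext this rfl
  refine ⟨LinearEquiv.ofLinearMap
    (LinearMap.snd K K U2 ∘ₗ f.toLinearMap ∘ₗ LinearMap.inr K K U1)
    (LinearMap.snd K K U1 ∘ₗ f.symm.toLinearMap ∘ₗ LinearMap.inr K K U2) ?_ ?_, ?_⟩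
  · ext u
    simp [← k2]
  · ext u
    simp [← k1]
  · intro x y
    have := hf (0, x) (0, y)
    rw [k1 x, k1 y] at this
    simpa using this

theorem witt_cancel {ι : Type} [Fintype ι] (v : ι → K) (hv : ∀ i, v i ≠ 0)
    {B1 : U1 →ₗ[K] U1 →ₗ[K] K} {B2 : U2 →ₗ[K] U2 →ₗ[K] K}
    (h2 : ∀ x y, B2 x y = B2 y x)
    (h : Isom (dsum (dg v) B1) (dsum (dg v) B2)) : Isom B1 B2 := by
  have key : ∀ (n : ℕ) (w : Fin n → K), (∀ i, w i ≠ 0) →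
      Isom (dsum (dg w) B1) (dsum (dg w) B2) → Isom B1 B2 := by
    intro n
    induction n with
    | zero =>
      intro w _ ⟨e, he⟩
      refine ⟨((LinearEquiv.uniqueProd).symm.trans e).trans LinearEquiv.uniqueProd, ?_⟩
      intro x y
      have := he (default, x) (default, y)
      simp only [dsum_apply, dg_apply, Finset.univ_eq_empty, Finset.sum_empty, zero_add] at this
      simpa using this
    | succ n ih =>
      intro w hw hh
      refine ih (fun i => w (Fin.succ i)) (fun i => hw _) ?_
      apply witt_cancel_one (a := w 0) _ (hw 0)
      · refine (dsum_assoc _ _ _).symm.trans ?_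
        refine Isom.trans ?_ (dsum_assoc _ _ _)
        exact ((dg_cons w).symm.dsum (Isom.refl _)).trans (hh.trans ((dg_cons w).dsum (Isom.refl _)))
      · intro x y
        simp [h2 x.2 y.2, mul_comm]
  refine key _ (fun i => v ((Fintype.equivFin ι).symm i)) (fun i => hv _) ?_
  have := dg_reindex v (fun i => v ((Fintype.equivFin ι).symm i)) (Fintype.equivFin ι) (by simp)
  exact (this.symm.dsum (Isom.refl _)).trans (h.trans (this.dsum (Isom.refl _)))

end Witt

theorem equiv_of_sum_single {α β : Type} [Fintype α] [Fintype β] (f : α → ℚ) (g : β → ℚ)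
    (h : ∑ i, Finsupp.single (f i) (1 : ℤ) = ∑ j, Finsupp.single (g j) (1 : ℤ)) :
    ∃ e : α ≃ β, ∀ i, g (e i) = f i := by
  classical
  have hc : ∀ a : ℚ, Fintype.card {i // f i = a} = Fintype.card {j // g j = a} := by
    intro a
    have := DFunLike.congr_fun h a
    simp only [Finsupp.coe_finsetSum, Finset.sum_apply, Finsupp.single_apply,
      Finset.sum_boole] at this
    rw [Fintype.card_subtype, Fintype.card_subtype]
    exact_mod_cast this
  let E : ∀ a : ℚ, {i // f i = a} ≃ {j // g j = a} := fun a => Fintype.equivOfCardEq (hc a)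
  refine ⟨(Equiv.sigmaFiberEquiv f).symm.trans
    ((Equiv.sigmaCongrRight E).trans (Equiv.sigmaFiberEquiv g)), ?_⟩
  intro i
  exact (E (f i) ⟨i, rfl⟩).2

/-- The subgroup of relations defining the Grothendieck-Witt group. -/
def relW : AddSubgroup (ℚ →₀ ℤ) where
  carrier := {x | ∃ (ι : Type) (_ : Fintype ι) (v w : ι → ℚ), (∀ i, v i ≠ 0) ∧ (∀ i, w i ≠ 0) ∧
    Isom (dg v) (dg w) ∧ x = ∑ i, Finsupp.single (v i) (1 : ℤ) - ∑ i, Finsupp.single (w i) (1 : ℤ)}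
  zero_mem' := ⟨Empty, inferInstance, fun _ => 1, fun _ => 1, by simp, by simp, Isom.refl _, by simp⟩
  add_mem' := by
    rintro x y ⟨ι, _, v, w, hv, hw, h, rfl⟩ ⟨κ, _, v', w', hv', hw', h', rfl⟩
    refine ⟨ι ⊕ κ, inferInstance, Sum.elim v v', Sum.elim w w', ?_, ?_, ?_, ?_⟩
    · rintro (i | i) <;> simp [hv, hv']
    · rintro (i | i) <;> simp [hw, hw']
    · exact (dg_sum _ _).trans ((h.dsum h').trans (dg_sum _ _).symm)
    · simp; abel
  neg_mem' := by
    rintro x ⟨ι, _, v, w, hv, hw, h, rfl⟩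
    exact ⟨ι, _, w, v, hw, hv, h.symm, by simp⟩

/-- The Grothendieck-Witt group of ℚ. -/
def GW : Type := (ℚ →₀ ℤ) ⧸ relW

noncomputable instance : AddCommGroup GW := inferInstanceAs (AddCommGroup ((ℚ →₀ ℤ) ⧸ relW))

/-- The projection to the Grothendieck-Witt group. -/
noncomputable def mkW : (ℚ →₀ ℤ) →+ GW := QuotientAddGroup.mk' relW

theorem mkW_eq (x y : ℚ →₀ ℤ) : mkW x = mkW y ↔ x - y ∈ relW := QuotientAddGroup.eq_iff_sub_mem

/-- The class of a rank one form. -/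
noncomputable def cls (a : ℚ) : GW :=
  if a = 0 then 0 else mkW (Finsupp.single a (1 : ℤ))

theorem cls_zero : cls 0 = 0 := by simp [cls]

theorem sum_cls {ι : Type} [Fintype ι] (v : ι → ℚ) (hv : ∀ i, v i ≠ 0) :
    ∑ i, cls (v i) = mkW (∑ i, Finsupp.single (v i) (1 : ℤ)) := by
  have : ∀ i, cls (v i) = mkW (Finsupp.single (v i) (1 : ℤ)) := by
    intro i
    simp [cls, hv i]
  simp only [this]
  rw [← map_sum]

theorem sum_cls_eq {ι : Type} [Fintype ι] (v w : ι → ℚ) (hv : ∀ i, v i ≠ 0) (hw : ∀ i, w i ≠ 0)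
    (h : Isom (dg v) (dg w)) : ∑ i, cls (v i) = ∑ i, cls (w i) := by
  rw [sum_cls v hv, sum_cls w hw]
  refine (mkW_eq _ _).2 ?_
  exact ⟨ι, _, v, w, hv, hw, h, rfl⟩

theorem isom_of_sum_cls {ι κ : Type} [Fintype ι] [Fintype κ] (v : ι → ℚ) (w : κ → ℚ)
    (hv : ∀ i, v i ≠ 0) (hw : ∀ i, w i ≠ 0)
    (h : ∑ i, cls (v i) = ∑ i, cls (w i)) : Isom (dg v) (dg w) := by
  rw [sum_cls v hv, sum_cls w hw] at h
  obtain ⟨α, _, v', w', hv', hw', hi, he⟩ := (mkW_eq _ _).1 h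
  obtain ⟨e, he'⟩ := equiv_of_sum_single (Sum.elim w' v) (Sum.elim v' w) (by
    simp
    rw [sub_eq_sub_iff_add_eq_add] at he
    rw [add_comm, he])
  have h1 := dg_reindex (Sum.elim w' v) (Sum.elim v' w) e he'
  refine witt_cancel w' hw' (fun x y => by simp [mul_comm]) ?_
  exact (dg_sum _ _).symm.trans (h1.trans ((dg_sum _ _).trans (hi.dsum (Isom.refl _))))

theorem cls_mul_sq (a c : ℚ) (hc : c ≠ 0) : cls (a * c ^ 2) = cls a := by
  by_cases ha : a = 0
  · simp [ha]
  have := sum_cls_eq (fun _ : Unit => a * c ^ 2) (fun _ => a) (by simp [ha, hc]) (by simp [ha])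
    ⟨LinearEquiv.smulOfNeZero ℚ (Unit → ℚ) c hc, by intro x y; simp; ring⟩
  simpa using this

theorem cls_add (a b : ℚ) (ha : a ≠ 0) (hb : b ≠ 0) (hab : a + b ≠ 0) :
    cls a + cls b = cls (a + b) + cls (a * b * (a + b)) := by
  have hM : IsUnit (!![1, -b; 1, a] : Matrix (Fin 2) (Fin 2) ℚ).det := by
    simp [Matrix.det_fin_two]
    exact hab
  have := sum_cls_eq ![a + b, a * b * (a + b)] ![a, b] (by simp [Fin.forall_fin_two, *])
    (by simp [Fin.forall_fin_two, *])
    ⟨Matrix.toLinearEquiv' _ ((Matrix.isUnit_iff_isUnit_det _).2 hM).invertible, by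
      intro x y
      simp [Matrix.toLinearEquiv', dotProduct, Fin.sum_univ_two]
      ring⟩
  simpa using this.symm

theorem cls_neg (a : ℚ) (ha : a ≠ 0) : cls a + cls (-a) = cls 1 + cls (-1) := by
  have hM : IsUnit (!![(a + 1) / 2, (a - 1) / 2; (a - 1) / 2, (a + 1) / 2] :
      Matrix (Fin 2) (Fin 2) ℚ).det := by
    have : (!![(a + 1) / 2, (a - 1) / 2; (a - 1) / 2, (a + 1) / 2] :
      Matrix (Fin 2) (Fin 2) ℚ).det = a := by
      simp [Matrix.det_fin_two]
      ring
    rw [this]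
    exact isUnit_iff_ne_zero.2 ha
  have := sum_cls_eq ![a, -a] ![1, -1] (by simp [Fin.forall_fin_two, *])
    (by simp [Fin.forall_fin_two])
    ⟨Matrix.toLinearEquiv' _ ((Matrix.isUnit_iff_isUnit_det _).2 hM).invertible, by
      intro x y
      simp [Matrix.toLinearEquiv', dotProduct, Fin.sum_univ_two]
      ring⟩
  simpa using this

/-- Nonzero integers all of whose prime factors are less than `k`. -/
def Sm (k : ℕ) (a : ℤ) : Prop := a ≠ 0 ∧ ∀ q : ℕ, q.Prime → (q : ℤ) ∣ a → q < k

theorem Sm.mul {k : ℕ} {a b : ℤ} (ha : Sm k a) (hb : Sm k b) : Sm k (a * b) := by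
  refine ⟨mul_ne_zero ha.1 hb.1, fun q hq hd => ?_⟩
  rcases (Int.Prime.dvd_mul' hq hd) with h | h
  · exact ha.2 q hq h
  · exact hb.2 q hq h

theorem Sm.of_lt {k : ℕ} {a : ℤ} (ha : a ≠ 0) (h : |a| < k) : Sm k a := by
  refine ⟨ha, fun q _ hd => ?_⟩
  have := Int.le_of_dvd (abs_pos.2 ha) ((dvd_abs _ _).2 hd)
  omega

theorem Sm.one (k : ℕ) : Sm k 1 := by
  refine ⟨one_ne_zero, fun q hq hd => ?_⟩
  have := Int.eq_one_of_dvd_one (by positivity) hd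
  have h2 := hq.one_lt
  omega

theorem Sm.neg {k : ℕ} {a : ℤ} (h : Sm k a) : Sm k (-a) :=
  ⟨neg_ne_zero.2 h.1, fun q hq hd => h.2 q hq ((dvd_neg).1 hd)⟩

/-- Subgroup generated by smooth classes. -/
noncomputable def GS (k : ℕ) : AddSubgroup GW := AddSubgroup.closure {x | ∃ a : ℤ, Sm k a ∧ x = cls (a : ℚ)}

theorem cls_mem_GS {k : ℕ} {a : ℤ} (h : Sm k a) : cls (a : ℚ) ∈ GS k :=
  AddSubgroup.subset_closure ⟨a, h, rfl⟩

theorem milnor_K0 (p : ℕ) (hp : p.Prime) (a b r m t : ℤ) (ha : a ≠ 0) (hb : b ≠ 0) (hr : r ≠ 0)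
    (ha' : |a| < p) (hb' : |b| < p) (hr' : |r| < p) (h : a * b = r + p * m) (ht : Sm p t) :
    cls ((p * t * (a * b) : ℤ) : ℚ) - cls ((p * t * r : ℤ) : ℚ) ∈ GS p := by
  by_cases hm : m = 0
  · subst hm
    rw [h]
    simp [(GS p).zero_mem]
  have hp0 : (p : ℚ) ≠ 0 := by exact_mod_cast hp.ne_zero
  have hm' : |m| < p := by
    have h1 : (p : ℤ) * |m| ≤ |a| * |b| + |r| := by
      rw [← abs_mul, ← Nat.abs_cast p, ← abs_mul, abs_le]
      have e : (p : ℤ) * m = a * b - r := by linarith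
      rw [e]
      have := neg_abs_le (a * b)
      have := le_abs_self (a * b)
      have := neg_abs_le r
      have := le_abs_self r
      constructor <;> linarith
    have h2 : |a| * |b| ≤ (p - 1) * (p - 1) := by
      have := hp.one_lt; apply mul_le_mul <;> first | omega | positivity
    by_contra hcon
    push Not at hcon
    have h3 : (p : ℤ) * p ≤ p * |m| := by gcongr
    have : 0 < p := hp.pos
    nlinarith
  have hQ : (a : ℚ) * b = r + p * m := by exact_mod_cast h
  have e1 := cls_add ((p * t * r : ℤ) : ℚ) ((p * p * t * m : ℤ) : ℚ)
    (by have := ht.1; have := hp.ne_zero; exact_mod_cast (by simp [*]))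
    (by have := ht.1; have := hp.ne_zero; exact_mod_cast (by simp [*]))
    (by
      have e : ((p * t * r : ℤ) : ℚ) + ((p * p * t * m : ℤ) : ℚ) = ((p * t * (a * b) : ℤ) : ℚ) := by
        push_cast; rw [hQ]; ring
      rw [e]
      have h1 := ht.1; have h2 := hp.ne_zero; exact_mod_cast (by simp [h1, h2, ha, hb]))
  have e : ((p * t * r : ℤ) : ℚ) + ((p * p * t * m : ℤ) : ℚ) = ((p * t * (a * b) : ℤ) : ℚ) := by
        push_cast; rw [hQ]; ring
  rw [e] at e1
  have e2 : cls ((p * p * t * m : ℤ) : ℚ) = cls ((t * m : ℤ) : ℚ) := by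
    rw [← cls_mul_sq ((t * m : ℤ) : ℚ) p hp0]
    congr 1
    push_cast
    ring
  have e3 : cls (((p * t * r : ℤ) : ℚ) * ((p * p * t * m : ℤ) : ℚ) * ((p * t * (a * b) : ℤ) : ℚ))
      = cls ((t * r * m * (a * b) : ℤ) : ℚ) := by
    rw [← cls_mul_sq ((t * r * m * (a * b) : ℤ) : ℚ) (p ^ 2 * t)
      (mul_ne_zero (pow_ne_zero _ hp0) (by exact_mod_cast ht.1))]
    congr 1
    push_cast
    ring
  rw [e2, e3] at e1
  have e4 : cls ((p * t * (a * b) : ℤ) : ℚ) - cls ((p * t * r : ℤ) : ℚ)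
      = cls ((t * m : ℤ) : ℚ) - cls ((t * r * m * (a * b) : ℤ) : ℚ) := by
    rw [sub_eq_sub_iff_add_eq_add, ← e1]
    abel
  rw [e4]
  have sm := Sm.of_lt hm hm'
  have sr := Sm.of_lt hr hr'
  have sa := Sm.of_lt ha ha'
  have sb := Sm.of_lt hb hb'
  exact (GS p).sub_mem (cls_mem_GS (ht.mul sm)) (cls_mem_GS (((ht.mul sr).mul sm).mul (sa.mul sb)))

theorem not_dvd_of_abs_lt {p : ℕ} {a : ℤ} (ha : a ≠ 0) (h : |a| < p) : ¬ (p : ℤ) ∣ a := by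
  intro hd
  have := Int.le_of_dvd (abs_pos.2 ha) ((dvd_abs _ _).2 hd)
  omega

theorem milnor_K1 (p : ℕ) (hp : p.Prime) (n : ℤ) : Sm p n →
    ∃ r : ℤ, |r| < p ∧ r ≠ 0 ∧ (r : ZMod p) = n ∧
      ∀ t, Sm p t → cls ((p * t * n : ℤ) : ℚ) - cls ((p * t * r : ℤ) : ℚ) ∈ GS p := by
  induction n using UniqueFactorizationMonoid.induction_on_prime with
  | h₁ => intro h; exact absurd rfl h.1
  | h₂ x hx =>
    intro h
    refine ⟨x, ?_, h.1, rfl, fun t _ => by simp [(GS p).zero_mem]⟩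
    have := hp.one_lt
    rcases Int.isUnit_iff.1 hx with rfl | rfl <;> simp <;> omega
  | h₃ a q ha hq ih =>
    intro h
    have sq : Sm p q := ⟨hq.ne_zero, fun l hl hd => h.2 l hl (hd.mul_right _)⟩
    have sa : Sm p a := ⟨ha, fun l hl hd => h.2 l hl (hd.mul_left _)⟩
    obtain ⟨r', h1, h2, h3, h4⟩ := ih sa
    have hq' : |q| < p := by
      have := sq.2 q.natAbs (Int.prime_iff_natAbs_prime.1 hq) (by simp)
      rw [Int.abs_eq_natAbs]
      exact_mod_cast this
    have hpp := Nat.prime_iff_prime_int.1 hp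
    have hp0 : (p : ℤ) ≠ 0 := hpp.ne_zero
    have hnd : ¬ (p : ℤ) ∣ q * r' := by
      intro hd
      rcases hpp.dvd_or_dvd hd with hd | hd
      · exact not_dvd_of_abs_lt hq.ne_zero hq' hd
      · exact not_dvd_of_abs_lt h2 h1 hd
    have hr0 : (q * r') % p ≠ 0 := fun hh => hnd (Int.dvd_of_emod_eq_zero hh)
    have hrl : |(q * r') % p| < p := by
      rw [abs_of_nonneg (Int.emod_nonneg _ hp0)]
      exact Int.emod_lt_of_pos _ (by have := hp.pos; omega)
    refine ⟨(q * r') % p, hrl, hr0, ?_, ?_⟩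
    · rw [ZMod.intCast_mod]
      push_cast
      rw [h3]
    · intro t ht
      have A := h4 (t * q) (ht.mul sq)
      have B := milnor_K0 p hp q r' ((q * r') % p) ((q * r') / p) t hq.ne_zero h2 hr0 hq' h1 hrl
        (Int.emod_add_mul_ediv _ _).symm ht
      have C := (GS p).add_mem A B
      have e1 : (p * (t * q) * a : ℤ) = p * t * (q * a) := by ring
      have e2 : (p * (t * q) * r' : ℤ) = p * t * (q * r') := by ring
      rw [e1, e2] at C
      simpa using C

/-- The quotient by the smooth subgroup. -/
def QP (p : ℕ) : Type := GW ⧸ GS p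

noncomputable instance (p : ℕ) : AddCommGroup (QP p) := inferInstanceAs (AddCommGroup (GW ⧸ GS p))

/-- The projection. -/
noncomputable def mkQ (p : ℕ) : GW →+ QP p := QuotientAddGroup.mk' (GS p)

theorem mkQ_eq (p : ℕ) (x y : GW) : mkQ p x = mkQ p y ↔ x - y ∈ GS p :=
  QuotientAddGroup.eq_iff_sub_mem

theorem mkQ_eq_zero (p : ℕ) (x : GW) : mkQ p x = 0 ↔ x ∈ GS p := by
  have := mkQ_eq p x 0
  simpa using this

theorem val_pos_of {p : ℕ} {u : ZMod p} (hu : u ≠ 0) : (u.val : ℤ) ≠ 0 := by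
  exact_mod_cast (by rwa [Ne, ZMod.val_eq_zero] : u.val ≠ 0)

theorem val_abs_lt {p : ℕ} [NeZero p] (u : ZMod p) : |(u.val : ℤ)| < p := by
  rw [Nat.abs_cast]
  exact_mod_cast ZMod.val_lt u

/-- The second residue parametrisation. -/
noncomputable def ff (p : ℕ) (u : ZMod p) : QP p :=
  mkQ p (cls ((p * (u.val : ℤ) : ℤ) : ℚ))

theorem ff_zero (p : ℕ) [NeZero p] : ff p 0 = 0 := by
  simp [ff, cls_zero]

theorem ff_eq (p : ℕ) (hp : p.Prime) (n : ℤ) (hn : Sm p n) :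
    mkQ p (cls ((p * n : ℤ) : ℚ)) = ff p (n : ZMod p) := by
  have := Fact.mk hp
  obtain ⟨r, h1, h2, h3, h4⟩ := milnor_K1 p hp n hn
  have A := h4 1 (Sm.one p)
  have hv : (((n : ZMod p).val : ℤ) : ZMod p) = r := by rw [h3]; simp
  have hd : (p : ℤ) ∣ r - ((n : ZMod p).val : ℤ) := by
    rw [← ZMod.intCast_zmod_eq_zero_iff_dvd]
    push_cast
    push_cast at hv
    rw [hv, sub_self]
  obtain ⟨m, hm⟩ := hd
  have hn0 : (n : ZMod p) ≠ 0 := by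
    rw [← h3]
    intro hh
    exact not_dvd_of_abs_lt h2 h1 ((ZMod.intCast_zmod_eq_zero_iff_dvd _ _).1 hh)
  have hvl : (n : ZMod p).val < p := ZMod.val_lt _
  have hv0 : (n : ZMod p).val ≠ 0 := by rwa [Ne, ZMod.val_eq_zero]
  have := hp.one_lt
  have B := milnor_K0 p hp r 1 ((n : ZMod p).val : ℤ) m 1 h2 one_ne_zero (by exact_mod_cast hv0) h1
    (by simp; omega) (val_abs_lt _) (by linarith) (Sm.one p)
  have C := (GS p).add_mem A B
  simp only [mul_one, sub_add_sub_cancel] at C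
  exact (mkQ_eq _ _ _).2 C

theorem ff_mul_sq (p : ℕ) (hp : p.Prime) (u z : ZMod p) (hz : z ≠ 0) :
    ff p (u * z ^ 2) = ff p u := by
  have := Fact.mk hp
  by_cases hu : u = 0
  · simp [hu]
  have su : Sm p (u.val : ℤ) := Sm.of_lt (val_pos_of hu) (val_abs_lt _)
  have sz : Sm p (z.val : ℤ) := Sm.of_lt (val_pos_of hz) (val_abs_lt _)
  have := ff_eq p hp (u.val * (z.val * z.val)) (su.mul (sz.mul sz))
  have e : (((u.val : ℤ) * ((z.val : ℤ) * z.val) : ℤ) : ZMod p) = u * z ^ 2 := by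
    push_cast
    simp [sq]
  rw [e] at this
  rw [← this, ff]
  congr 1
  rw [← cls_mul_sq ((p * (u.val : ℤ) : ℤ) : ℚ) (z.val : ℚ) (by exact_mod_cast (by simpa using hz))]
  congr 1
  push_cast
  ring

theorem ff_add (p : ℕ) (hp : p.Prime) (u v : ZMod p) (hu : u ≠ 0) (hv : v ≠ 0) :
    ff p u + ff p v = ff p (u + v) + ff p (u * v * (u + v)) := by
  have := Fact.mk hp
  have hul := ZMod.val_lt u
  have hvl := ZMod.val_lt v
  have hu0 : u.val ≠ 0 := by simpa using hu
  have hv0 : v.val ≠ 0 := by simpa using hv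
  have hp0 : (p : ℚ) ≠ 0 := by exact_mod_cast hp.ne_zero
  obtain ⟨a, ha⟩ : ∃ a : ℤ, a = u.val := ⟨_, rfl⟩
  obtain ⟨b, hb⟩ : ∃ b : ℤ, b = v.val - p := ⟨_, rfl⟩
  have ea : (a : ZMod p) = u := by simp [ha]
  have eb : (b : ZMod p) = v := by simp [hb]
  have ha0 : a ≠ 0 := by omega
  have hb0 : b ≠ 0 := by omega
  have sa : Sm p a := Sm.of_lt ha0 (by rw [abs_lt]; omega)
  have sb : Sm p b := Sm.of_lt hb0 (by rw [abs_lt]; omega)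
  rw [← ea, ← eb, ← ff_eq p hp a sa, ← ff_eq p hp b sb]
  have ha1 : (a : ℚ) ≠ 0 := by exact_mod_cast ha0
  have hb1 : (b : ℚ) ≠ 0 := by exact_mod_cast hb0
  by_cases hab : a + b = 0
  · have hb' : b = -a := by omega
    have : ff p ((a : ZMod p) + (b : ZMod p)) + ff p (a * b * ((a : ZMod p) + (b : ZMod p))) = 0 := by
      have : (a : ZMod p) + (b : ZMod p) = 0 := by exact_mod_cast congrArg (Int.cast : ℤ → ZMod p) hab
      simp [this, ff_zero]
    rw [this, hb', ← map_add, mkQ_eq_zero]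
    have := cls_neg ((p * a : ℤ) : ℚ) (by push_cast; exact mul_ne_zero hp0 ha1)
    have e : ((p * -a : ℤ) : ℚ) = -((p * a : ℤ) : ℚ) := by push_cast; ring
    rw [e, this]
    have h1 := cls_mem_GS (Sm.one p)
    have h2 := cls_mem_GS (Sm.one p).neg
    push_cast at h1 h2
    exact (GS p).add_mem h1 h2
  · have sab : Sm p (a + b) := Sm.of_lt hab (by rw [abs_lt]; omega)
    have hab1 : (a : ℚ) + b ≠ 0 := by exact_mod_cast hab
    have e1 := ff_eq p hp _ sab
    have e2 := ff_eq p hp _ ((sa.mul sb).mul sab)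
    push_cast at e1 e2 ⊢
    rw [← e1, ← e2, ← map_add, ← map_add]
    have := cls_add (p * a : ℚ) (p * b) (mul_ne_zero hp0 ha1) (mul_ne_zero hp0 hb1)
      (by rw [← mul_add]; exact mul_ne_zero hp0 hab1)
    rw [this]
    congr 2
    · congr 1; ring
    · rw [← cls_mul_sq (p * (a * b * (a + b)) : ℚ) (p : ℚ) hp0]
      congr 1
      ring

theorem ff_neg (p : ℕ) (hp : p.Prime) (u : ZMod p) : ff p (-u) = - ff p u := by
  have := Fact.mk hp
  by_cases hu : u = 0
  · simp [hu, ff_zero]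
  have := ff_add p hp u (-u) hu (neg_ne_zero.2 hu)
  simp [ff_zero] at this
  exact (neg_eq_of_add_eq_zero_right this).symm

theorem ff_list (p : ℕ) (hp : p.Prime) (x : GW) (hx : x ∈ GS (p + 1)) :
    ∃ l : List (ZMod p), (∀ u ∈ l, u ≠ 0) ∧
      mkQ p x = (l.map (ff p)).sum := by
  have := Fact.mk hp
  have hpp := Nat.prime_iff_prime_int.1 hp
  have hp0 : (p : ℚ) ≠ 0 := by exact_mod_cast hp.ne_zero
  induction hx using AddSubgroup.closure_induction with
  | mem x hx =>
    obtain ⟨a, ha, rfl⟩ := hx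
    obtain ⟨n, hn, hna⟩ := (Int.finiteMultiplicity_iff (a := (p : ℤ)) (b := a)).2
      ⟨by simpa using hp.ne_one, ha.1⟩ |>.exists_eq_pow_mul_and_not_dvd
    have sn : Sm p n := by
      refine ⟨by rintro rfl; simp at hna, fun q hq hd => ?_⟩
      have := ha.2 q hq (by rw [hn]; exact hd.mul_left _)
      rcases Nat.lt_succ_iff_lt_or_eq.1 this with h | h
      · exact h
      · subst h; exact absurd hd hna
    rcases Nat.even_or_odd' (multiplicity (p : ℤ) a) with ⟨k, hk | hk⟩
    · refine ⟨[], by simp, ?_⟩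
      have : cls (a : ℚ) = cls (n : ℚ) := by
        rw [← cls_mul_sq (n : ℚ) (p ^ k) (pow_ne_zero _ hp0), hn, hk]
        congr 1
        push_cast
        ring
      rw [this]
      simpa using (mkQ_eq_zero _ _).2 (cls_mem_GS sn)
    · refine ⟨[(n : ZMod p)], ?_, ?_⟩
      · simpa [ZMod.intCast_zmod_eq_zero_iff_dvd] using hna
      have : cls (a : ℚ) = cls ((p * n : ℤ) : ℚ) := by
        rw [← cls_mul_sq ((p * n : ℤ) : ℚ) (p ^ k) (pow_ne_zero _ hp0), hn, hk]
        congr 1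
        push_cast
        ring
      rw [this, ff_eq p hp n sn]
      simp
  | zero => exact ⟨[], by simp, by simp⟩
  | add x y _ _ hx hy =>
    obtain ⟨l, h1, h2⟩ := hx
    obtain ⟨l', h1', h2'⟩ := hy
    refine ⟨l ++ l', ?_, ?_⟩
    · intro u hu
      rcases List.mem_append.1 hu with h | h
      · exact h1 u h
      · exact h1' u h
    · simp [h2, h2']
  | neg x _ hx =>
    obtain ⟨l, h1, h2⟩ := hx
    refine ⟨l.map (fun u => -u), ?_, ?_⟩
    · intro u hu
      obtain ⟨v, hv, rfl⟩ := List.mem_map.1 hu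
      exact neg_ne_zero.2 (h1 v hv)
    · rw [map_neg, h2]
      clear h1 h2
      induction l with
      | nil => simp
      | cons a l ih =>
        simp only [List.map_cons, List.sum_cons, neg_add] at ih ⊢
        rw [ih, ff_neg p hp]

theorem ff_red (p : ℕ) (hp : p.Prime) (n : ℕ) : ∀ l : List (ZMod p), l.length = n → l ≠ [] →
    (∀ u ∈ l, u ≠ 0) → l.sum = 0 →
    ∃ l' : List (ZMod p), (∀ u ∈ l', u ≠ 0) ∧ l'.length < l.length ∧
      (l.map (ff p)).sum = (l'.map (ff p)).sum := by
  have := Fact.mk hp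
  induction n with
  | zero => intro l hl h; exact absurd (List.length_eq_zero_iff.1 hl) h
  | succ n ih =>
    intro l hl hne h0 hs
    match l, hl, hne, h0, hs with
    | [a], _, _, h0, hs => simp at h0 hs; exact absurd hs h0
    | a :: b :: t, hl, _, h0, hs =>
      have ha : a ≠ 0 := h0 a (by simp)
      have hb : b ≠ 0 := h0 b (by simp)
      have ht : ∀ u ∈ t, u ≠ 0 := fun u hu => h0 u (by simp [hu])
      have hadd := ff_add p hp a b ha hb
      by_cases hab : a + b = 0
      · refine ⟨t, ht, by simp, ?_⟩
        simp only [hab, mul_zero, ff_zero, add_zero] at hadd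
        simp only [List.map_cons, List.sum_cons]
        rw [← add_assoc, hadd, zero_add]
      · obtain ⟨l', h1, h2, h3⟩ := ih ((a + b) :: t) (by simp at hl ⊢; omega) (by simp)
          (by
            intro u hu
            rcases List.mem_cons.1 hu with rfl | hu
            · exact hab
            · exact ht u hu)
          (by simpa [add_assoc] using hs)
        refine ⟨(a * b * (a + b)) :: l', ?_, ?_, ?_⟩
        · intro u hu
          rcases List.mem_cons.1 hu with rfl | hu
          · exact mul_ne_zero (mul_ne_zero ha hb) hab
          · exact h1 u hu
        · simp at h2 ⊢; omega
        · simp only [List.map_cons, List.sum_cons] at h3 ⊢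
          rw [← h3, ← add_assoc, hadd]
          abel

theorem sum_map_eq {α M : Type} [AddCommMonoid M] (f : α → M) (l : List α) :
    (l.map f).sum = ∑ i, f (l.get i) := by
  rw [← List.sum_ofFn]
  congr 1
  conv_lhs => rw [← List.ofFn_get (l := l)]
  rw [List.map_ofFn]
  rfl

theorem ff_aniso (p : ℕ) (hp : p.Prime) (n : ℕ) : ∀ l : List (ZMod p), l.length = n →
    (∀ u ∈ l, u ≠ 0) →
    ∃ (m : ℕ) (u : Fin m → ZMod p), (∀ i, u i ≠ 0) ∧ (l.map (ff p)).sum = ∑ i, ff p (u i) ∧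
      ∀ z : Fin m → ZMod p, ∑ i, u i * z i ^ 2 = 0 → z = 0 := by
  have := Fact.mk hp
  induction n using Nat.strong_induction_on with
  | _ n ih =>
    intro l hl h0
    by_cases han : ∀ z : Fin l.length → ZMod p, ∑ i, l.get i * z i ^ 2 = 0 → z = 0
    · refine ⟨l.length, l.get, fun i => h0 _ (List.get_mem _ _), ?_, han⟩
      exact sum_map_eq _ _
    · push Not at han
      obtain ⟨z, hz, hz0⟩ := han
      classical
      let s := Finset.univ.filter (fun i => z i ≠ 0)
      let t := Finset.univ.filter (fun i => ¬ z i ≠ 0)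
      let r := s.toList.map (fun i => l.get i * z i ^ 2)
      obtain ⟨r', h1, h2, h3⟩ := ff_red p hp _ r rfl
        (by
          intro hr
          apply hz0
          ext i
          by_contra hi
          have : i ∈ s.toList := by simp [s]; exact hi
          simp only [r, List.map_eq_nil_iff] at hr
          rw [hr] at this
          simp at this)
        (by
          intro u hu
          simp only [r, List.mem_map, Finset.mem_toList] at hu
          obtain ⟨i, hi, rfl⟩ := hu
          exact mul_ne_zero (h0 _ (List.get_mem _ _)) (pow_ne_zero _ (by simpa [s] using hi)))
        (by
          simp only [r]
          rw [Finset.sum_map_toList, Finset.sum_filter]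
          refine Eq.trans ?_ hz
          apply Finset.sum_congr rfl
          intro i _
          split_ifs with h
          · rfl
          · push Not at h; simp [h])
      have hcard : s.card + t.card = l.length := by
        rw [Finset.card_filter_add_card_filter_not]; simp
      have hr : r.length = s.card := by simp [r]
      obtain ⟨m, u, hu, hs, ha⟩ := ih (r' ++ t.toList.map l.get).length
        (by rw [List.length_append, List.length_map, Finset.length_toList]; omega)
        (r' ++ t.toList.map l.get) rfl
        (by
          intro u hu
          rcases List.mem_append.1 hu with h | h
          · exact h1 u h
          · obtain ⟨i, _, rfl⟩ := List.mem_map.1 h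
            exact h0 _ (List.get_mem _ _))
      refine ⟨m, u, hu, ?_, ha⟩
      rw [← hs, List.map_append, List.sum_append, ← h3]
      simp only [r, List.map_map]
      rw [Finset.sum_map_toList, Finset.sum_map_toList]
      have : ∑ x ∈ s, (ff p ∘ fun i => l.get i * z i ^ 2) x = ∑ x ∈ s, (ff p ∘ l.get) x := by
        apply Finset.sum_congr rfl
        intro i hi
        exact ff_mul_sq p hp _ _ (by simpa [s] using hi)
      rw [this, Finset.sum_filter_add_sum_filter_not]
      exact sum_map_eq _ _

section Lattice
variable {ι κ : Type} [Fintype ι] [Fintype κ] [DecidableEq ι] [DecidableEq κ]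

/-- reduction mod p -/
def redp (p : ℕ) (x : (ι → ℤ) × (κ → ℤ)) : (ι → ZMod p) × (κ → ZMod p) :=
  (fun i => (x.1 i : ZMod p), fun i => (x.2 i : ZMod p))

theorem redp_eq_zero (p : ℕ) (x : (ι → ℤ) × (κ → ℤ)) (h : redp p x = 0) :
    ∃ m : (ι → ℤ) × (κ → ℤ), x = (p : ℤ) • m := by
  have h1 : ∀ i, (p : ℤ) ∣ x.1 i := fun i =>
    (ZMod.intCast_zmod_eq_zero_iff_dvd _ _).1 (congrFun (congrArg Prod.fst h) i)
  have h2 : ∀ i, (p : ℤ) ∣ x.2 i := fun i =>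
    (ZMod.intCast_zmod_eq_zero_iff_dvd _ _).1 (congrFun (congrArg Prod.snd h) i)
  choose a ha using h1
  choose b hb using h2
  exact ⟨(a, b), Prod.ext (funext fun i => by simp [ha]) (funext fun i => by simp [hb])⟩

/-- The graph lattice -/
def graphL (e : (κ → ℚ) ≃ₗ[ℚ] (ι → ℚ)) : Submodule ℤ ((ι → ℤ) × (κ → ℤ)) where
  carrier := {x | (fun i => (x.1 i : ℚ)) = e (fun j => (x.2 j : ℚ))}
  zero_mem' := by
    change _ = _
    have : (fun j : κ => (((0 : (ι → ℤ) × (κ → ℤ)).2 j : ℤ) : ℚ)) = 0 := by ext; simp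
    rw [this, map_zero]
    ext; simp
  add_mem' := by
    intro x y hx hy
    change _ = _ at hx hy ⊢
    have : (fun j : κ => (((x + y).2 j : ℤ) : ℚ)) = (fun j => (x.2 j : ℚ)) + (fun j => (y.2 j : ℚ)) := by
      ext; simp
    rw [this, map_add, ← hx, ← hy]
    ext; simp
  smul_mem' := by
    intro c x hx
    change _ = _ at hx ⊢
    have : (fun j : κ => (((c • x).2 j : ℤ) : ℚ)) = (c : ℚ) • (fun j => (x.2 j : ℚ)) := by
      ext; simp
    rw [this, map_smul, ← hx]
    ext; simp

theorem mem_graphL (e : (κ → ℚ) ≃ₗ[ℚ] (ι → ℚ)) (x : (ι → ℤ) × (κ → ℤ)) :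
    x ∈ graphL e ↔ (fun i => (x.1 i : ℚ)) = e (fun j => (x.2 j : ℚ)) := Iff.rfl

theorem graphL_sat (e : (κ → ℚ) ≃ₗ[ℚ] (ι → ℚ)) (c : ℤ) (hc : c ≠ 0) (x : (ι → ℤ) × (κ → ℤ))
    (h : c • x ∈ graphL e) : x ∈ graphL e := by
  rw [mem_graphL] at h ⊢
  have h1 : (fun j : κ => (((c • x).2 j : ℤ) : ℚ)) = (c : ℚ) • (fun j => (x.2 j : ℚ)) := by
    ext; simp
  have h2 : (fun j : ι => (((c • x).1 j : ℤ) : ℚ)) = (c : ℚ) • (fun j => (x.1 j : ℚ)) := by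
    ext; simp
  rw [h1, h2, map_smul] at h
  exact smul_right_injective _ (by exact_mod_cast hc : (c : ℚ) ≠ 0) h

theorem graphL_rank (e : (κ → ℚ) ≃ₗ[ℚ] (ι → ℚ)) : Fintype.card κ ≤ Module.finrank ℤ (graphL e) := by
  -- clear denominators
  have hden : ∃ N : ℤ, N ≠ 0 ∧ ∀ (j : κ) (i : ι), ∃ a : ℤ, (a : ℚ) = N * e (Pi.single j 1) i := by
    obtain ⟨N, hN⟩ := IsLocalization.exist_integer_multiples_of_finset (nonZeroDivisors ℤ)
      ((Finset.univ : Finset (κ × ι)).image (fun q => e (Pi.single q.1 1) q.2))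
    refine ⟨N, nonZeroDivisors.coe_ne_zero N, fun j i => ?_⟩
    obtain ⟨a, ha⟩ := hN (e (Pi.single j 1) i) (Finset.mem_image.2 ⟨(j, i), by simp, rfl⟩)
    exact ⟨a, by simpa using ha⟩
  obtain ⟨N, hN, hA⟩ := hden
  choose a ha using hA
  have hmem : ∀ j, ((a j, N • Pi.single j 1) : (ι → ℤ) × (κ → ℤ)) ∈ graphL e := by
    intro j
    rw [mem_graphL]
    have : (fun k : κ => (((N • Pi.single j 1 : κ → ℤ) k : ℤ) : ℚ)) = (N : ℚ) • Pi.single j 1 := by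
      ext k
      by_cases hk : k = j
      · subst hk; simp
      · simp [hk]
    simp only [this, map_smul]
    ext i
    simp [ha]
  have hli : LinearIndependent ℤ (fun j : κ => (⟨_, hmem j⟩ : graphL e)) := by
    rw [Fintype.linearIndependent_iff]
    intro g hg j
    have h1 := congrArg (fun x : graphL e => (x : (ι → ℤ) × (κ → ℤ)).2 j) hg
    simp only [AddSubmonoidClass.coe_finsetSum, Submodule.coe_smul, Prod.snd_sum, Prod.smul_snd,
      Finset.sum_apply, Pi.smul_apply, smul_eq_mul] at h1
    rw [Finset.sum_eq_single j] at h1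
    · simpa [hN] using h1
    · intro k _ hk
      simp [hk.symm]
    · simp
  exact hli.fintype_card_le_finrank

theorem lattice_lemma (p : ℕ) (hp : p.Prime) (S : Matrix ι ι ℤ) (hS : S.transpose = S)
    (hdet : ¬ (p : ℤ) ∣ S.det) (d : κ → ℤ)
    (hI : Isom (dg (fun i => (d i : ℚ))) (Matrix.toBilin' (S.map (Int.cast : ℤ → ℚ))))
    (i0 : κ) (hi0 : (p : ℤ) ∣ d i0) :
    ∃ c : κ → ℤ, (∃ i, ¬ (p : ℤ) ∣ c i) ∧ (∀ i, ¬ (p : ℤ) ∣ d i → (p : ℤ) ∣ c i) ∧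
      (p ^ 2 : ℤ) ∣ ∑ i, d i * c i ^ 2 := by
  have := Fact.mk hp
  obtain ⟨e, he⟩ := hI
  have hX : ∀ x ∈ graphL e, ∀ y ∈ graphL e,
      ∑ i, ∑ j, x.1 i * S i j * y.1 j = ∑ i, d i * (x.2 i * y.2 i) := by
    intro x hx y hy
    rw [mem_graphL] at hx hy
    have := he (fun j => (x.2 j : ℚ)) (fun j => (y.2 j : ℚ))
    rw [← hx, ← hy, Matrix.toBilin'_apply, dg_apply] at this
    simp only [Matrix.map_apply] at this
    exact_mod_cast this
  let C : LinearMap.BilinForm (ZMod p) ((ι → (ZMod p)) × (κ → (ZMod p))) :=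
    dsum (Matrix.toBilin' (S.map (Int.cast : ℤ → (ZMod p)))) (dg (fun i => -(d i : (ZMod p))))
  have hCapp : ∀ v w, C v w = ∑ i, ∑ j, v.1 i * (S i j : (ZMod p)) * w.1 j
      + ∑ i, -(d i : (ZMod p)) * (v.2 i * w.2 i) := by
    intro v w
    simp only [C, dsum_apply, Matrix.toBilin'_apply, dg_apply, Matrix.map_apply]
  have hCsymm : ∀ v w, C v w = C w v := by
    intro v w
    rw [hCapp, hCapp, Finset.sum_comm]
    congr 1
    · refine Finset.sum_congr rfl fun i _ => Finset.sum_congr rfl fun j _ => ?_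
      have : S j i = S i j := by conv_lhs => rw [← hS, Matrix.transpose_apply]
      rw [this]; ring
    · refine Finset.sum_congr rfl fun i _ => ?_
      ring
  have hCrefl : C.IsRefl := fun v w h => by rw [hCsymm]; exact h
  have hCX : ∀ x ∈ graphL e, ∀ y ∈ graphL e, C (redp p x) (redp p y) = 0 := by
    intro x hx y hy
    have := congrArg (Int.cast : ℤ → (ZMod p)) (hX x hx y hy)
    rw [hCapp]
    push_cast at this
    simp only [redp]
    rw [this]
    simp
  let β := Module.finBasis ℤ (graphL e)
  let fam : Fin (Module.finrank ℤ (graphL e)) → (ι → (ZMod p)) × (κ → (ZMod p)) := fun i => redp p (β i)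
  have hredsum : ∀ c : Fin (Module.finrank ℤ (graphL e)) → ℤ,
      redp p ((∑ i, c i • β i : graphL e) : (ι → ℤ) × (κ → ℤ)) = ∑ i, (c i : (ZMod p)) • fam i := by
    intro c
    ext k
    · simp [redp, fam, Prod.fst_sum, Finset.sum_apply]
    · simp [redp, fam, Prod.snd_sum, Finset.sum_apply]
  have hli : LinearIndependent (ZMod p) fam := by
    rw [Fintype.linearIndependent_iff]
    intro g hg i
    have h1 := hredsum (fun i => ((g i).val : ℤ))
    have hv : ∀ i, ((((g i).val : ℕ) : ℤ) : ZMod p) = g i := fun i => by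
      rw [Int.cast_natCast, ZMod.natCast_zmod_val]
    simp only [hv] at h1
    rw [hg] at h1
    obtain ⟨m, hm⟩ := redp_eq_zero p _ h1
    have hmX : m ∈ graphL e := graphL_sat e p (by exact_mod_cast hp.ne_zero) m (by
      rw [← hm]; exact Submodule.coe_mem _)
    have h2 : (∑ i, ((g i).val : ℤ) • β i) = (p : ℤ) • (⟨m, hmX⟩ : graphL e) := by
      apply Subtype.ext
      rw [Submodule.coe_smul, ← hm]
    have h3 := congrArg (fun x => β.repr x i) h2
    simp only [Module.Basis.repr_sum_self, map_smul, Finsupp.smul_apply, smul_eq_mul] at h3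
    have h4 := congrArg (Int.cast : ℤ → (ZMod p)) h3
    simpa using h4
  let W := Submodule.span (ZMod p) (Set.range fam)
  have hWdim : Module.finrank (ZMod p) W = Module.finrank ℤ (graphL e) := by
    rw [finrank_span_eq_card hli, Fintype.card_fin]
  have hlift : ∀ w ∈ W, ∃ x ∈ graphL e, redp p x = w := by
    intro w hw
    obtain ⟨c, rfl⟩ := (Submodule.mem_span_range_iff_exists_fun (ZMod p)).1 hw
    refine ⟨_, Submodule.coe_mem (∑ i, ((c i).val : ℤ) • β i), ?_⟩
    rw [hredsum]
    simp
  have hWW : W ≤ C.orthogonal W := by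
    intro w hw
    rw [LinearMap.BilinForm.mem_orthogonal_iff]
    intro v hv
    obtain ⟨x, hx, rfl⟩ := hlift w hw
    obtain ⟨y, hy, rfl⟩ := hlift v hv
    exact hCX y hy x hx
  have hrad : C.orthogonal ⊤ ≤ C.orthogonal W := LinearMap.BilinForm.orthogonal_le le_top
  have hcard : Fintype.card ι = Fintype.card κ := by
    have := e.finrank_eq
    simpa using this.symm
  have hdimV : Module.finrank (ZMod p) ((ι → (ZMod p)) × (κ → (ZMod p))) = 2 * Fintype.card κ := by
    rw [Module.finrank_prod]
    simp [hcard, two_mul]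
  have hmemrad : ((0, Pi.single i0 1) : (ι → (ZMod p)) × (κ → (ZMod p))) ∈ C.orthogonal ⊤ := by
    rw [LinearMap.BilinForm.mem_orthogonal_iff]
    intro v _
    change C v _ = 0
    rw [hCapp]
    have : (d i0 : (ZMod p)) = 0 := (ZMod.intCast_zmod_eq_zero_iff_dvd _ _).2 hi0
    simp only [Pi.zero_apply, mul_zero, Finset.sum_const_zero, zero_add]
    apply Finset.sum_eq_zero
    intro i _
    by_cases hi : i = i0
    · subst hi; simp [this]
    · simp [hi]
  have hne : W ⊓ C.orthogonal ⊤ ≠ ⊥ := by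
    intro hbot
    have h1 := LinearMap.BilinForm.finrank_add_finrank_orthogonal hCrefl W
    rw [hbot, finrank_bot, add_zero, hdimV] at h1
    have h2 := Submodule.finrank_sup_add_finrank_inf_eq W (C.orthogonal ⊤)
    rw [hbot, finrank_bot, add_zero] at h2
    have h3 := Submodule.finrank_mono (sup_le hWW hrad)
    have h4 : 0 < Module.finrank (ZMod p) (C.orthogonal ⊤) := by
      apply Module.finrank_pos_iff_exists_ne_zero.2
      refine ⟨⟨_, hmemrad⟩, ?_⟩
      intro hh
      have := congrFun (congrArg (fun x : C.orthogonal ⊤ => (x : (ι → (ZMod p)) × (κ → (ZMod p))).2) hh) i0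
      simp at this
    have h5 := graphL_rank e
    omega
  obtain ⟨w, hw, hw0⟩ := Submodule.exists_mem_ne_zero_of_ne_bot hne
  obtain ⟨x, hx, rfl⟩ := hlift w hw.1
  have hr := LinearMap.BilinForm.mem_orthogonal_iff.1 hw.2
  have hr1 : (redp p x).1 = 0 := by
    apply Matrix.eq_zero_of_mulVec_eq_zero (M := S.map (Int.cast : ℤ → (ZMod p)))
    · have : (S.map (Int.cast : ℤ → (ZMod p))).det = ((S.det : ℤ) : (ZMod p)) := by
        have := RingHom.map_det (Int.castRingHom (ZMod p)) S
        simpa using this.symm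
      rw [this]
      intro hh
      exact hdet ((ZMod.intCast_zmod_eq_zero_iff_dvd _ _).1 hh)
    · ext i
      have : C (Pi.single i 1, 0) (redp p x) = 0 := hr _ trivial
      rw [hCapp] at this
      simp only [Pi.zero_apply, zero_mul, mul_zero, Finset.sum_const_zero, add_zero] at this
      rw [Finset.sum_eq_single i] at this
      · simpa [Matrix.mulVec, dotProduct] using this
      · intro k _ hk
        simp [hk]
      · simp
  have hr2 : ∀ i, (d i : (ZMod p)) * (redp p x).2 i = 0 := by
    intro i
    have : C (0, Pi.single i 1) (redp p x) = 0 := hr _ trivial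
    rw [hCapp] at this
    simp only [Pi.zero_apply, zero_mul, Finset.sum_const_zero, zero_add] at this
    rw [Finset.sum_eq_single i] at this
    · simpa using this
    · intro k _ hk
      simp [hk]
    · simp
  refine ⟨x.2, ?_, ?_, ?_⟩
  · by_contra hcon
    push Not at hcon
    apply hw0
    refine Prod.ext hr1 ?_
    ext i
    exact (ZMod.intCast_zmod_eq_zero_iff_dvd _ _).2 (hcon i)
  · intro i hi
    rcases mul_eq_zero.1 (hr2 i) with h | h
    · exact absurd ((ZMod.intCast_zmod_eq_zero_iff_dvd _ _).1 h) hi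
    · exact (ZMod.intCast_zmod_eq_zero_iff_dvd _ _).1 h
  · have h1 : ∀ i, (p : ℤ) ∣ x.1 i := fun i =>
      (ZMod.intCast_zmod_eq_zero_iff_dvd _ _).1 (congrFun hr1 i)
    choose a ha using h1
    have := hX x hx x hx
    simp only [← sq] at this
    rw [← this]
    refine Finset.dvd_sum fun i _ => Finset.dvd_sum fun j _ => ?_
    rw [ha i, ha j]
    exact ⟨a i * S i j * a j, by ring⟩

end Lattice

section Descent

theorem GS_mono {k l : ℕ} (h : k ≤ l) : GS k ≤ GS l := by
  refine AddSubgroup.closure_mono ?_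
  rintro x ⟨a, ha, rfl⟩
  exact ⟨a, ⟨ha.1, fun q hq hd => (ha.2 q hq hd).trans_le h⟩, rfl⟩

theorem GS_lists {k : ℕ} {x : GW} (hx : x ∈ GS k) : ∃ l l' : List ℤ, (∀ a ∈ l, Sm k a) ∧
    (∀ a ∈ l', Sm k a) ∧
    x + (l'.map (fun a : ℤ => cls (a : ℚ))).sum = (l.map (fun a : ℤ => cls (a : ℚ))).sum := by
  induction hx using AddSubgroup.closure_induction with
  | mem x hx =>
    obtain ⟨a, ha, rfl⟩ := hx
    exact ⟨[a], [], by simpa using ha, by simp, by simp⟩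
  | zero => exact ⟨[], [], by simp, by simp, by simp⟩
  | add x y _ _ h1 h2 =>
    obtain ⟨l1, l1', a1, a2, a3⟩ := h1
    obtain ⟨l2, l2', b1, b2, b3⟩ := h2
    refine ⟨l1 ++ l2, l1' ++ l2', ?_, ?_, ?_⟩
    · intro a ha
      rcases List.mem_append.1 ha with h | h
      · exact a1 a h
      · exact b1 a h
    · intro a ha
      rcases List.mem_append.1 ha with h | h
      · exact a2 a h
      · exact b2 a h
    · rw [List.map_append, List.map_append, List.sum_append, List.sum_append, ← a3, ← b3]
      abel
  | neg x _ h =>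
    obtain ⟨l, l', a1, a2, a3⟩ := h
    refine ⟨l', l, a2, a1, ?_⟩
    rw [← a3]; abel

theorem cls_mem_some (a : ℚ) : ∃ k, cls a ∈ GS k := by
  by_cases ha : a = 0
  · exact ⟨0, by rw [ha, cls_zero]; exact zero_mem _⟩
  · have h0 : (a.num * a.den : ℤ) ≠ 0 := by
      simp [ha]
    have h1 : cls a = cls ((a.num * a.den : ℤ) : ℚ) := by
      have hd : (a.den : ℚ) ≠ 0 := by exact_mod_cast a.den_nz
      rw [← cls_mul_sq a (a.den : ℚ) hd]
      congr 1
      push_cast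
      have hq := Rat.mul_den_eq_num a
      rw [← hq]; ring
    refine ⟨(|(a.num * a.den : ℤ)| + 1).toNat, ?_⟩
    rw [h1]
    apply cls_mem_GS
    apply Sm.of_lt h0
    have : (0 : ℤ) ≤ |(a.num * a.den : ℤ)| := abs_nonneg _
    omega

theorem sum_cls_mem_some {n : ℕ} (v : Fin n → ℚ) : ∃ k, ∑ i, cls (v i) ∈ GS k := by
  choose k hk using fun i => cls_mem_some (v i)
  exact ⟨Finset.univ.sup k, sum_mem fun i _ => GS_mono (Finset.le_sup (Finset.mem_univ i)) (hk i)⟩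

theorem blocks_isom {ι κ : Type} [Fintype ι] [Fintype κ] [DecidableEq ι] [DecidableEq κ]
    (S : Matrix ι ι ℤ) (a : κ → ℤ) :
    Isom (Matrix.toBilin' ((Matrix.fromBlocks S 0 0 (Matrix.diagonal a)).map (Int.cast : ℤ → ℚ)))
      (dsum (Matrix.toBilin' (S.map (Int.cast : ℤ → ℚ))) (dg (fun i => (a i : ℚ)))) := by
  refine ⟨LinearEquiv.sumArrowLequivProdArrow ι κ ℚ ℚ, fun x y => ?_⟩
  simp [Matrix.toBilin'_apply, Fintype.sum_sum_type, Matrix.diagonal_apply]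
  refine Finset.sum_congr rfl fun i _ => ?_
  ring

theorem descent {n : ℕ} (S : Matrix (Fin n) (Fin n) ℤ) (hS : S.transpose = S)
    (hdet : S.det = 1 ∨ S.det = -1) (v : Fin n → ℚ) (hv : ∀ i, v i ≠ 0)
    (hI : Isom (dg v) (Matrix.toBilin' (S.map (Int.cast : ℤ → ℚ)))) (p : ℕ) (hp : p.Prime)
    (hx : ∑ i, cls (v i) ∈ GS (p + 1)) : ∑ i, cls (v i) ∈ GS p := by
  have := Fact.mk hp
  obtain ⟨l, hl, hlx⟩ := ff_list p hp _ hx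
  obtain ⟨m, u, hu, hsum, haniso⟩ := ff_aniso p hp _ l rfl hl
  have hpu : mkQ p (∑ i, cls ((p * ((u i).val : ℤ) : ℤ) : ℚ)) = ∑ i, ff p (u i) := by
    rw [map_sum]; rfl
  rw [hsum, ← hpu, mkQ_eq] at hlx
  obtain ⟨A, A', hA, hA', hAA⟩ := GS_lists hlx
  rw [sum_map_eq, sum_map_eq] at hAA
  rcases Nat.eq_zero_or_pos m with hm | hm
  · subst hm
    rw [Fin.sum_univ_zero (fun i => cls ((p * ((u i).val : ℤ) : ℤ) : ℚ)), sub_zero] at hlx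
    exact hlx
  exfalso
  let a : Fin A.length → ℤ := fun i => A.get i
  let a' : Fin A'.length → ℤ := fun i => A'.get i
  have ha : ∀ i, Sm p (a i) := fun i => hA _ (List.get_mem _ _)
  have ha' : ∀ i, Sm p (a' i) := fun i => hA' _ (List.get_mem _ _)
  have hnd : ∀ z : ℤ, Sm p z → ¬ (p : ℤ) ∣ z := fun z hz hd => lt_irrefl _ (hz.2 p hp hd)
  let d : Fin A.length ⊕ Fin m → ℤ := Sum.elim a (fun i => p * ((u i).val : ℤ))
  have hI2 : Isom (dg (fun i => (d i : ℚ)))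
      (dg (Sum.elim v (fun i => (a' i : ℚ)))) := by
    apply isom_of_sum_cls
    · rintro (i | i)
      · simpa [d] using (ha i).1
      · have h1 := val_pos_of (hu i)
        have h2 : (p : ℤ) ≠ 0 := by exact_mod_cast hp.ne_zero
        exact Int.cast_ne_zero.2 (mul_ne_zero h2 h1)
    · rintro (i | i)
      · exact hv i
      · simpa using (ha' i).1
    · rw [Fintype.sum_sum_type, Fintype.sum_sum_type]
      simp only [Sum.elim_inl, Sum.elim_inr, d, a, a']
      rw [← hAA]
      abel
  have hI3 : Isom (dg (fun i => (d i : ℚ)))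
      (Matrix.toBilin' ((Matrix.fromBlocks S 0 0 (Matrix.diagonal a')).map (Int.cast : ℤ → ℚ))) :=
    hI2.trans ((dg_sum _ _).trans ((hI.dsum (Isom.refl _)).trans (blocks_isom S a').symm))
  obtain ⟨c, ⟨i1, hc1⟩, hc2, hc3⟩ := lattice_lemma p hp _ (by
    rw [Matrix.fromBlocks_transpose, hS]; simp) (by
    rw [Matrix.det_fromBlocks_zero₂₁, Matrix.det_diagonal]
    intro hd
    have hpp : Prime (p : ℤ) := Nat.prime_iff_prime_int.1 hp
    have : (p : ℤ) ∣ ∏ i, a' i := by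
      rcases hdet with h | h <;> rw [h] at hd <;> simpa using hd
    obtain ⟨i, _, hi⟩ := (Prime.dvd_finset_prod_iff hpp _).1 this
    exact hnd _ (ha' i) hi) d hI3 (Sum.inr ⟨0, hm⟩) (by simp [d])
  have hcl : ∀ i, (p : ℤ) ∣ c (Sum.inl i) := fun i => hc2 _ (by
    simpa [d] using hnd _ (ha i))
  rw [Fintype.sum_sum_type] at hc3
  have h1 : (p ^ 2 : ℤ) ∣ ∑ i, d (Sum.inl i) * c (Sum.inl i) ^ 2 :=
    Finset.dvd_sum fun i _ => Dvd.dvd.mul_left (pow_dvd_pow_of_dvd (hcl i) 2) _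
  have h2 := (dvd_add_right h1).1 hc3
  have h3 : ∑ i, d (Sum.inr i) * c (Sum.inr i) ^ 2
      = p * ∑ i, ((u i).val : ℤ) * c (Sum.inr i) ^ 2 := by
    rw [Finset.mul_sum]
    refine Finset.sum_congr rfl fun i _ => ?_
    simp only [d, Sum.elim_inr]; ring
  rw [h3, sq] at h2
  have h4 := (mul_dvd_mul_iff_left (by exact_mod_cast hp.ne_zero : (p : ℤ) ≠ 0)).1 h2
  have h5 := (ZMod.intCast_zmod_eq_zero_iff_dvd _ _).2 h4
  push_cast at h5
  simp only [ZMod.natCast_zmod_val] at h5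
  have h6 := haniso (fun i => (c (Sum.inr i) : ZMod p)) h5
  apply hc1
  rcases i1 with i | i
  · exact hcl i
  · exact (ZMod.intCast_zmod_eq_zero_iff_dvd _ _).1 (congrFun h6 i)

theorem descent_all {n : ℕ} (S : Matrix (Fin n) (Fin n) ℤ) (hS : S.transpose = S)
    (hdet : S.det = 1 ∨ S.det = -1) (v : Fin n → ℚ) (hv : ∀ i, v i ≠ 0)
    (hI : Isom (dg v) (Matrix.toBilin' (S.map (Int.cast : ℤ → ℚ)))) :
    ∑ i, cls (v i) ∈ GS 0 := by
  obtain ⟨k, hk⟩ := sum_cls_mem_some v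
  induction k with
  | zero => exact hk
  | succ k ih =>
    apply ih
    by_cases hp : k.Prime
    · exact descent S hS hdet v hv hI k hp hk
    · refine (AddSubgroup.closure_mono ?_ : GS (k + 1) ≤ GS k) hk
      rintro x ⟨a, ha, rfl⟩
      refine ⟨a, ⟨ha.1, fun q hq hd => ?_⟩, rfl⟩
      have h1 := ha.2 q hq hd
      have h2 : q ≠ k := by rintro rfl; exact hp hq
      omega

theorem GS_zero {x : GW} (hx : x ∈ GS 0) : ∃ i j : ℤ, x = i • cls 1 + j • cls (-1) := by
  induction hx using AddSubgroup.closure_induction with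
  | mem x hx =>
    obtain ⟨a, ha, rfl⟩ := hx
    have h1 : a.natAbs = 1 := by
      by_contra hne
      obtain ⟨q, hq, hd⟩ := Nat.exists_prime_and_dvd hne
      exact absurd (ha.2 q hq (Int.natCast_dvd.2 hd)) (by simp)
    rcases Int.natAbs_eq a with h | h <;> rw [h, h1]
    · exact ⟨1, 0, by simp⟩
    · exact ⟨0, 1, by simp⟩
  | zero => exact ⟨0, 0, by simp⟩
  | add x y _ _ h1 h2 =>
    obtain ⟨i, j, rfl⟩ := h1
    obtain ⟨i', j', rfl⟩ := h2
    exact ⟨i + i', j + j', by rw [add_smul, add_smul]; abel⟩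
  | neg x _ h =>
    obtain ⟨i, j, rfl⟩ := h
    exact ⟨-i, -j, by rw [neg_smul, neg_smul]; abel⟩

theorem not_isom_pos_neg {U1 U2 : Type} [AddCommGroup U1] [Module ℚ U1] [AddCommGroup U2]
    [Module ℚ U2] {B1 : U1 →ₗ[ℚ] U1 →ₗ[ℚ] ℚ} {B2 : U2 →ₗ[ℚ] U2 →ₗ[ℚ] ℚ}
    (h : Isom B1 B2) (h1 : ∀ x, 0 ≤ B1 x x) (y : U2) (hy : B2 y y < 0) : False := by
  obtain ⟨e, he⟩ := h
  have := h1 (e.symm y)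
  rw [← he] at this
  simp at this
  linarith

theorem exists_rat_one {n : ℕ} (hn : 0 < n) (S : Matrix (Fin n) (Fin n) ℤ)
    (hS : S.transpose = S)
    (hdet : S.det = 1 ∨ S.det = -1)
    (v : Fin n → ℚ) (hv : ∀ i, 0 < v i)
    (hI : Isom (dg v) (Matrix.toBilin' (S.map (Int.cast : ℤ → ℚ)))) :
    ∃ x, Matrix.toBilin' (S.map (Int.cast : ℤ → ℚ)) x x = 1 := by
  have hmem := descent_all S hS hdet v (fun i => (hv i).ne') hI
  obtain ⟨i, j, hij⟩ := GS_zero hmem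
  let w1 : Fin n ⊕ (Fin (-i).toNat ⊕ Fin (-j).toNat) → ℚ :=
    Sum.elim v (Sum.elim (fun _ => 1) (fun _ => -1))
  let w2 : Fin i.toNat ⊕ Fin j.toNat → ℚ := (Sum.elim (fun _ => 1) (fun _ => -1))
  have hiso : Isom (dg w1) (dg w2) := by
    apply isom_of_sum_cls
    · rintro (i | (i | i))
      · exact (hv i).ne'
      · simp [w1]
      · simp [w1]
    · rintro (i | i) <;> simp [w2]
    · simp only [Fintype.sum_sum_type, w1, w2, Sum.elim_inl, Sum.elim_inr, hij, Finset.sum_const,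
        Finset.card_univ, Fintype.card_fin]
      have e1 : i • cls 1 = i.toNat • cls 1 - (-i).toNat • cls 1 := by
        rw [← natCast_zsmul, ← natCast_zsmul, ← sub_smul]
        congr 1; omega
      have e2 : j • cls (-1) = j.toNat • cls (-1) - (-j).toNat • cls (-1) := by
        rw [← natCast_zsmul, ← natCast_zsmul, ← sub_smul]
        congr 1; omega
      rw [e1, e2]; abel
  have key : ∀ {κ : Type} [Fintype κ] (w : κ → ℚ) (hw : ∀ i, 0 ≤ w i) (x : κ → ℚ), 0 ≤ dg w x x := by
    intro κ _ w hw x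
    rw [dg_apply]
    exact Finset.sum_nonneg fun i _ => mul_nonneg (hw i) (mul_self_nonneg _)
  have hsing : ∀ {κ : Type} [Fintype κ] [DecidableEq κ] (w : κ → ℚ) (k : κ),
      dg w (Pi.single k 1) (Pi.single k 1) = w k := by
    intro κ _ _ w k
    rw [dg_apply, Finset.sum_eq_single k]
    · simp
    · intro l _ hl; simp [hl]
    · simp
  have hj : j = 0 := by
    rcases lt_trichotomy j 0 with h | h | h
    · exfalso
      have hj0 : j.toNat = 0 := by omega
      refine not_isom_pos_neg hiso.symm (key w2 ?_) (Pi.single (Sum.inr (Sum.inr ⟨0, by omega⟩)) 1) ?_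
      · rintro (i | i)
        · simp [w2]
        · exact absurd i.2 (by omega)
      · rw [hsing]; simp [w1]
    · exact h
    · exfalso
      refine not_isom_pos_neg hiso (key w1 ?_) (Pi.single (Sum.inr ⟨0, by omega⟩) 1) ?_
      · rintro (i | (i | i))
        · exact (hv i).le
        · simp [w1]
        · exact absurd i.2 (by omega)
      · rw [hsing]; simp [w2]
  subst hj
  have hcard := hiso.choose.finrank_eq
  simp only [Module.finrank_fintype_fun_eq_card, Fintype.card_sum, Fintype.card_fin] at hcard
  have hiso2 : Isom (dg v) (dg (fun _ : Fin i.toNat => (1 : ℚ))) := by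
    apply isom_of_sum_cls
    · exact fun i => (hv i).ne'
    · simp
    · rw [hij]
      simp only [Finset.sum_const, Finset.card_univ, Fintype.card_fin, zero_smul, add_zero]
      rw [← natCast_zsmul]
      congr 1; omega
  obtain ⟨e, he⟩ := hiso2.symm.trans hI
  refine ⟨e (Pi.single ⟨0, by omega⟩ 1), ?_⟩
  rw [he, hsing]

theorem exists_sq {n : ℕ} (hn : 0 < n) (S : Matrix (Fin n) (Fin n) ℤ)
    (hS : S.transpose = S)
    (hdet : S.det = 1 ∨ S.det = -1)
    (hpos : ∀ x : Fin n → ℤ, x ≠ 0 → 0 < ∑ i, ∑ j, x i * S i j * x j) :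
    ∃ (x : Fin n → ℤ) (m : ℤ), m ≠ 0 ∧ ∑ i, ∑ j, x i * S i j * x j = m ^ 2 := by
  have hden : ∀ x : Fin n → ℚ, ∃ (N : ℤ) (y : Fin n → ℤ), N ≠ 0 ∧ ∀ i, (y i : ℚ) = N * x i := by
    intro x
    obtain ⟨N, hN⟩ := IsLocalization.exist_integer_multiples_of_finset (nonZeroDivisors ℤ)
      ((Finset.univ : Finset (Fin n)).image x)
    have : ∀ i, ∃ a : ℤ, (a : ℚ) = N * x i := by
      intro i
      obtain ⟨a, ha⟩ := hN (x i) (Finset.mem_image.2 ⟨i, by simp, rfl⟩)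
      exact ⟨a, by simpa using ha⟩
    choose y hy using this
    exact ⟨N, y, nonZeroDivisors.coe_ne_zero N, hy⟩
  let B := Matrix.toBilin' (S.map (Int.cast : ℤ → ℚ))
  have hscale : ∀ (x : Fin n → ℚ) (N : ℤ) (y : Fin n → ℤ), (∀ i, (y i : ℚ) = N * x i) →
      ((∑ i, ∑ j, y i * S i j * y j : ℤ) : ℚ) = N ^ 2 * B x x := by
    intro x N y h
    simp only [B, Matrix.toBilin'_apply, Matrix.map_apply]
    push_cast
    simp only [h, Finset.mul_sum]
    refine Finset.sum_congr rfl fun i _ => Finset.sum_congr rfl fun j _ => ?_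
    ring
  have hBpos : ∀ x, x ≠ 0 → 0 < B x x := by
    intro x hx
    obtain ⟨N, y, hN, hy⟩ := hden x
    have h1 := hscale x N y hy
    have hy0 : y ≠ 0 := by
      rintro rfl
      apply hx
      ext i
      have := hy i
      simp [hN] at this
      exact this
    have h2 : (0 : ℚ) < ((∑ i, ∑ j, y i * S i j * y j : ℤ) : ℚ) := by exact_mod_cast hpos y hy0
    rw [h1] at h2
    have h3 : (0 : ℚ) < (N : ℚ) ^ 2 := by
      have : (N : ℚ) ≠ 0 := by exact_mod_cast hN
      positivity
    exact pos_of_mul_pos_right h2 h3.le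
  have hBsymm : ∀ x y, B x y = B y x := by
    intro x y
    simp only [B, Matrix.toBilin'_apply, Matrix.map_apply]
    rw [Finset.sum_comm]
    refine Finset.sum_congr rfl fun i _ => Finset.sum_congr rfl fun j _ => ?_
    have : S j i = S i j := by conv_lhs => rw [← hS, Matrix.transpose_apply]
    rw [this]; ring
  have hBs : LinearMap.IsSymm B := ⟨fun x y => hBsymm x y⟩
  have : Invertible (2 : ℚ) := invertibleOfNonzero (by norm_num)
  obtain ⟨β0, hβ0⟩ := LinearMap.BilinForm.exists_orthogonal_basis hBs
  have hfr : Module.finrank ℚ (Fin n → ℚ) = n := by simp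
  let β := β0.reindex (finCongr hfr)
  have hβ : ∀ i j, i ≠ j → B (β i) (β j) = 0 := by
    intro i j hij
    simp only [β, Module.Basis.reindex_apply]
    exact hβ0 (by simpa using hij)
  let v : Fin n → ℚ := fun i => B (β i) (β i)
  have hI : Isom (dg v) B := by
    refine ⟨β.equivFun.symm, fun x y => ?_⟩
    rw [Module.Basis.equivFun_symm_apply, Module.Basis.equivFun_symm_apply]
    simp only [map_sum, LinearMap.sum_apply, map_smul, LinearMap.smul_apply, smul_eq_mul, dg_apply]
    refine Finset.sum_congr rfl fun i _ => ?_
    rw [Finset.sum_eq_single i]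
    · simp only [v]; ring
    · intro j _ hj
      rw [hβ _ _ hj]; simp
    · simp
  obtain ⟨x, hx⟩ := exists_rat_one hn S hS hdet v (fun i => hBpos _ (β.ne_zero i)) hI
  obtain ⟨N, y, hN, hy⟩ := hden x
  refine ⟨y, N, hN, ?_⟩
  have := hscale x N y hy
  simp only [B] at this
  rw [hx, mul_one] at this
  exact_mod_cast this

end Descent

section Integral

theorem dsum_left_comm {U1 U2 U3 : Type} [AddCommGroup U1] [AddCommGroup U2] [AddCommGroup U3]
    (B1 : U1 →ₗ[ℤ] U1 →ₗ[ℤ] ℤ) (B2 : U2 →ₗ[ℤ] U2 →ₗ[ℤ] ℤ) (B3 : U3 →ₗ[ℤ] U3 →ₗ[ℤ] ℤ) :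
    Isom (dsum B1 (dsum B2 B3)) (dsum B2 (dsum B1 B3)) :=
  (dsum_assoc _ _ _).symm.trans (((dsum_comm _ _).dsum (Isom.refl _)).trans (dsum_assoc _ _ _))

/-- The form with Gram matrix `[0 1; 1 τ]`. -/
def pf (τ : ℤ) : (ℤ × ℤ) →ₗ[ℤ] (ℤ × ℤ) →ₗ[ℤ] ℤ :=
  (LinearMap.mul ℤ ℤ).compl₁₂ (LinearMap.fst ℤ ℤ ℤ) (LinearMap.snd ℤ ℤ ℤ) +
  (LinearMap.mul ℤ ℤ).compl₁₂ (LinearMap.snd ℤ ℤ ℤ) (LinearMap.fst ℤ ℤ ℤ) +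
  τ • (LinearMap.mul ℤ ℤ).compl₁₂ (LinearMap.snd ℤ ℤ ℤ) (LinearMap.snd ℤ ℤ ℤ)

theorem pf_apply (τ : ℤ) (x y : ℤ × ℤ) : pf τ x y = x.1 * y.2 + x.2 * y.1 + τ * (x.2 * y.2) := by
  simp [pf]

theorem pf_isom (τ : ℤ) (hτ : τ = 0 ∨ τ = 1) :
    Isom (dsum (pf τ) (sc 1)) (dsum (sc (1 : ℤ)) (dsum (sc 1) (sc (-1)))) := by
  rcases hτ with rfl | rfl
  · refine ⟨{
      toFun := fun x => (x.1.2 + x.2, x.2 - x.1.1, x.1.1 - x.1.2 - x.2)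
      invFun := fun x => ((x.1 + x.2.2, - x.2.1 - x.2.2), x.2.1 + x.1 + x.2.2)
      map_add' := fun x y => by ext <;> simp <;> ring
      map_smul' := fun c x => by ext <;> simp <;> ring
      left_inv := fun x => by ext <;> simp; try ring
      right_inv := fun x => by ext <;> simp; try ring }, fun x y => ?_⟩
    simp only [LinearEquiv.coe_mk, LinearMap.coe_mk, AddHom.coe_mk, dsum_apply, pf_apply, sc_apply]
    ring
  · refine ⟨{
      toFun := fun x => (x.1.1 + x.1.2, x.2, - x.1.1)
      invFun := fun x => ((- x.2.2, x.1 + x.2.2), x.2.1)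
      map_add' := fun x y => by ext <;> simp <;> ring
      map_smul' := fun c x => by ext <;> simp <;> ring
      left_inv := fun x => by ext <;> simp
      right_inv := fun x => by ext <;> simp }, fun x y => ?_⟩
    simp only [LinearEquiv.coe_mk, LinearMap.coe_mk, AddHom.coe_mk, dsum_apply, pf_apply, sc_apply]
    ring

variable {L : Type} [AddCommGroup L] [Module.Free ℤ L] [Module.Finite ℤ L]

theorem exists_sq_form (b : L →ₗ[ℤ] L →ₗ[ℤ] ℤ) (hs : ∀ x y, b x y = b y x)
    (hpos : ∀ x, x ≠ 0 → 0 < b x x) (huni : ∀ φ : L →ₗ[ℤ] ℤ, ∃ x, ∀ y, b x y = φ y)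
    (hn : 0 < Module.finrank ℤ L) : ∃ (x : L) (m : ℤ), m ≠ 0 ∧ b x x = m ^ 2 := by
  let β := Module.finBasis ℤ L
  let S : Matrix (Fin (Module.finrank ℤ L)) (Fin (Module.finrank ℤ L)) ℤ :=
    Matrix.of fun i j => b (β i) (β j)
  have hb : ∀ c c' : Fin (Module.finrank ℤ L) → ℤ,
      b (∑ i, c i • β i) (∑ i, c' i • β i) = ∑ i, ∑ j, c i * S i j * c' j := by
    intro c c'
    simp only [map_sum, LinearMap.sum_apply, map_smul, LinearMap.smul_apply, smul_eq_mul, S,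
      Matrix.of_apply]
    simp only [Finset.mul_sum]
    rw [Finset.sum_comm]
    refine Finset.sum_congr rfl fun i _ => Finset.sum_congr rfl fun j _ => ?_
    ring
  choose z hz using fun i => huni (β.coord i)
  let T : Matrix (Fin (Module.finrank ℤ L)) (Fin (Module.finrank ℤ L)) ℤ :=
    Matrix.of fun i j => β.repr (z i) j
  have hTS : T * S = 1 := by
    ext i j
    have h1 := hz i (β j)
    conv_lhs at h1 => rw [← β.sum_repr (z i)]
    simp only [map_sum, LinearMap.sum_apply, map_smul, LinearMap.smul_apply, smul_eq_mul] at h1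
    rw [Matrix.mul_apply]
    simp only [T, S, Matrix.of_apply]
    rw [h1, Module.Basis.coord_apply, Module.Basis.repr_self, Matrix.one_apply,
      Finsupp.single_apply]
    simp [eq_comm]
  have hdet : S.det = 1 ∨ S.det = -1 := by
    apply Int.isUnit_iff.1
    have : T.det * S.det = 1 := by rw [← Matrix.det_mul, hTS, Matrix.det_one]
    exact IsUnit.of_mul_eq_one_right _ this
  obtain ⟨x, m, hm, hx⟩ := exists_sq hn S (by ext i j; simp [S, hs (β j)]) hdet (by
    intro x hx
    rw [← hb]
    apply hpos
    intro h0
    apply hx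
    ext i
    exact Fintype.linearIndependent_iff.1 β.linearIndependent x h0 i)
  exact ⟨∑ i, x i • β i, m, hm, by rw [hb, hx]⟩

theorem split_step (b : L →ₗ[ℤ] L →ₗ[ℤ] ℤ) (hs : ∀ x y, b x y = b y x)
    (hpos : ∀ x, x ≠ 0 → 0 < b x x) (huni : ∀ φ : L →ₗ[ℤ] ℤ, ∃ x, ∀ y, b x y = φ y)
    (hn : 0 < Module.finrank ℤ L) :
    ∃ (L' : Submodule ℤ (L × ℤ)) (b' : L' →ₗ[ℤ] L' →ₗ[ℤ] ℤ) (τ : ℤ), (τ = 0 ∨ τ = 1) ∧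
      (∀ x y, b' x y = b' y x) ∧ (∀ x, x ≠ 0 → 0 < b' x x) ∧
      (∀ φ : L' →ₗ[ℤ] ℤ, ∃ x, ∀ y, b' x y = φ y) ∧
      Isom (dsum (pf τ) b') (dsum b (sc (-1))) := by
  obtain ⟨x, m, hm, hx⟩ := exists_sq_form b hs hpos huni hn
  let C := dsum b (sc (-1 : ℤ))
  have hC : ∀ y z, C y z = b y.1 z.1 - y.2 * z.2 := by
    intro y z
    simp only [C, dsum_apply, sc_apply]; ring
  have hCs : ∀ y z, C y z = C z y := by
    intro y z; rw [hC, hC, hs, mul_comm]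
  have hCuni : ∀ φ : (L × ℤ) →ₗ[ℤ] ℤ, ∃ x, ∀ y, C x y = φ y := by
    intro φ
    obtain ⟨z, hz⟩ := huni (φ.comp (LinearMap.inl ℤ L ℤ))
    refine ⟨(z, - φ (0, 1)), fun y => ?_⟩
    rw [hC]
    simp only [hz]
    have : y = (y.1, 0) + y.2 • (0, (1 : ℤ)) := by ext <;> simp
    conv_rhs => rw [this, map_add, map_smul]
    simp
    ring
  let w0 : L × ℤ := (x, m)
  have hw0 : C w0 w0 = 0 := by rw [hC]; simp only [w0, hx]; ring
  obtain ⟨d, hd⟩ : ∃ d, LinearMap.range (C w0) = Ideal.span {d} :=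
    (IsPrincipalIdealRing.principal (LinearMap.range (C w0) : Ideal ℤ)).principal
  have hdvd : ∀ y, d ∣ C w0 y := by
    intro y
    have : C w0 y ∈ LinearMap.range (C w0) := ⟨y, rfl⟩
    rw [hd] at this
    exact Ideal.mem_span_singleton.1 this
  have hd0 : d ≠ 0 := by
    rintro rfl
    have := hdvd (0, 1)
    rw [zero_dvd_iff, hC] at this
    simp [w0, hm] at this
  obtain ⟨w1, hw1⟩ : ∃ w1, C w0 w1 = d := by
    have : d ∈ LinearMap.range (C w0) := by rw [hd]; exact Ideal.mem_span_singleton_self d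
    exact this
  choose f hf using hdvd
  have hfl : ∀ y z, f (y + z) = f y + f z := by
    intro y z
    apply mul_left_cancel₀ hd0
    rw [← hf, map_add, hf, hf]; ring
  obtain ⟨w, hw⟩ := hCuni (AddMonoidHom.mk' f hfl).toIntLinearMap
  have hwf : ∀ y, d * C w y = C w0 y := by
    intro y; rw [hw, hf]; simp
  have hww1 : C w w1 = 1 := by
    apply mul_left_cancel₀ hd0
    rw [hwf, hw1, mul_one]
  have hww : C w w = 0 := by
    apply mul_left_cancel₀ hd0
    rw [hwf, hCs]
    apply mul_left_cancel₀ hd0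
    rw [hwf, hw0]; simp
  obtain ⟨w', hww', hτ⟩ : ∃ w', C w w' = 1 ∧ (C w' w' = 0 ∨ C w' w' = 1) := by
    refine ⟨w1 - (C w1 w1 / 2) • w, ?_, ?_⟩
    · rw [map_sub, map_smul, hww, hww1]; simp
    · have : C (w1 - (C w1 w1 / 2) • w) (w1 - (C w1 w1 / 2) • w) = C w1 w1 - 2 * (C w1 w1 / 2) := by
        simp only [map_sub, map_smul, LinearMap.sub_apply, LinearMap.smul_apply, hww, hww1,
          hCs w1 w, smul_eq_mul]
        ring
      rw [this]
      omega
  let L' : Submodule ℤ (L × ℤ) := LinearMap.ker (C w) ⊓ LinearMap.ker (C w')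
  have hL' : ∀ y, y ∈ L' ↔ C w y = 0 ∧ C w' y = 0 := fun y => by
    simp [L', Submodule.mem_inf, LinearMap.mem_ker]
  let b' : L' →ₗ[ℤ] L' →ₗ[ℤ] ℤ := C.compl₁₂ L'.subtype L'.subtype
  have hb' : ∀ y z : L', b' y z = C (y : L × ℤ) (z : L × ℤ) := fun y z => rfl
  -- the projection
  have hprojmem : ∀ y, y - (C w' y - C w' w' * C w y) • w - (C w y) • w' ∈ L' := by
    intro y
    rw [hL']
    constructor
    · simp only [map_sub, map_smul, hww, hww', smul_eq_mul]; ring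
    · simp only [map_sub, map_smul, hCs w' w, hww', smul_eq_mul]; ring
  refine ⟨L', b', C w' w', hτ, ?_, ?_, ?_, ?_⟩
  · intro y z; rw [hb', hb', hCs]
  · rintro ⟨⟨l, a⟩, hy⟩ hne
    rw [hb']
    obtain ⟨h1, h2⟩ := (hL' _).1 hy
    change 0 < C (l, a) (l, a)
    have h3 : C w0 (l, a) = 0 := by rw [← hwf, h1, mul_zero]
    have h3' : b x l = m * a := by
      rw [hC] at h3
      simp only [w0] at h3
      linarith
    have h4 : b (m • l - a • x) (m • l - a • x) = m ^ 2 * C (l, a) (l, a) := by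
      rw [hC]
      simp only [map_sub, map_smul, LinearMap.sub_apply, LinearMap.smul_apply, smul_eq_mul,
        hs l x, h3', hx]
      ring
    by_cases h5 : m • l - a • x = 0
    · exfalso
      have h6 : m • ((l, a) : L × ℤ) = a • w0 := by
        ext
        · simpa [w0] using sub_eq_zero.1 h5
        · simp [w0, mul_comm]
      have h7 := congrArg (C w') h6
      rw [map_smul, map_smul, h2, hCs w' w0, ← hwf, hww'] at h7
      have ha : a = 0 := by simpa [hd0] using h7
      subst ha
      rw [zero_smul, sub_zero] at h5
      have hl : l = 0 := by
        by_contra hl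
        have := hpos l hl
        have h8 : b (m • l) l = 0 := by rw [h5]; simp
        rw [map_smul, LinearMap.smul_apply, smul_eq_mul] at h8
        rcases mul_eq_zero.1 h8 with h | h
        · exact hm h
        · omega
      subst hl
      exact hne rfl
    · have h6 := hpos _ h5
      rw [h4] at h6
      exact pos_of_mul_pos_right h6 (sq_nonneg m)
  · intro φ
    let pr : (L × ℤ) →ₗ[ℤ] L' :=
      { toFun := fun y => ⟨_, hprojmem y⟩
        map_add' := fun y z => by
          apply Subtype.ext
          simp only [map_add, Submodule.coe_add]
          module
        map_smul' := fun c y => by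
          apply Subtype.ext
          simp only [map_smul, Submodule.coe_smul, smul_eq_mul, RingHom.id_apply]
          module }
    have hpr : ∀ y : L', pr y = y := by
      rintro ⟨y, hy⟩
      apply Subtype.ext
      change y - (C w' y - C w' w' * C w y) • w - (C w y) • w' = y
      obtain ⟨h1, h2⟩ := (hL' _).1 hy
      rw [h1, h2]; simp
    obtain ⟨z, hz⟩ := hCuni (φ.comp pr)
    refine ⟨pr z, fun y => ?_⟩
    rw [hb']
    change C (z - (C w' z - C w' w' * C w z) • w - (C w z) • w') y = _
    obtain ⟨h1, h2⟩ := (hL' _).1 y.2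
    simp only [map_sub, map_smul, LinearMap.sub_apply, LinearMap.smul_apply, h1, h2, smul_zero,
      sub_zero, hz, LinearMap.comp_apply, hpr]
  · refine ⟨{
      toFun := fun q => q.1.1 • w + q.1.2 • w' + (q.2 : L × ℤ)
      invFun := fun y => ((C w' y - C w' w' * C w y, C w y), ⟨_, hprojmem y⟩)
      map_add' := fun p q => by
        simp only [Prod.fst_add, Prod.snd_add, Submodule.coe_add]
        module
      map_smul' := fun c p => by
        simp only [Prod.smul_fst, Prod.smul_snd, Submodule.coe_smul, smul_eq_mul, RingHom.id_apply]
        module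
      left_inv := ?_
      right_inv := ?_ }, ?_⟩
    · rintro ⟨⟨s, t⟩, ⟨y, hy⟩⟩
      obtain ⟨h1, h2⟩ := (hL' _).1 hy
      have e1 : C w (s • w + t • w' + y) = t := by
        simp only [map_add, map_smul, hww, hww', h1, smul_eq_mul]; ring
      have e2 : C w' (s • w + t • w' + y) - C w' w' * t = s := by
        simp only [map_add, map_smul, hCs w' w, hww', h2, smul_eq_mul]; ring
      simp only [e1, e2]
      refine Prod.ext rfl (Subtype.ext ?_)
      change s • w + t • w' + y - s • w - t • w' = y
      abel
    · intro y
      simp only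
      abel
    · rintro ⟨⟨s, t⟩, ⟨y, hy⟩⟩ ⟨⟨s', t'⟩, ⟨y', hy'⟩⟩
      obtain ⟨h1, h2⟩ := (hL' _).1 hy
      obtain ⟨h1', h2'⟩ := (hL' _).1 hy'
      change C (s • w + t • w' + y) (s' • w + t' • w' + y') = _
      rw [dsum_apply (pf _) b', pf_apply, hb']
      simp only [map_add, map_smul, LinearMap.add_apply, LinearMap.smul_apply, smul_eq_mul, hww,
        hww', hCs w' w, h1', h2', hCs y w, hCs y w', h1, h2]
      ring

end Integral

theorem stable_class (n : ℕ) : ∀ (L : Type) [AddCommGroup L] [Module.Free ℤ L] [Module.Finite ℤ L]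
    (b : L →ₗ[ℤ] L →ₗ[ℤ] ℤ) (_ : ∀ x y, b x y = b y x)
    (_ : ∀ x, x ≠ 0 → 0 < b x x) (_ : ∀ φ : L →ₗ[ℤ] ℤ, ∃ x, ∀ y, b x y = φ y)
    (_ : Module.finrank ℤ L = n),
    Isom (U1 := L × ℤ × ℤ) (dsum b (dsum (sc 1) (sc (-1))))
      (dsum (dg (fun _ : Fin n => (1 : ℤ))) (dsum (sc 1) (sc (-1)))) := by
  induction n with
  | zero =>
    intro L _ _ _ b hs hpos huni hn
    refine Isom.dsum ?_ (Isom.refl _)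
    have : Subsingleton L := (Module.finrank_eq_zero_iff_of_free ℤ L).1 hn
    refine ⟨LinearEquiv.ofSubsingleton _ _, fun x y => ?_⟩
    have : x = 0 := Subsingleton.elim _ _
    subst this
    simp
  | succ n ih =>
    intro L _ _ _ b hs hpos huni hn
    obtain ⟨L', b', τ, hτ, hs', hpos', huni', hI⟩ := split_step b hs hpos huni (by omega)
    have hr : Module.finrank ℤ L' = n := by
      have := hI.choose.finrank_eq
      simp only [Module.finrank_prod, Module.finrank_self] at this
      omega
    have h1 := ih L' b' hs' hpos' huni' hr
    have a1 : Isom (dsum b (dsum (sc 1) (sc (-1)))) (dsum (sc 1) (dsum b (sc (-1)))) :=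
      dsum_left_comm _ _ _
    have a2 := (Isom.refl (sc (1 : ℤ))).dsum hI.symm
    have a3 : Isom (dsum (sc 1) (dsum (pf τ) b')) (dsum b' (dsum (pf τ) (sc 1))) :=
      ((dsum_comm _ _).trans ((dsum_comm _ _).dsum (Isom.refl _))).trans (dsum_assoc _ _ _)
    have a4 := (Isom.refl b').dsum (pf_isom τ hτ)
    have a5 : Isom (dsum b' (dsum (sc 1) (dsum (sc 1) (sc (-1)))))
      (dsum (sc 1) (dsum b' (dsum (sc 1) (sc (-1))))) := dsum_left_comm _ _ _
    have a6 := (Isom.refl (sc (1 : ℤ))).dsum h1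
    have a7 := (dsum_assoc (sc 1) (dg (fun _ : Fin n => (1 : ℤ))) (dsum (sc 1) (sc (-1)))).symm
    have a8 := (dg_cons (fun _ : Fin (n + 1) => (1 : ℤ))).symm.dsum
      (Isom.refl (dsum (sc (1 : ℤ)) (sc (-1))))
    exact a1.trans (a2.trans (a3.trans (a4.trans (a5.trans (a6.trans (a7.trans a8))))))

section Orbit

theorem refl_two {U : Type} [AddCommGroup U] (C : U →ₗ[ℤ] U →ₗ[ℤ] ℤ) (hC : ∀ x y, C x y = C y x)
    (v : U) (hv : C v v = 2) :
    ∃ e : U ≃ₗ[ℤ] U, (∀ x, e x = x - C v x • v) ∧ ∀ x y, C (e x) (e y) = C x y := by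
  let f : U →ₗ[ℤ] U := LinearMap.id - (C v).smulRight v
  have hf : ∀ x, f x = x - C v x • v := fun x => by simp [f]
  have hinv : Function.Involutive f := by
    intro x
    rw [hf (f x), hf x, map_sub, map_smul, hv, smul_eq_mul]
    module
  refine ⟨LinearEquiv.ofInvolutive f hinv, fun x => hf x, fun x y => ?_⟩
  simp only [LinearEquiv.coe_ofInvolutive, hf, map_sub, map_smul, LinearMap.sub_apply,
    LinearMap.smul_apply, smul_eq_mul, hv, hC x v]
  ring

/-- The Lorentzian form. -/
def lor (n : ℕ) : ((Fin n → ℤ) × ℤ) →ₗ[ℤ] ((Fin n → ℤ) × ℤ) →ₗ[ℤ] ℤ :=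
  dsum (dg (fun _ : Fin n => (1 : ℤ))) (sc (-1))

theorem lor_apply {n : ℕ} (x y : (Fin n → ℤ) × ℤ) :
    lor n x y = ∑ i, x.1 i * y.1 i - x.2 * y.2 := by
  simp [lor]; ring

theorem lor_symm {n : ℕ} (x y : (Fin n → ℤ) × ℤ) : lor n x y = lor n y x := by
  rw [lor_apply, lor_apply]
  congr 1
  · exact Finset.sum_congr rfl fun i _ => mul_comm _ _
  · ring

theorem sq_mod_four (a : ℤ) : (4 : ℤ) ∣ a * a - (if Odd a then 1 else 0) := by
  split_ifs with h
  · obtain ⟨k, rfl⟩ := h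
    exact ⟨k * k + k, by ring⟩
  · obtain ⟨k, rfl⟩ := Int.not_odd_iff_even.1 h
    exact ⟨k * k, by ring⟩

/-- The odd coordinates. -/
def oddSet {n : ℕ} (y : Fin n → ℤ) : Finset (Fin n) := Finset.univ.filter fun i => Odd (y i)

theorem mem_oddSet {n : ℕ} (y : Fin n → ℤ) (i : Fin n) : i ∈ oddSet y ↔ Odd (y i) := by
  simp [oddSet]

theorem oddSet_card {n : ℕ} (y : Fin n → ℤ) : (4 : ℤ) ∣ ∑ i, y i * y i - (oddSet y).card := by
  have : ((oddSet y).card : ℤ) = ∑ i, if Odd (y i) then 1 else 0 := by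
    simp [oddSet, Finset.sum_ite]
  rw [this, ← Finset.sum_sub_distrib]
  exact Finset.dvd_sum fun i _ => sq_mod_four _

theorem refl_triple {n : ℕ} (i j l : Fin n) (hij : i ≠ j) (hil : i ≠ l) (hjl : j ≠ l)
    (y : (Fin n → ℤ) × ℤ) :
    ∃ e : ((Fin n → ℤ) × ℤ) ≃ₗ[ℤ] ((Fin n → ℤ) × ℤ),
      (∀ x y, lor n (e x) (e y) = lor n x y) ∧
      (∀ m, m ≠ i → m ≠ j → m ≠ l → (e y).1 m = y.1 m) ∧
      (e y).1 i = y.1 i - (y.1 i + y.1 j + y.1 l - y.2) ∧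
      (e y).1 j = y.1 j - (y.1 i + y.1 j + y.1 l - y.2) ∧
      (e y).1 l = y.1 l - (y.1 i + y.1 j + y.1 l - y.2) ∧
      (e y).2 = y.2 - (y.1 i + y.1 j + y.1 l - y.2) := by
  let v : (Fin n → ℤ) × ℤ := (Pi.single i 1 + Pi.single j 1 + Pi.single l 1, 1)
  have hvy : ∀ y, lor n v y = y.1 i + y.1 j + y.1 l - y.2 := by
    intro y
    rw [lor_apply]
    simp [v, add_mul, Finset.sum_add_distrib, Pi.single_apply]
  have hvv : lor n v v = 2 := by
    rw [hvy]
    simp [v, hij, hil, hjl, hij.symm, hil.symm, hjl.symm]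
  obtain ⟨e, he, hiso⟩ := refl_two (lor n) lor_symm v hvv
  refine ⟨e, hiso, ?_, ?_, ?_, ?_, ?_⟩
  · intro m h1 h2 h3
    rw [he]; simp [v, h1, h2, h3]
  all_goals
    rw [he, hvy]
    simp [v, hij, hil, hjl, hij.symm, hil.symm, hjl.symm]

theorem lor_swap {n : ℕ} (i j : Fin n) :
    ∃ e : ((Fin n → ℤ) × ℤ) ≃ₗ[ℤ] ((Fin n → ℤ) × ℤ),
      (∀ x y, lor n (e x) (e y) = lor n x y) ∧
      ∀ y, (∀ m, (e y).1 m = y.1 (Equiv.swap i j m)) ∧ (e y).2 = y.2 := by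
  refine ⟨(LinearEquiv.funCongrLeft ℤ ℤ (Equiv.swap i j)).prodCongr (LinearEquiv.refl ℤ ℤ), ?_, ?_⟩
  · intro x y
    rw [lor_apply, lor_apply]
    simp only [LinearEquiv.prodCongr_apply, LinearEquiv.funCongrLeft_apply, LinearMap.funLeft_apply,
      LinearEquiv.refl_apply]
    congr 1
    exact Equiv.sum_comp (Equiv.swap i j) (fun m => x.1 m * y.1 m)
  · intro y
    exact ⟨fun m => rfl, rfl⟩

theorem orbit (n : ℕ) (k : ℕ) : ∀ y : (Fin (n + 1) → ℤ) × ℤ, (oddSet y.1).card = k →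
    (4 : ℤ) ∣ lor (n + 1) y y → ((∃ i, Odd (y.1 i)) ∨ Odd y.2) →
    ((∃ i, Even (y.1 i)) ∨ Even y.2) →
    ∃ e : ((Fin (n + 1) → ℤ) × ℤ) ≃ₗ[ℤ] ((Fin (n + 1) → ℤ) × ℤ),
      (∀ x y, lor (n + 1) (e x) (e y) = lor (n + 1) x y) ∧
      ∃ z : (Fin (n + 1) → ℤ) × ℤ, e y = (Pi.single 0 1, 1) + (2 : ℤ) • z := by
  induction k using Nat.strong_induction_on with
  | _ k ih =>
    intro y hk h4 hnz hnc
    have hc := oddSet_card y.1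
    rw [lor_apply] at h4
    have hsq := sq_mod_four y.2
    rcases Int.even_or_odd y.2 with hβ | hβ
    · rw [if_neg (Int.not_odd_iff_even.2 hβ)] at hsq
      have hk4 : (4 : ℤ) ∣ k := by
        rw [hk] at hc
        omega
      obtain ⟨i, hi⟩ : ∃ i, Odd (y.1 i) := by
        rcases hnz with h | h
        · exact h
        · exact absurd h (Int.not_odd_iff_even.2 hβ)
      have hkpos : 0 < k := by
        rw [← hk]
        exact Finset.card_pos.2 ⟨i, (mem_oddSet _ _).2 hi⟩
      obtain ⟨i, hi, j, hj, l, hl, hij, hil, hjl⟩ := Finset.two_lt_card.1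
        (show 2 < (oddSet y.1).card by omega)
      rw [mem_oddSet] at hi hj hl
      obtain ⟨e, he, h1, h2, h3, h5, h6⟩ := refl_triple i j l hij hil hjl y
      have hodd : Odd (y.1 i + y.1 j + y.1 l - y.2) := ((hi.add_odd hj).add_odd hl).sub_even hβ
      have hlt : (oddSet (e y).1).card < k := by
        rw [← hk]
        apply Finset.card_lt_card
        refine Finset.ssubset_iff_of_subset ?_ |>.2 ⟨i, (mem_oddSet _ _).2 hi, ?_⟩
        · intro m hm
          rw [mem_oddSet] at hm ⊢
          by_cases a1 : m = i
          · rw [a1]; exact hi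
          by_cases a2 : m = j
          · rw [a2]; exact hj
          by_cases a3 : m = l
          · rw [a3]; exact hl
          rwa [h1 m a1 a2 a3] at hm
        · rw [mem_oddSet, h2, Int.not_odd_iff_even]
          exact hi.sub_odd hodd
      obtain ⟨e', he', z, hz⟩ := ih _ hlt (e y) rfl (by rw [he, lor_apply]; exact h4)
        (Or.inr (by rw [h6]; exact hβ.sub_odd hodd))
        (Or.inl ⟨i, by rw [h2]; exact hi.sub_odd hodd⟩)
      exact ⟨e.trans e', fun x y => by simp [he', he], z, by simpa using hz⟩
    · rw [if_pos hβ] at hsq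
      have hk4 : (4 : ℤ) ∣ k - 1 := by
        rw [hk] at hc
        omega
      by_cases hk1 : k = 1
      · obtain ⟨i, hi⟩ := Finset.card_eq_one.1 (hk.trans hk1)
        obtain ⟨e, he, h1⟩ := lor_swap 0 i
        refine ⟨e, he, ?_⟩
        have hd : ∀ m, ∃ a, (e y).1 m = (Pi.single 0 1 : Fin (n + 1) → ℤ) m + 2 * a := by
          intro m
          rw [(h1 y).1]
          by_cases hm : m = 0
          · subst hm
            rw [Equiv.swap_apply_left]
            have : Odd (y.1 i) := (mem_oddSet _ _).1 (by rw [hi]; simp)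
            obtain ⟨a, ha⟩ := this
            exact ⟨a, by rw [ha]; simp; ring⟩
          · have : ¬ Odd (y.1 (Equiv.swap 0 i m)) := by
              rw [← mem_oddSet, hi, Finset.mem_singleton]
              intro hh
              apply hm
              rw [← Equiv.swap_apply_left (0 : Fin (n + 1)) i] at hh
              exact (Equiv.swap 0 i).injective hh
            obtain ⟨a, ha⟩ := Int.not_odd_iff_even.1 this
            exact ⟨a, by rw [ha]; simp [hm]; ring⟩
        choose a ha using hd
        obtain ⟨c, hc⟩ := hβ
        refine ⟨(a, c), Prod.ext (funext fun m => ?_) ?_⟩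
        · rw [ha]; simp
        · rw [(h1 y).2, hc]; simp; ring
      · have hkk : 5 ≤ k := by omega
        obtain ⟨l, hl⟩ : ∃ i, Even (y.1 i) := by
          rcases hnc with h | h
          · exact h
          · exact absurd hβ (Int.not_odd_iff_even.2 h)
        obtain ⟨i, hi', j, hj', hij⟩ := Finset.one_lt_card.1
          (show 1 < (oddSet y.1).card by omega)
        have hi := (mem_oddSet _ _).1 hi'
        have hj := (mem_oddSet _ _).1 hj'
        have hil : i ≠ l := by rintro rfl; exact absurd hi (Int.not_odd_iff_even.2 hl)
        have hjl : j ≠ l := by rintro rfl; exact absurd hj (Int.not_odd_iff_even.2 hl)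
        obtain ⟨e, he, h1, h2, h3, h5, h6⟩ := refl_triple i j l hij hil hjl y
        have hodd : Odd (y.1 i + y.1 j + y.1 l - y.2) := ((hi.add_odd hj).add hl).sub_odd hβ
        have hlt : (oddSet (e y).1).card < k := by
          have hsub : oddSet (e y).1 ⊆ insert l (((oddSet y.1).erase i).erase j) := by
            intro m hm
            rw [mem_oddSet] at hm
            by_cases a3 : m = l
            · simp [a3]
            by_cases a1 : m = i
            · rw [a1, h2] at hm
              exact absurd hm (Int.not_odd_iff_even.2 (hi.sub_odd hodd))
            by_cases a2 : m = j
            · rw [a2, h3] at hm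
              exact absurd hm (Int.not_odd_iff_even.2 (hj.sub_odd hodd))
            rw [h1 m a1 a2 a3] at hm
            simp [a1, a2, mem_oddSet, hm]
          have c1 := Finset.card_le_card hsub
          have c2 := Finset.card_insert_le l (((oddSet y.1).erase i).erase j)
          rw [Finset.card_erase_of_mem (Finset.mem_erase.2 ⟨hij.symm, hj'⟩),
            Finset.card_erase_of_mem hi', hk] at c2
          omega
        obtain ⟨e', he', z, hz⟩ := ih _ hlt (e y) rfl (by rw [he, lor_apply]; exact h4)
          (Or.inl ⟨l, by rw [h5]; exact hl.sub_odd hodd⟩)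
          (Or.inl ⟨i, by rw [h2]; exact hi.sub_odd hodd⟩)
        exact ⟨e.trans e', fun x y => by simp [he', he], z, by simpa using hz⟩

end Orbit

section Final

/-- The stabilised form. -/
def stab {L : Type} [AddCommGroup L] (b : L →ₗ[ℤ] L →ₗ[ℤ] ℤ) :
    (L × ℤ × ℤ) →ₗ[ℤ] (L × ℤ × ℤ) →ₗ[ℤ] ℤ := dsum b (dsum (sc 1) (sc (-1)))

theorem stab_apply {L : Type} [AddCommGroup L] (b : L →ₗ[ℤ] L →ₗ[ℤ] ℤ) (x y : L × ℤ × ℤ) :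
    stab b x y = b x.1 y.1 + x.2.1 * y.2.1 - x.2.2 * y.2.2 := by
  simp only [stab, dsum_apply, sc_apply]; ring

/-- The embedding of the doubled even sublattice plus hyperbolic plane. -/
def emb {L : Type} [AddCommGroup L] (K : Submodule ℤ L) :
    (K × (Fin 2 → ℤ)) →ₗ[ℤ] (L × ℤ × ℤ) where
  toFun v := ((2 : ℤ) • (v.1 : L), v.2 0 + v.2 1, v.2 0 - v.2 1)
  map_add' v w := by
    refine Prod.ext ?_ (Prod.ext ?_ ?_)
    · simp
    · simp; ring
    · simp; ring
  map_smul' a v := by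
    refine Prod.ext ?_ (Prod.ext ?_ ?_)
    · change (2 : ℤ) • (a • (v.1 : L)) = a • ((2 : ℤ) • (v.1 : L))
      rw [smul_comm]
    · simp; ring
    · simp; ring

theorem emb_apply {L : Type} [AddCommGroup L] (K : Submodule ℤ L) (v : K × (Fin 2 → ℤ)) :
    emb K v = ((2 : ℤ) • (v.1 : L), v.2 0 + v.2 1, v.2 0 - v.2 1) := rfl

theorem emb_inj {L : Type} [AddCommGroup L] [Module.IsTorsionFree ℤ L] (K : Submodule ℤ L) :
    Function.Injective (emb K) := by
  intro v w h
  rw [emb_apply, emb_apply] at h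
  have h1 := congrArg Prod.fst h
  have h2 := congrArg (fun x => x.2.1) h
  have h3 := congrArg (fun x => x.2.2) h
  simp only at h1 h2 h3
  refine Prod.ext (Subtype.ext ?_) (funext fun i => ?_)
  · exact smul_right_injective L (two_ne_zero : (2 : ℤ) ≠ 0) h1
  · fin_cases i
    · simp; omega
    · simp; omega

theorem stab_emb {L : Type} [AddCommGroup L] (b : L →ₗ[ℤ] L →ₗ[ℤ] ℤ) (K : Submodule ℤ L)
    (v w : K × (Fin 2 → ℤ)) :
    stab b (emb K v) (emb K w) = 2 * (2 * b v.1 w.1 + hypForm v.2 w.2) := by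
  rw [stab_apply, emb_apply, emb_apply, hypForm]
  simp only [map_smul, LinearMap.smul_apply, smul_eq_mul]
  ring

theorem emb_range {L : Type} [AddCommGroup L] (b : L →ₗ[ℤ] L →ₗ[ℤ] ℤ) (K : Submodule ℤ L)
    (hK : ∀ x, x ∈ K ↔ Even (b x x)) (c : L) (hc : ∀ x, Even (b x c - b x x)) (m : L × ℤ × ℤ) :
    m ∈ LinearMap.range (emb K) ↔
      (∃ (m' : L × ℤ × ℤ) (s : ℤ), m = (2 : ℤ) • m' + s • (0, 1, 1)) ∧
        (4 : ℤ) ∣ stab b m (c, 0, 0) := by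
  have hdv : ∀ x, x ∈ K ↔ (4 : ℤ) ∣ 2 * b x c := by
    intro x
    rw [hK]
    obtain ⟨k, hk⟩ := hc x
    constructor
    · rintro ⟨j, hj⟩
      omega
    · intro h
      rw [Int.even_iff]
      omega
  constructor
  · rintro ⟨v, rfl⟩
    constructor
    · refine ⟨(v.1, v.2 1, 0), v.2 0 - v.2 1, ?_⟩
      rw [emb_apply]
      refine Prod.ext ?_ (Prod.ext ?_ ?_)
      · simp
      · simp; ring
      · simp
    · rw [stab_apply, emb_apply]
      have := (hdv v.1).1 v.1.2
      simpa using this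
  · rintro ⟨⟨⟨x, p, q⟩, s, rfl⟩, h⟩
    rw [stab_apply] at h
    have hx : x ∈ K := by
      rw [hdv]
      simpa using h
    refine ⟨(⟨x, hx⟩, ![p + q + s, p - q]), ?_⟩
    rw [emb_apply]
    refine Prod.ext ?_ (Prod.ext ?_ ?_)
    · simp
    · simp; ring
    · simp; ring

theorem glue {A A' M M' : Type} [AddCommGroup A] [AddCommGroup A'] [AddCommGroup M]
    [AddCommGroup M'] (f : A →ₗ[ℤ] M) (g : A' →ₗ[ℤ] M') (hf : Function.Injective f)
    (hg : Function.Injective g) (Ψ : M ≃ₗ[ℤ] M')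
    (h : ∀ m, m ∈ LinearMap.range f ↔ Ψ m ∈ LinearMap.range g) :
    ∃ e : A' ≃ₗ[ℤ] A, ∀ v, Ψ (f (e v)) = g v := by
  have hmap : (LinearMap.range f).map (Ψ : M →ₗ[ℤ] M') = LinearMap.range g := by
    ext z
    constructor
    · rintro ⟨m, hm, rfl⟩
      exact (h m).1 hm
    · intro hz
      refine ⟨Ψ.symm z, (h _).2 (by simpa using hz), by simp⟩
  let e : A ≃ₗ[ℤ] A' := ((LinearEquiv.ofInjective f hf).trans
    ((Ψ.submoduleMap _).trans (LinearEquiv.ofEq _ _ hmap))).trans (LinearEquiv.ofInjective g hg).symm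
  refine ⟨e.symm, fun v => ?_⟩
  obtain ⟨a, rfl⟩ := e.surjective v
  rw [LinearEquiv.symm_apply_apply]
  have : (LinearEquiv.ofInjective g hg) (e a) = ⟨Ψ (f a), (h _).1 ⟨a, rfl⟩⟩ := by
    simp only [e, LinearEquiv.trans_apply, LinearEquiv.apply_symm_apply]
    rfl
  have := congrArg Subtype.val this
  exact this.symm

theorem uni_of_det {h : ℕ} (b : (Fin h → ℤ) →ₗ[ℤ] (Fin h → ℤ) →ₗ[ℤ] ℤ)
    (huni : (gram b).det = 1 ∨ (gram b).det = -1) (φ : (Fin h → ℤ) →ₗ[ℤ] ℤ) :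
    ∃ x, ∀ y, b x y = φ y := by
  have hu : IsUnit (gram b).det := Int.isUnit_iff.2 huni
  let f : Fin h → ℤ := fun j => φ (Pi.single j 1)
  let x := Matrix.vecMul f (gram b)⁻¹
  have hx : Matrix.vecMul x (gram b) = f := by
    simp only [x]
    rw [Matrix.vecMul_vecMul, Matrix.nonsing_inv_mul _ hu, Matrix.vecMul_one]
  refine ⟨x, fun y => ?_⟩
  have : b x = φ := by
    apply (Pi.basisFun ℤ (Fin h)).ext
    intro j
    rw [Pi.basisFun_apply]
    have h1 := congrFun hx j
    rw [Matrix.vecMul, dotProduct] at h1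
    have h2 : x = ∑ i, x i • (Pi.single i 1 : Fin h → ℤ) := by
      ext k; simp [Finset.sum_apply, Pi.single_apply]
    conv_lhs => rw [h2]
    simp only [map_sum, map_smul, LinearMap.sum_apply, LinearMap.smul_apply, smul_eq_mul]
    exact h1
  rw [this]

theorem exists_char {h : ℕ} (b : (Fin h → ℤ) →ₗ[ℤ] (Fin h → ℤ) →ₗ[ℤ] ℤ)
    (hs : ∀ x y, b x y = b y x)
    (huni : ∀ φ : (Fin h → ℤ) →ₗ[ℤ] ℤ, ∃ x, ∀ y, b x y = φ y) :
    ∃ c, ∀ x, Even (b x c - b x x) := by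
  let φ : (Fin h → ℤ) →ₗ[ℤ] ℤ := ∑ i, (b (Pi.single i 1) (Pi.single i 1)) • LinearMap.proj i
  obtain ⟨c, hc⟩ := huni φ
  refine ⟨c, ?_⟩
  let S : Submodule ℤ (Fin h → ℤ) :=
    { carrier := {x | Even (b x c - b x x)}
      zero_mem' := by simp
      add_mem' := by
        intro x y hx hy
        simp only [Set.mem_setOf_eq] at *
        have : b (x + y) c - b (x + y) (x + y)
            = (b x c - b x x) + (b y c - b y y) - 2 * b x y := by
          simp only [map_add, LinearMap.add_apply]
          rw [hs y x]; ring
        rw [this]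
        exact (hx.add hy).sub (even_two_mul _)
      smul_mem' := by
        intro a x hx
        simp only [Set.mem_setOf_eq] at *
        have : b (a • x) c - b (a • x) (a • x)
            = a * (b x c - b x x) - (a * (a - 1)) * b x x := by
          simp only [map_smul, LinearMap.smul_apply, smul_eq_mul]; ring
        rw [this]
        exact (hx.mul_left a).sub ((Int.even_mul_pred_self a).mul_right _) }
  intro x
  change x ∈ S
  have h2 : x = ∑ i, x i • (Pi.single i 1 : Fin h → ℤ) := by
    ext k; simp [Finset.sum_apply, Pi.single_apply]
  rw [h2]
  refine Submodule.sum_mem _ fun i _ => Submodule.smul_mem _ _ ?_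
  change Even (b (Pi.single i 1) c - b (Pi.single i 1) (Pi.single i 1))
  rw [hs _ c, hc]
  have : φ (Pi.single i 1) = b (Pi.single i 1) (Pi.single i 1) := by
    simp [φ, LinearMap.sum_apply, Pi.single_apply]
  rw [this]; simp

theorem odd_sq_mod_eight {a : ℤ} (h : Odd a) : (8 : ℤ) ∣ a * a - 1 := by
  obtain ⟨k, rfl⟩ := h
  obtain ⟨j, hj⟩ := Int.even_mul_succ_self k
  refine ⟨j, ?_⟩
  linear_combination 4 * hj

/-- Abbreviation for the standard form. -/
abbrev std (h : ℕ) : (Fin h → ℤ) →ₗ[ℤ] (Fin h → ℤ) →ₗ[ℤ] ℤ := dg (fun _ : Fin h => (1 : ℤ))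

theorem std_to_lor (h : ℕ) : ∃ θ : ((Fin h → ℤ) × ℤ × ℤ) ≃ₗ[ℤ] ((Fin (h + 1) → ℤ) × ℤ),
    (∀ x y, lor (h + 1) (θ x) (θ y) = stab (std h) x y) ∧ θ (0, 1, 1) = (Pi.single 0 1, 1) := by
  refine ⟨{
    toFun := fun x => (Fin.cons x.2.1 x.1, x.2.2)
    invFun := fun y => (Fin.tail y.1, y.1 0, y.2)
    map_add' := fun x y => by
      refine Prod.ext (funext fun i => ?_) rfl
      refine Fin.cases ?_ (fun j => ?_) i <;> simp
    map_smul' := fun a x => by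
      refine Prod.ext (funext fun i => ?_) rfl
      refine Fin.cases ?_ (fun j => ?_) i <;> simp
    left_inv := fun x => by simp
    right_inv := fun y => by simp }, fun x y => ?_, ?_⟩
  · rw [lor_apply, stab_apply]
    simp [Fin.sum_univ_succ]
    ring
  · refine Prod.ext (funext fun i => ?_) rfl
    refine Fin.cases ?_ (fun j => ?_) i <;> simp

theorem exists_good_isom {h : ℕ} (b : (Fin h → ℤ) →ₗ[ℤ] (Fin h → ℤ) →ₗ[ℤ] ℤ)
    (hsymm : ∀ x y, b x y = b y x)
    (hodd : ∃ x, Odd (b x x))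
    (hpos : ∀ x, x ≠ 0 → 0 < b x x)
    (huni : ∀ φ : (Fin h → ℤ) →ₗ[ℤ] ℤ, ∃ x, ∀ y, b x y = φ y) :
    ∃ Ψ : ((Fin h → ℤ) × ℤ × ℤ) ≃ₗ[ℤ] ((Fin h → ℤ) × ℤ × ℤ),
      (∀ x y, stab (std h) (Ψ x) (Ψ y) = stab b x y) ∧
      ∃ z, Ψ (0, 1, 1) = (0, 1, 1) + (2 : ℤ) • z := by
  obtain ⟨Ψ0, hΨ0⟩ := stable_class h (Fin h → ℤ) b hsymm hpos huni (by simp)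
  obtain ⟨θ, hθ, hθκ⟩ := std_to_lor h
  let Φ := Ψ0.trans θ
  have hΦ : ∀ x y, lor (h + 1) (Φ x) (Φ y) = stab b x y := by
    intro x y
    simp only [Φ, LinearEquiv.trans_apply]
    rw [hθ]
    exact hΨ0 x y
  let κ : (Fin h → ℤ) × ℤ × ℤ := (0, 1, 1)
  have hκκ : lor (h + 1) (Φ κ) (Φ κ) = 0 := by
    rw [hΦ, stab_apply]; simp [κ]
  have hnz : (∃ i, Odd ((Φ κ).1 i)) ∨ Odd (Φ κ).2 := by
    by_contra hcon
    push Not at hcon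
    obtain ⟨h1, h2⟩ := hcon
    have h3 : Even (lor (h + 1) (Φ κ) (Φ (0, 1, 0))) := by
      rw [lor_apply]
      refine Even.sub (Finset.even_sum _ fun i _ => ?_) ?_
      · exact (Int.not_odd_iff_even.1 (h1 i)).mul_right _
      · exact (Int.not_odd_iff_even.1 h2).mul_right _
    rw [hΦ, stab_apply] at h3
    simp [κ] at h3
  have hnc : (∃ i, Even ((Φ κ).1 i)) ∨ Even (Φ κ).2 := by
    by_contra hcon
    push Not at hcon
    obtain ⟨h1, h2⟩ := hcon
    obtain ⟨x, hx⟩ := hodd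
    have h3 : Even (lor (h + 1) (Φ κ) (Φ (x, 0, 0)) - lor (h + 1) (Φ (x, 0, 0)) (Φ (x, 0, 0))) := by
      rw [lor_apply, lor_apply]
      have key : ∀ a c : ℤ, Odd a → Even (a * c - c * c) := by
        intro a c ha
        rw [← sub_mul]
        rcases Int.even_or_odd c with hc | hc
        · exact hc.mul_left _
        · exact (ha.sub_odd hc).mul_right _
      rw [sub_sub_sub_comm, ← Finset.sum_sub_distrib]
      refine Even.sub (Finset.even_sum _ fun i _ => ?_) ?_
      · exact key _ _ (Int.not_even_iff_odd.1 (h1 i))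
      · exact key _ _ (Int.not_even_iff_odd.1 h2)
    rw [hΦ, hΦ, stab_apply, stab_apply] at h3
    simp [κ] at h3
    exact (Int.not_even_iff_odd.2 hx) h3
  obtain ⟨σ, hσ, z, hz⟩ := orbit h _ (Φ κ) rfl (by rw [hκκ]; simp) hnz hnc
  refine ⟨(Φ.trans σ).trans θ.symm, fun x y => ?_, θ.symm z, ?_⟩
  · rw [← hθ]
    simp only [LinearEquiv.trans_apply, LinearEquiv.apply_symm_apply]
    rw [hσ, hΦ]
  · simp only [LinearEquiv.trans_apply]
    change θ.symm (σ (Φ κ)) = _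
    rw [hz, ← hθκ, map_add, map_smul, LinearEquiv.symm_apply_apply]

theorem std_char_odd {h : ℕ} (χ : (Fin h → ℤ) × ℤ × ℤ)
    (hχ : ∀ y, Even (stab (std h) χ y - stab (std h) y y)) :
    (∀ i, Odd (χ.1 i)) ∧ Odd χ.2.1 ∧ Odd χ.2.2 := by
  refine ⟨fun i => ?_, ?_, ?_⟩
  · have h1 := hχ (Pi.single i 1, 0, 0)
    rw [stab_apply, stab_apply] at h1
    simp [Pi.single_apply] at h1
    exact h1
  · have h1 := hχ (0, 1, 0)
    rw [stab_apply, stab_apply] at h1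
    simp at h1
    exact h1
  · have h1 := hχ (0, 0, 1)
    rw [stab_apply, stab_apply] at h1
    simp at h1
    exact h1

theorem sum_odd_sq {h : ℕ} (x : Fin h → ℤ) (hx : ∀ i, Odd (x i)) :
    (8 : ℤ) ∣ ∑ i, x i * x i - h := by
  have : ∑ i, x i * x i - (h : ℤ) = ∑ i, (x i * x i - 1) := by
    rw [Finset.sum_sub_distrib]; simp
  rw [this]
  exact Finset.dvd_sum fun i _ => odd_sq_mod_eight (hx i)

theorem gamma_mod {h : ℕ} (b : (Fin h → ℤ) →ₗ[ℤ] (Fin h → ℤ) →ₗ[ℤ] ℤ)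
    (c : Fin h → ℤ) (hsymm : ∀ x y, b x y = b y x) (hc : ∀ x, Even (b x c - b x x))
    (Ψ : ((Fin h → ℤ) × ℤ × ℤ) ≃ₗ[ℤ] ((Fin h → ℤ) × ℤ × ℤ))
    (hΨ : ∀ x y, stab (std h) (Ψ x) (Ψ y) = stab b x y)
    (z : (Fin h → ℤ) × ℤ × ℤ) (hz : Ψ (0, 1, 1) = (0, 1, 1) + (2 : ℤ) • z) :
    ∃ δ : (Fin h → ℤ) × ℤ × ℤ, Ψ (c, 0, 0) = (fun _ => 1, 0, 0) + (2 : ℤ) • δ ∧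
      Even (δ.2.1 - δ.2.2) := by
  have hχ := std_char_odd (Ψ (c, 1, 1)) (by
    intro y
    obtain ⟨x, rfl⟩ := Ψ.surjective y
    rw [hΨ, hΨ, stab_apply, stab_apply, hsymm]
    have e : b x.1 c + (1 : ℤ) * x.2.1 - 1 * x.2.2 - (b x.1 x.1 + x.2.1 * x.2.1 - x.2.2 * x.2.2)
      = (b x.1 c - b x.1 x.1) - x.2.1 * (x.2.1 - 1) + x.2.2 * (x.2.2 - 1) := by ring
    change Even (b x.1 c + (1 : ℤ) * x.2.1 - 1 * x.2.2 - _)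
    rw [e]
    exact ((hc x.1).sub (Int.even_mul_pred_self _)).add (Int.even_mul_pred_self _))
  have hadd : Ψ (c, 1, 1) = Ψ (c, 0, 0) + ((0, 1, 1) + (2 : ℤ) • z) := by
    rw [← hz, ← map_add]; simp
  have hγ1 : ∀ i, Odd ((Ψ (c, 0, 0)).1 i) := by
    intro i
    have := hχ.1 i
    rw [hadd] at this
    simp at this
    rw [Int.odd_iff] at this ⊢
    omega
  have hγ2 : Even (Ψ (c, 0, 0)).2.1 := by
    have := hχ.2.1
    rw [hadd] at this
    simp at this
    rw [Int.odd_iff] at this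
    rw [Int.even_iff]
    omega
  have hγ3 : Even (Ψ (c, 0, 0)).2.2 := by
    have := hχ.2.2
    rw [hadd] at this
    simp at this
    rw [Int.odd_iff] at this
    rw [Int.even_iff]
    omega
  obtain ⟨p, hp⟩ := hγ2
  obtain ⟨q, hq⟩ := hγ3
  choose d hd using hγ1
  refine ⟨(d, p, q), Prod.ext (funext fun i => ?_) (Prod.ext ?_ ?_), ?_⟩
  · rw [hd]; simp; ring
  · rw [hp]; simp; ring
  · rw [hq]; simp; ring
  -- norms
  have n1 : stab (std h) (Ψ (c, 0, 0)) (Ψ (c, 0, 0)) = b c c := by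
    rw [hΨ, stab_apply]; simp
  have n2 : stab (std h) (Ψ (c, 1, 1)) (Ψ (c, 1, 1)) = b c c := by
    rw [hΨ, stab_apply]; simp
  rw [stab_apply, dg_apply, hp, hq] at n1
  rw [stab_apply, dg_apply] at n2
  simp only [one_mul] at n1 n2
  have s1 := sum_odd_sq _ (fun i => (⟨d i, hd i⟩ : Odd ((Ψ (c, 0, 0)).1 i)))
  have s2 := sum_odd_sq _ hχ.1
  have s3 := odd_sq_mod_eight hχ.2.1
  have s4 := odd_sq_mod_eight hχ.2.2
  have s5 : (8 : ℤ) ∣ 4 * (p * p - q * q) := by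
    have e : (4 : ℤ) * (p * p - q * q) = (p + p) * (p + p) - (q + q) * (q + q) := by ring
    rw [e]
    omega
  have s6 : (2 : ℤ) ∣ p * p - q * q := by omega
  have s7 : Even ((p - q) * (p + q)) := by
    have : (p - q) * (p + q) = p * p - q * q := by ring
    rw [this]; exact even_iff_two_dvd.2 s6
  change Even (p - q)
  rcases Int.even_mul.1 s7 with h | h
  · exact h
  · rw [Int.even_iff] at h ⊢; omega

theorem range_iff {h : ℕ} (b : (Fin h → ℤ) →ₗ[ℤ] (Fin h → ℤ) →ₗ[ℤ] ℤ)
    (c : Fin h → ℤ)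
    (Ψ : ((Fin h → ℤ) × ℤ × ℤ) ≃ₗ[ℤ] ((Fin h → ℤ) × ℤ × ℤ))
    (hΨ : ∀ x y, stab (std h) (Ψ x) (Ψ y) = stab b x y)
    (z : (Fin h → ℤ) × ℤ × ℤ) (hz : Ψ (0, 1, 1) = (0, 1, 1) + (2 : ℤ) • z)
    (δ : (Fin h → ℤ) × ℤ × ℤ) (hδ : Ψ (c, 0, 0) = (fun _ => 1, 0, 0) + (2 : ℤ) • δ)
    (hδ2 : Even (δ.2.1 - δ.2.2)) (m : (Fin h → ℤ) × ℤ × ℤ) :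
    ((∃ (m' : (Fin h → ℤ) × ℤ × ℤ) (s : ℤ), m = (2 : ℤ) • m' + s • (0, 1, 1)) ∧
        (4 : ℤ) ∣ stab b m (c, 0, 0)) ↔
    ((∃ (m' : (Fin h → ℤ) × ℤ × ℤ) (s : ℤ), Ψ m = (2 : ℤ) • m' + s • (0, 1, 1)) ∧
        (4 : ℤ) ∣ stab (std h) (Ψ m) (fun _ => 1, 0, 0)) := by
  have h1 : (∃ (m' : (Fin h → ℤ) × ℤ × ℤ) (s : ℤ), m = (2 : ℤ) • m' + s • (0, 1, 1)) ↔
      (∃ (m' : (Fin h → ℤ) × ℤ × ℤ) (s : ℤ), Ψ m = (2 : ℤ) • m' + s • (0, 1, 1)) := by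
    constructor
    · rintro ⟨m', s, rfl⟩
      refine ⟨Ψ m' + s • z, s, ?_⟩
      rw [map_add, map_smul, map_smul, hz]
      module
    · rintro ⟨m', s, hm⟩
      refine ⟨Ψ.symm (m' - s • z), s, ?_⟩
      apply Ψ.injective
      rw [hm, map_add, map_smul, map_smul, hz, LinearEquiv.apply_symm_apply]
      module
  rw [h1]
  refine and_congr_right ?_
  rintro ⟨m', s, hm⟩
  rw [← hΨ, hδ, map_add, map_smul]
  have h2 : (4 : ℤ) ∣ (2 : ℤ) • stab (std h) (Ψ m) δ := by
    rw [hm]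
    obtain ⟨k, hk⟩ := hδ2
    have e : stab (std h) (0, 1, 1) δ = k + k := by
      rw [stab_apply, ← hk]; simp
    rw [map_add, map_smul, map_smul, LinearMap.add_apply, LinearMap.smul_apply,
      LinearMap.smul_apply, e]
    exact ⟨stab (std h) m' δ + s * k, by simp only [smul_eq_mul]; ring⟩
  exact dvd_add_left h2

end Final

/-- for an odd, positive definite, unimodular symmetric bilinear form `b`
on `ℤ^h` and the standard dot product `u` (with exterior submodule `D_h`), the forms
`2·u^nd_ext ⊕ H` and `2·b^nd_ext ⊕ H` are isometric over `ℤ`. -/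
theorem stmt8 (h : ℕ) (b : (Fin h → ℤ) →ₗ[ℤ] (Fin h → ℤ) →ₗ[ℤ] ℤ)
    (hsymm : ∀ x y, b x y = b y x)
    (hodd : ∃ x, Odd (b x x))
    (hpos : ∀ x, x ≠ 0 → 0 < b x x)
    (huni : (gram b).det = 1 ∨ (gram b).det = -1) :
    ∃ e : (↥(Dsub h) × (Fin 2 → ℤ)) ≃ₗ[ℤ] (↥(extSub b hsymm) × (Fin 2 → ℤ)),
      ∀ v w : ↥(Dsub h) × (Fin 2 → ℤ),
        2 * (∑ i, (v.1 : Fin h → ℤ) i * (w.1 : Fin h → ℤ) i) + hypForm v.2 w.2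
          = 2 * b ((e v).1 : Fin h → ℤ) ((e w).1 : Fin h → ℤ)
              + hypForm (e v).2 (e w).2 := by
  have hu := uni_of_det b huni
  obtain ⟨c, hc⟩ := exists_char b hsymm hu
  obtain ⟨Ψ, hΨ, z, hz⟩ := exists_good_isom b hsymm hodd hpos hu
  obtain ⟨δ, hδ, hδ2⟩ := gamma_mod b c hsymm hc Ψ hΨ z hz
  have hcstd : ∀ x : Fin h → ℤ, Even (std h x (fun _ => 1) - std h x x) := by
    intro x
    rw [dg_apply, dg_apply, ← Finset.sum_sub_distrib]
    refine Finset.even_sum _ fun i _ => ?_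
    have e : (1 : ℤ) * (x i * 1) - 1 * (x i * x i) = - (x i * (x i - 1)) := by ring
    rw [e]
    exact (Int.even_mul_pred_self _).neg
  have hD : ∀ x, x ∈ Dsub h ↔ Even (std h x x) := by
    intro x
    have h1 := hcstd x
    have h2 : std h x (fun _ => 1) = ∑ i, x i := by simp
    rw [h2, Int.even_sub] at h1
    exact h1
  obtain ⟨e, he⟩ := glue (emb (extSub b hsymm)) (emb (Dsub h)) (emb_inj _) (emb_inj _) Ψ (by
    intro m
    rw [emb_range b (extSub b hsymm) (fun x => Iff.rfl) c hc,
      emb_range (std h) (Dsub h) hD (fun _ => 1) hcstd]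
    exact range_iff b c Ψ hΨ z hz δ hδ hδ2 m)
  refine ⟨e, fun v w => ?_⟩
  have h1 := hΨ (emb _ (e v)) (emb _ (e w))
  rw [he, he, stab_emb, stab_emb] at h1
  have h2 := mul_left_cancel₀ (two_ne_zero : (2 : ℤ) ≠ 0) h1
  rw [← h2, dg_apply]
  simp
end

section
/- Let b and c be odd, positive definite, unimodular symmetric bilinear forms over ℤ on ℤ^h, and assume h % 8 ≠ 4. If there exists a ℤ-linear equivalence ψ : K_b ≃ K_c with c (ψ x) (ψ y) = b x y for all x, y ∈ K_b (i.e. the exterior non-degenerate forms b^nd_ext and c^nd_ext are isometric), then there exists a ℤ-linear equivalence Ψ : (Fin h → ℤ) ≃ (Fin h → ℤ) with c (Ψ x) (Ψ y) = b x y for all x, y (i.e. b and c are isometric). -/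
open Complex Real

noncomputable def gf (a : ℕ) (u n : ℤ) : ℂ := cexp (π * I * (n ^ 2 + u * n) / a)

lemma gf_period (a : ℕ) (ha : a ≠ 0) (u : ℤ) (hu : Even (u + a)) (n m : ℤ) :
    gf a u (n + a * m) = gf a u n := by
  have ha' : (a : ℂ) ≠ 0 := by exact_mod_cast ha
  have hev : Even (a * m ^ 2 + u * m) := by
    rcases Int.even_or_odd m with hm | hm
    · obtain ⟨t, rfl⟩ := hm
      exact ⟨a * (t + t) * t + u * t, by ring⟩
    · obtain ⟨t, rfl⟩ := hm
      obtain ⟨s, hs⟩ := hu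
      exact ⟨s * (2 * t + 1) + a * (2 * t + 1) * t, by
        have : u = s + s - a := by omega
        rw [this]; ring⟩
  obtain ⟨t, ht⟩ := hev
  have ht' : (a : ℂ) * m ^ 2 + u * m = t + t := by exact_mod_cast ht
  unfold gf
  rw [Complex.exp_eq_exp_iff_exists_int]
  refine ⟨n * m + t, ?_⟩
  push_cast
  field_simp
  linear_combination (a : ℂ) * ht'

lemma gf_mod (a : ℕ) (ha : a ≠ 0) (u : ℤ) (hu : Even (u + a)) (n : ℤ) :
    gf a u (((n : ZMod a)).val : ℤ) = gf a u n := by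
  have : NeZero a := ⟨ha⟩
  rw [ZMod.val_intCast]
  conv_rhs => rw [← Int.emod_add_mul_ediv n a]
  rw [gf_period a ha u hu]

noncomputable def gG (a : ℕ) [NeZero a] (u : ℤ) : ℂ := ∑ d : ZMod a, gf a u (d.val : ℤ)

lemma gG_shift (a : ℕ) [NeZero a] (u : ℤ) (hu : Even (u + a)) (n : ℤ) :
    ∑ d : ZMod a, gf a u ((d.val : ℤ) + n) = gG a u := by
  have ha := NeZero.ne a
  unfold gG
  rw [← Equiv.sum_comp (Equiv.addRight (n : ZMod a)) (fun d : ZMod a => gf a u (d.val : ℤ))]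
  refine Finset.sum_congr rfl fun d _ => ?_
  rw [← gf_mod a ha u hu]
  simp

lemma tsum_split (a : ℕ) [NeZero a] (F : ℤ → ℂ) (hF : Summable F) :
    ∑' n, F n = ∑ d : ZMod a, ∑' m : ℤ, F ((d.val : ℤ) + a * m) := by
  let e : Fin a × ℤ ≃ ℤ := (Equiv.prodComm (Fin a) ℤ).trans (Int.divModEquiv a).symm
  have h2 : Summable (fun p => F (e p)) := e.summable_iff.2 hF
  rw [← e.tsum_eq, Summable.tsum_prod h2, tsum_fintype]
  have he : ∀ (k : Fin a) (m : ℤ), e (k, m) = (k : ℤ) + a * m := by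
    intro k m
    simp [e]; ring
  simp_rw [he]
  cases a with
  | zero => exact absurd rfl (NeZero.ne 0)
  | succ n => rfl

lemma sum_gauss (T z : ℂ) (hT : 0 < T.re) :
    Summable fun n : ℤ => cexp (-π * T * n ^ 2 + 2 * π * z * n) := by
  have := (summable_jacobiTheta₂_term_iff (-I * z) (I * T)).2 (by simpa using hT)
  refine this.congr fun n => ?_
  unfold jacobiTheta₂_term
  congr 1
  linear_combination (2 * π * z * n - π * n ^ 2 * T) * (-I_sq)

lemma sqrt_branch (R S : ℂ) (a : ℕ) (ha : 0 < a) (hR : 0 < R.re) (hS : 0 < S.re)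
    (h : R * S = -I / a) :
    (1 / R ^ (1 / 2 : ℂ)) * (1 / S ^ (1 / 2 : ℂ)) = (Real.sqrt a : ℂ) * cexp (π * I / 4) := by
  have hR0 : R ≠ 0 := by rintro rfl; simp at hR
  have hS0 : S ≠ 0 := by rintro rfl; simp at hS
  have h1 : |R.arg| < π / 2 := Complex.abs_arg_lt_pi_div_two_iff.2 (Or.inl hR)
  have h2 : |S.arg| < π / 2 := Complex.abs_arg_lt_pi_div_two_iff.2 (Or.inl hS)
  rw [abs_lt] at h1 h2
  have hl : Complex.log (R * S) = Complex.log R + Complex.log S :=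
    Complex.log_mul hR0 hS0 ⟨by linarith, by linarith⟩
  have ha' : (0 : ℝ) < a := by exact_mod_cast ha
  have hl2 : Complex.log (R * S) = ((-Real.log a : ℝ) : ℂ) + -(π / 2) * I := by
    have : R * S = ((a : ℝ)⁻¹ : ℝ) * (-I) := by rw [h]; push_cast; ring
    rw [this, Complex.log_ofReal_mul (by positivity) (by simp), Complex.log_neg_I,
      Real.log_inv]
  have hs : (Real.sqrt a : ℂ) = cexp ((Real.log a : ℝ) / 2) := by
    rw [Real.sqrt_eq_rpow, Real.rpow_def_of_pos ha']
    push_cast; congr 1; ring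
  rw [hs, Complex.cpow_def_of_ne_zero hR0, Complex.cpow_def_of_ne_zero hS0, one_div (cexp _), one_div (cexp _),
    ← Complex.exp_neg, ← Complex.exp_neg, ← Complex.exp_add, ← Complex.exp_add]
  congr 1
  rw [hl] at hl2
  push_cast at hl2 ⊢
  linear_combination (-1/2) * hl2

lemma gG_eq (a : ℕ) [NeZero a] (u : ℤ) (hu : Even (u + a)) :
    gG a u = (Real.sqrt a : ℂ) * cexp (π * I / 4) * cexp (- π * I * u ^ 2 / (4 * a)) := by
  have ha := NeZero.ne a
  have hapos : 0 < a := Nat.pos_of_ne_zero ha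
  have ha' : (a : ℂ) ≠ 0 := by exact_mod_cast ha
  have haR : (0 : ℝ) < a := by exact_mod_cast hapos
  have hden : (1 + I * a : ℂ) ≠ 0 := by
    intro h0; have := congrArg Complex.re h0; simp at this
  set R : ℂ := 1 - I / a with hRdef
  set S : ℂ := 1 / (1 + I * a) with hSdef
  have hR : 0 < R.re := by
    have : (I / (a : ℂ)).re = 0 := by
      rw [show (I / (a : ℂ)) = ((a : ℝ)⁻¹ : ℝ) * I by push_cast; ring]; simp
    rw [hRdef, Complex.sub_re, this]; simp
  have hS : 0 < S.re := by
    rw [hSdef, one_div, Complex.inv_re]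
    apply div_pos
    · simp
    · exact Complex.normSq_pos.2 hden
  have hR0 : R ≠ 0 := by intro h0; rw [h0] at hR; simp at hR
  have hS0 : S ≠ 0 := by intro h0; rw [h0] at hS; simp at hS
  have hRa : R * a = a - I := by rw [hRdef]; field_simp
  have hRS : R * S = -I / a := by
    rw [hRdef, hSdef]; field_simp
    linear_combination (a : ℂ) * (I_sq)
  set C : ℂ := ∑' n : ℤ, cexp (-π * 1 * n ^ 2 + 2 * π * (I * u / (2 * a)) * n) with hC
  have P3 : C = ∑' n : ℤ, cexp (-π * (n - u / (2 * a)) ^ 2) := by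
    rw [hC, Complex.tsum_exp_neg_quadratic (by simp)]
    simp only [one_cpow, div_one, one_mul]
    refine tsum_congr fun n => ?_
    congr 1
    rw [show (I * (I * u / (2 * a)) : ℂ) = - (u / (2 * a)) by
      linear_combination (u / (2 * a) : ℂ) * I_sq]
    ring
  have hCne : C ≠ 0 := by
    rw [P3]
    have hsum : Summable fun n : ℤ => Real.exp (-π * (n - u / (2 * a)) ^ 2) := by
      have h1 := (sum_gauss 1 (u / (2 * a)) (by simp)).mul_left
        (cexp (-π * (u / (2 * a)) ^ 2))
      have h2 := h1.norm
      refine h2.congr fun n => ?_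
      rw [← Complex.exp_add, Complex.norm_exp]
      congr 1
      rw [show (-π * (u / (2 * a)) ^ 2 + (-π * 1 * n ^ 2 + 2 * π * (u / (2 * a)) * n) : ℂ)
        = ((-π * (n - u / (2 * a)) ^ 2 : ℝ) : ℂ) by push_cast; ring]
      exact Complex.ofReal_re _
    have : (∑' n : ℤ, cexp (-π * (n - u / (2 * a)) ^ 2))
        = ((∑' n : ℤ, Real.exp (-π * (n - u / (2 * a)) ^ 2) : ℝ) : ℂ) := by
      rw [Complex.ofReal_tsum]
      refine tsum_congr fun n => ?_
      push_cast; rfl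
    rw [this]
    have hp : 0 < ∑' n : ℤ, Real.exp (-π * (n - u / (2 * a)) ^ 2) :=
      hsum.tsum_pos (fun n => (Real.exp_pos _).le) 0 (Real.exp_pos _)
    exact_mod_cast hp.ne'
  have P1 : (∑' n : ℤ, cexp (-π * S * n ^ 2 + 2 * π * (I * u / (2 * a)) * n))
      = 1 / S ^ (1 / 2 : ℂ) * (cexp (- π * I * u ^ 2 / (4 * a)) * C) := by
    rw [Complex.tsum_exp_neg_quadratic hS, P3]
    congr 1
    rw [← tsum_mul_left]
    refine tsum_congr fun n => ?_
    rw [← Complex.exp_add, Complex.exp_eq_exp_iff_exists_int]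
    have hev : Even (u * n - a * n ^ 2) := by
      obtain ⟨s, hs⟩ := hu
      have : u = s + s - a := by omega
      have h2 : Even (n * (n + 1)) := Int.even_mul_succ_self n
      obtain ⟨r, hr⟩ := h2
      exact ⟨s * n - a * r, by rw [this]; linear_combination (-(a : ℤ)) * hr⟩
    obtain ⟨t, ht⟩ := hev
    have ht' : (u : ℂ) * n - a * n ^ 2 = t + t := by exact_mod_cast ht
    refine ⟨t, ?_⟩
    rw [show (I * (I * u / (2 * a)) : ℂ) = - (u / (2 * a)) by
      linear_combination (u / (2 * a) : ℂ) * I_sq]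
    rw [hSdef]
    field_simp
    linear_combination (16 * a ^ 2 * I : ℂ) * ht'
  have P2 : ∀ k : ℤ, (∑' n : ℤ, cexp (-π * R * n ^ 2 + 2 * π * (-I * k / a) * n))
      = 1 / R ^ (1 / 2 : ℂ) * ∑' m : ℤ, cexp (-π / R * (m + k / a) ^ 2) := by
    intro k
    rw [Complex.tsum_exp_neg_quadratic hR]
    congr 1
    refine tsum_congr fun n => ?_
    rw [show (I * (-I * k / a) : ℂ) = (k / a) by
      linear_combination (-k / a : ℂ) * I_sq]
  have E1 : ∑ d : ZMod a, gf a u (d.val : ℤ) *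
      (∑' n : ℤ, cexp (-π * R * n ^ 2 + 2 * π * (-I * ((d.val : ℤ) : ℂ) / a) * n))
      = gG a u * C := by
    simp_rw [← tsum_mul_left]
    rw [← Summable.tsum_finsetSum (fun d _ => (sum_gauss R _ hR).mul_left _), hC,
      ← tsum_mul_left]
    refine tsum_congr fun n => ?_
    rw [← gG_shift a u hu (-n), Finset.sum_mul]
    refine Finset.sum_congr rfl fun d _ => ?_
    unfold gf
    rw [← Complex.exp_add, ← Complex.exp_add]
    congr 1
    push_cast
    rw [hRdef]
    field_simp
    ring
  have E2 : ∑ d : ZMod a, gf a u (d.val : ℤ) *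
      (∑' m : ℤ, cexp (-π / R * (m + ((d.val : ℤ) : ℂ) / a) ^ 2))
      = ∑' n : ℤ, cexp (-π * S * n ^ 2 + 2 * π * (I * u / (2 * a)) * n) := by
    have hs := sum_gauss S (I * u / (2 * a)) hS
    rw [tsum_split a _ hs]
    have key : ∀ (k : ℕ) (m : ℤ), gf a u k * cexp (-π / R * (m + ((k : ℤ) : ℂ) / a) ^ 2)
        = cexp (-π * S * ((k + a * m : ℤ) : ℂ) ^ 2 +
          2 * π * (I * u / (2 * a)) * ((k + a * m : ℤ) : ℂ)) := by
      intro k m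
      rw [← gf_period a ha u hu k m]
      unfold gf
      rw [← Complex.exp_add]
      congr 1
      have hS' : S = 1 / (R * a ^ 2) - I / a := by
        rw [eq_comm, ← mul_right_inj' hR0, hRS]
        field_simp
        linear_combination (-I) * hRa + I_sq
      rw [hS']
      push_cast
      field_simp
      ring
    refine Finset.sum_congr rfl fun d _ => ?_
    rw [← tsum_mul_left]
    exact tsum_congr fun m => key d.val m
  have E3 : gG a u * C = 1 / R ^ (1 / 2 : ℂ) * (1 / S ^ (1 / 2 : ℂ) * (cexp (- π * I * u ^ 2 / (4 * a)) * C)) := by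
    rw [← E1, ← P1, ← E2, Finset.mul_sum]
    refine Finset.sum_congr rfl fun d _ => ?_
    rw [P2]; ring
  rw [← sqrt_branch R S a hapos hR hS hRS]
  apply mul_right_cancel₀ hCne
  rw [E3]; ring

lemma char_sum {D : Type*} [AddCommGroup D] [Fintype D] (H : AddSubgroup D) (Q : D → ℂ)
    (h1 : ∀ d ∈ H, Q d = 1)
    (h2 : ∀ d, d ∉ H → ∃ h0 ∈ H, ∃ c : ℂ, c ≠ 1 ∧ ∀ x ∈ H, Q (d + x + h0) = c * Q (d + x)) :
    ∑ d, Q d = (Nat.card H : ℂ) := by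
  classical
  have hI : ∀ d, ∑ x : H, Q (d + x) = if d ∈ H then (Nat.card H : ℂ) else 0 := by
    intro d
    split_ifs with hd
    · rw [Finset.sum_congr rfl (fun x _ => h1 _ (H.add_mem hd x.2))]
      simp [Nat.card_eq_fintype_card]
    · obtain ⟨h0, hh0, c, hc, hx⟩ := h2 d hd
      have e := Equiv.sum_comp (Equiv.addRight (⟨h0, hh0⟩ : H)) (fun x : H => Q (d + x))
      simp only [Equiv.coe_addRight, AddSubgroup.coe_add, ← add_assoc] at e
      rw [Finset.sum_congr rfl (fun (x : H) _ => hx x x.2), ← Finset.mul_sum] at e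
      have : (c - 1) * ∑ x : H, Q (d + x) = 0 := by linear_combination e
      exact (mul_eq_zero.1 this).resolve_left (sub_ne_zero.2 hc)
  have hsum : ∑ d, ∑ x : H, Q (d + x) = (Nat.card H : ℂ) * ∑ d, Q d := by
    rw [Finset.sum_comm]
    have e : ∀ x : H, ∑ d, Q (d + x) = ∑ d, Q d := fun x =>
      Equiv.sum_comp (Equiv.addRight (x : D)) (fun d => Q d)
    simp only [e]
    simp [Nat.card_eq_fintype_card]
  have hne : (Nat.card H : ℂ) ≠ 0 := by
    exact_mod_cast (Nat.card_pos (α := H)).ne'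
  apply mul_left_cancel₀ hne
  rw [← hsum, Finset.sum_congr rfl (fun d _ => hI d), ← Finset.sum_filter, Finset.sum_const,
    nsmul_eq_mul]
  congr 2
  rw [Nat.card_eq_fintype_card, Fintype.card_subtype]

section lat
variable {h : ℕ}

lemma gram_apply (b : (Fin h → ℤ) →ₗ[ℤ] (Fin h → ℤ) →ₗ[ℤ] ℤ) (x y : Fin h → ℤ) :
    b x y = ∑ i, ∑ j, x i * gram b i j * y j := by
  conv_lhs => rw [pi_eq_sum_univ' x, pi_eq_sum_univ' y]
  simp only [map_sum, LinearMap.sum_apply, map_smul, LinearMap.smul_apply, smul_eq_mul]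
  rw [Finset.sum_comm]
  refine Finset.sum_congr rfl fun i _ => ?_
  rw [Finset.mul_sum]
  refine Finset.sum_congr rfl fun j _ => ?_
  simp only [gram, Matrix.of_apply]
  ring

lemma unimod_rep (b : (Fin h → ℤ) →ₗ[ℤ] (Fin h → ℤ) →ₗ[ℤ] ℤ)
    (hu : (gram b).det = 1 ∨ (gram b).det = -1) (f : (Fin h → ℤ) →ₗ[ℤ] ℤ) :
    ∃ y, ∀ x, b y x = f x := by
  have hunit : IsUnit (gram b).det := by
    rcases hu with hu | hu <;> rw [hu] <;> simp
  refine ⟨Matrix.vecMul (fun j => f (Pi.single j 1)) (gram b)⁻¹, ?_⟩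
  have key : b (Matrix.vecMul (fun j => f (Pi.single j 1)) (gram b)⁻¹) = f := by
    apply LinearMap.pi_ext'
    intro j
    ext
    simp only [LinearMap.coe_comp, LinearMap.coe_single, Function.comp_apply]
    rw [gram_apply]
    have h3 : Matrix.vecMul (Matrix.vecMul (fun j => f (Pi.single j 1)) (gram b)⁻¹) (gram b)
        = fun j => f (Pi.single j 1) := by
      rw [Matrix.vecMul_vecMul, Matrix.nonsing_inv_mul _ hunit, Matrix.vecMul_one]
    have h4 := congrFun h3 j
    rw [← h4]
    conv_rhs => rw [Matrix.vecMul, dotProduct]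
    refine Finset.sum_congr rfl fun i _ => ?_
    rw [Finset.sum_eq_single j]
    · simp
    · intro k _ hk; simp [Pi.single_apply, hk]
    · simp
  intro x; rw [key]

lemma exists_orth (b : (Fin h → ℤ) →ₗ[ℤ] (Fin h → ℤ) →ₗ[ℤ] ℤ)
    (hs : ∀ x y, b x y = b y x) (hpos : ∀ x, x ≠ 0 → 0 < b x x) :
    ∃ v : Fin h → (Fin h → ℤ), (∀ i j, i ≠ j → b (v i) (v j) = 0) ∧
      (∀ i, 0 < b (v i) (v i)) ∧
      ∀ x y, (b x y : ℚ) = ∑ i, (b x (v i) : ℚ) * b y (v i) / b (v i) (v i) := by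
  let B : LinearMap.BilinForm ℚ (Fin h → ℚ) := Matrix.toBilin' ((gram b).map (Int.cast : ℤ → ℚ))
  have hB : ∀ x y : Fin h → ℤ, B (fun i => (x i : ℚ)) (fun i => (y i : ℚ)) = b x y := by
    intro x y
    rw [gram_apply]
    simp [B, Matrix.toBilin'_apply]
  have hBs : LinearMap.IsSymm B := by
    constructor
    intro x y
    simp only [B, Matrix.toBilin'_apply, RingHom.id_apply]
    rw [Finset.sum_comm]
    refine Finset.sum_congr rfl fun i _ => Finset.sum_congr rfl fun j _ => ?_
    simp only [Matrix.map_apply, gram, Matrix.of_apply]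
    rw [hs]; ring
  have : Invertible (2 : ℚ) := invertibleOfNonzero (by norm_num)
  obtain ⟨u0, hu0⟩ := LinearMap.BilinForm.exists_orthogonal_basis hBs
  have hfr : Module.finrank ℚ (Fin h → ℚ) = h := by simp
  let u := u0.reindex (finCongr hfr)
  have hu : ∀ i j, i ≠ j → B (u i) (u j) = 0 := by
    intro i j hij
    simp only [u, Module.Basis.reindex_apply]
    exact hu0 (fun hh => hij ((finCongr hfr).symm.injective hh))
  obtain ⟨N, hN⟩ := IsLocalization.exist_integer_multiples_of_finite (nonZeroDivisors ℤ)
    (fun p : Fin h × Fin h => u p.1 p.2)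
  have hN0 : ((N : ℤ) : ℚ) ≠ 0 := by
    have := nonZeroDivisors.ne_zero N.2
    exact_mod_cast this
  choose z hz using hN
  set n : ℚ := ((N : ℤ) : ℚ) with hn
  have hz' : ∀ i, (fun j => (z (i, j) : ℚ)) = n • u i := by
    intro i; ext j
    have := hz (i, j)
    simpa [hn] using this
  let v : Fin h → (Fin h → ℤ) := fun i j => z (i, j)
  have hv : ∀ i, (fun j => (v i j : ℚ)) = n • u i := hz'
  have hvne : ∀ i, v i ≠ 0 := by
    intro i h0
    have h1 := hv i
    rw [h0] at h1
    have h2 : n • u i = 0 := by rw [← h1]; ext j; simp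
    rcases smul_eq_zero.1 h2 with h3 | h3
    · exact hN0 h3
    · exact u.ne_zero i h3
  have hvv : ∀ i j, (b (v i) (v j) : ℚ) = n ^ 2 * B (u i) (u j) := by
    intro i j
    rw [← hB, hv, hv]
    simp only [map_smul, LinearMap.smul_apply, smul_eq_mul]; ring
  have hxv : ∀ x i, (b x (v i) : ℚ) = n * B (fun i => (x i : ℚ)) (u i) := by
    intro x i
    rw [← hB, hv]
    simp only [map_smul, smul_eq_mul]
  refine ⟨v, ?_, fun i => hpos _ (hvne i), ?_⟩
  · intro i j hij
    have := hvv i j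
    rw [hu i j hij, mul_zero] at this
    exact_mod_cast this
  · intro x y
    have hne : ∀ i, B (u i) (u i) ≠ 0 := by
      intro i h0
      have h1 := hvv i i
      rw [h0, mul_zero] at h1
      have h2 := hpos _ (hvne i)
      have h3 : b (v i) (v i) = 0 := by exact_mod_cast h1
      omega
    set X : Fin h → ℚ := fun i => (x i : ℚ)
    set Y : Fin h → ℚ := fun i => (y i : ℚ)
    have hY : ∀ i, B Y (u i) = u.repr Y i * B (u i) (u i) := by
      intro i
      conv_lhs => rw [← u.sum_repr Y]
      simp only [map_sum, LinearMap.sum_apply, map_smul, LinearMap.smul_apply, smul_eq_mul]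
      rw [Finset.sum_eq_single i]
      · intro j _ hj; rw [hu j i hj, mul_zero]
      · simp
    rw [← hB]
    change B X Y = _
    conv_lhs => rw [← u.sum_repr Y]
    simp only [map_sum, map_smul, smul_eq_mul]
    refine Finset.sum_congr rfl fun i _ => ?_
    rw [hxv, hxv, hvv]
    change _ = n * B X (u i) * (n * B Y (u i)) / _
    rw [hY]
    have := hne i
    field_simp

lemma vdb (b : (Fin h → ℤ) →ₗ[ℤ] (Fin h → ℤ) →ₗ[ℤ] ℤ)
    (hs : ∀ x y, b x y = b y x) (hpos : ∀ x, x ≠ 0 → 0 < b x x)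
    (huni : (gram b).det = 1 ∨ (gram b).det = -1)
    (w : Fin h → ℤ) (hw : ∀ x, Even (b x x + b w x)) :
    ∃ n : ℤ, (h : ℤ) - b w w = 8 * n := by
  obtain ⟨v, hvo, hvp, hpar⟩ := exists_orth b hs hpos
  let a : Fin h → ℕ := fun i => (b (v i) (v i)).toNat
  have haZ : ∀ i, (a i : ℤ) = b (v i) (v i) := fun i => Int.toNat_of_nonneg (hvp i).le
  have ha : ∀ i, a i ≠ 0 := by
    intro i h0; have := haZ i; have := hvp i; omega
  have hne : ∀ i, NeZero (a i) := fun i => ⟨ha i⟩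
  have hC : ∀ i, (a i : ℂ) ≠ 0 := fun i => by exact_mod_cast ha i
  have hpar' : ∀ x y, (b x y : ℂ) = ∑ i, (b x (v i) : ℂ) * b y (v i) / a i := by
    intro x y
    have h1 := congrArg (Rat.cast : ℚ → ℂ) (hpar x y)
    push_cast at h1
    rw [h1]
    refine Finset.sum_congr rfl fun i _ => ?_
    have : (a i : ℂ) = (b (v i) (v i) : ℂ) := by exact_mod_cast haZ i
    rw [this]
  have hwi : ∀ i, Even (b w (v i) + a i) := by
    intro i; rw [haZ, add_comm]; exact hw _
  let φ : (Fin h → ℤ) →+ (∀ i, ZMod (a i)) :=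
    { toFun := fun x i => ((b x (v i) : ℤ) : ZMod (a i))
      map_zero' := by ext i; simp
      map_add' := by intro x y; ext i; simp }
  let Q : (∀ i, ZMod (a i)) → ℂ := fun d => ∏ i, gf (a i) (b w (v i)) ((d i).val : ℤ)
  have hQ : ∀ k : Fin h → ℤ, Q (fun i => (k i : ZMod (a i))) =
      cexp (π * I * ∑ i, ((k i : ℂ) ^ 2 + b w (v i) * k i) / a i) := by
    intro k
    simp only [Q]
    rw [Finset.prod_congr rfl (fun i _ => gf_mod (a i) (ha i) _ (hwi i) (k i))]
    unfold gf
    rw [← Complex.exp_sum, Finset.mul_sum]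
    congr 1
    refine Finset.sum_congr rfl fun i _ => ?_
    ring
  have hS : ∑ d, Q d = (Nat.card φ.range : ℂ) := by
    apply char_sum
    · rintro d ⟨x, rfl⟩
      change Q (fun i => ((b x (v i) : ℤ) : ZMod (a i))) = 1
      rw [hQ, Complex.exp_eq_one_iff]
      obtain ⟨t, ht⟩ := hw x
      refine ⟨t, ?_⟩
      have ht' : (b x x : ℂ) + b w x = t + t := by exact_mod_cast ht
      rw [hpar' x x, hpar' w x, ← Finset.sum_add_distrib] at ht'
      have : ∑ i, ((b x (v i) : ℂ) ^ 2 + b w (v i) * b x (v i)) / a i = t + t := by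
        rw [← ht']; refine Finset.sum_congr rfl fun i _ => ?_; ring
      rw [this]; ring
    · intro d hd
      let k : Fin h → ℤ := fun i => ((d i).val : ℤ)
      have hk : d = fun i => (k i : ZMod (a i)) := by
        ext i; simp [k]
      have hex : ∃ x0, ∀ m : ℤ, ∑ i, (k i : ℂ) * b x0 (v i) / a i ≠ m := by
        by_contra hcon
        push Not at hcon
        choose F hF using hcon
        let f : (Fin h → ℤ) →ₗ[ℤ] ℤ := 
          { toFun := F
            map_add' := by
              intro x y
              have : (F (x + y) : ℂ) = F x + F y := by
                rw [← hF, ← hF, ← hF, ← Finset.sum_add_distrib]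
                refine Finset.sum_congr rfl fun i _ => ?_
                simp only [map_add, LinearMap.add_apply]; push_cast; ring
              exact_mod_cast this
            map_smul' := by
              intro c x
              have : (F (c • x) : ℂ) = c * F x := by
                rw [← hF, ← hF, Finset.mul_sum]
                refine Finset.sum_congr rfl fun i _ => ?_
                simp only [map_smul, LinearMap.smul_apply, smul_eq_mul]; push_cast; ring
              simp only [smul_eq_mul, RingHom.id_apply]
              exact_mod_cast this }
        obtain ⟨y, hy⟩ := unimod_rep b huni f
        apply hd
        refine ⟨y, ?_⟩
        rw [hk]
        ext j
        change ((b y (v j) : ℤ) : ZMod (a j)) = (k j : ZMod (a j))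
        congr 1
        rw [hy]
        have : (F (v j) : ℂ) = k j := by
          rw [← hF, Finset.sum_eq_single j]
          · have : (b (v j) (v j) : ℂ) = a j := by exact_mod_cast (haZ j).symm
            rw [this]; have := hC j; field_simp
          · intro i _ hij
            rw [hvo j i hij.symm]; simp
          · simp
        exact_mod_cast this
      obtain ⟨x0, hx0⟩ := hex
      refine ⟨φ x0, ⟨x0, rfl⟩, cexp (2 * π * I * ∑ i, (k i : ℂ) * b x0 (v i) / a i), ?_, ?_⟩
      · intro h1
        rw [Complex.exp_eq_one_iff] at h1
        obtain ⟨m, hm⟩ := h1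
        apply hx0 m
        have hpi : (2 * π * I : ℂ) ≠ 0 := Complex.two_pi_I_ne_zero
        apply mul_left_cancel₀ hpi
        rw [hm]; ring
      · rintro _ ⟨x, rfl⟩
        have e1 : d + φ x = fun i => ((k i + b x (v i) : ℤ) : ZMod (a i)) := by
          rw [hk]; ext i; simp [φ]
        have e2 : d + φ x + φ x0 =
            fun i => ((k i + b x (v i) + b x0 (v i) : ℤ) : ZMod (a i)) := by
          rw [hk]; ext i; simp [φ]
        rw [e2, e1, hQ, hQ, ← Complex.exp_add, Complex.exp_eq_exp_iff_exists_int]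
        obtain ⟨t, ht⟩ := hw x0
        have ht' : (b x0 x0 : ℂ) + b w x0 = t + t := by exact_mod_cast ht
        refine ⟨b x x0 + t, ?_⟩
        have hsum : ∑ i, (((k i + b x (v i) + b x0 (v i) : ℤ) : ℂ) ^ 2 +
              b w (v i) * ((k i + b x (v i) + b x0 (v i) : ℤ) : ℂ)) / a i
            = ∑ i, (((k i + b x (v i) : ℤ) : ℂ) ^ 2 +
              b w (v i) * ((k i + b x (v i) : ℤ) : ℂ)) / a i
              + 2 * (∑ i, (k i : ℂ) * b x0 (v i) / a i) + 2 * b x x0 + b x0 x0 + b w x0 := by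
          rw [hpar' x x0, hpar' x0 x0, hpar' w x0, Finset.mul_sum, Finset.mul_sum,
            ← Finset.sum_add_distrib, ← Finset.sum_add_distrib, ← Finset.sum_add_distrib,
            ← Finset.sum_add_distrib]
          refine Finset.sum_congr rfl fun i _ => ?_
          push_cast; ring
        rw [hsum]
        push_cast
        linear_combination (π * I) * ht'
  have hP : ∑ d, Q d = ((∏ i, Real.sqrt (a i) : ℝ) : ℂ) *
      cexp (((π / 4 * (h - b w w) : ℝ) : ℂ) * I) := by
    simp only [Q]
    rw [← Fintype.prod_sum (fun i (j : ZMod (a i)) => gf (a i) (b w (v i)) (j.val : ℤ))]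
    have : ∀ i, ∑ j : ZMod (a i), gf (a i) (b w (v i)) (j.val : ℤ) = gG (a i) (b w (v i)) :=
      fun i => rfl
    simp only [this]
    rw [Finset.prod_congr rfl (fun i _ => gG_eq (a i) _ (hwi i))]
    rw [Finset.prod_mul_distrib, Finset.prod_mul_distrib, ← Complex.exp_sum, ← Complex.exp_sum,
      mul_assoc, ← Complex.exp_add]
    push_cast
    congr 2
    rw [hpar' w w, mul_sub, sub_mul, Finset.mul_sum, Finset.sum_mul, sub_eq_add_neg,
      ← Finset.sum_neg_distrib]
    congr 1
    · simp; ring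
    · refine Finset.sum_congr rfl fun i _ => ?_
      have := hC i
      field_simp
  have hr : 0 < ∏ i, Real.sqrt (a i) := by
    apply Finset.prod_pos
    intro i _
    apply Real.sqrt_pos.2
    exact_mod_cast Nat.pos_of_ne_zero (ha i)
  have hfin := hP.symm.trans hS
  have hnorm := congrArg norm hfin
  rw [norm_mul, Complex.norm_exp_ofReal_mul_I, mul_one, Complex.norm_real,
    Complex.norm_natCast, Real.norm_of_nonneg hr.le] at hnorm
  rw [show ((Nat.card φ.range : ℕ) : ℂ) = (((Nat.card φ.range : ℕ) : ℝ) : ℂ) by push_cast; rfl,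
    ← hnorm] at hfin
  have hone : cexp (((π / 4 * (h - b w w) : ℝ) : ℂ) * I) = 1 := by
    have h0 : ((∏ i, Real.sqrt (a i) : ℝ) : ℂ) ≠ 0 := by exact_mod_cast hr.ne'
    apply mul_left_cancel₀ h0
    rw [hfin, mul_one]
  rw [Complex.exp_eq_one_iff] at hone
  obtain ⟨n, hn⟩ := hone
  refine ⟨n, ?_⟩
  have hpi : (π * I : ℂ) ≠ 0 := by simp [Real.pi_ne_zero]
  have : (h : ℂ) - b w w = 8 * n := by
    apply mul_left_cancel₀ hpi
    push_cast at hn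
    linear_combination 4 * hn
  exact_mod_cast this

/-- halving the image of the doubled vector -/
lemma ext_exists (hmod : h % 8 ≠ 4)
    (b c : (Fin h → ℤ) →ₗ[ℤ] (Fin h → ℤ) →ₗ[ℤ] ℤ)
    (hbs : ∀ x y, b x y = b y x) (hcs : ∀ x y, c x y = c y x)
    (hcpos : ∀ x, x ≠ 0 → 0 < c x x)
    (hcuni : (gram c).det = 1 ∨ (gram c).det = -1)
    (ψ : ↥(extSub b hbs) ≃ₗ[ℤ] ↥(extSub c hcs))
    (hψ : ∀ x y : ↥(extSub b hbs),
        c ((ψ x : Fin h → ℤ)) ((ψ y : Fin h → ℤ)) = b (x : Fin h → ℤ) (y : Fin h → ℤ))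
    (h2 : ∀ x : Fin h → ℤ, (2 : ℤ) • x ∈ extSub b hbs) :
    ∃ Ψ : (Fin h → ℤ) →ₗ[ℤ] (Fin h → ℤ),
      ∀ x, (2 : ℤ) • Ψ x = (ψ ⟨(2 : ℤ) • x, h2 x⟩ : Fin h → ℤ) := by
  have hmem : ∀ y, y ∈ extSub c hcs ↔ Even (c y y) := fun y => Iff.rfl
  have hinj : ∀ y z : Fin h → ℤ, (∀ x, c y x = c z x) → y = z := by
    intro y z hyz
    by_contra hne
    have h1 := hcpos (y - z) (sub_ne_zero.2 hne)
    rw [map_sub c, LinearMap.sub_apply, hyz, sub_self] at h1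
    exact lt_irrefl _ h1
  have hhalf : ∀ x, ∃ y : Fin h → ℤ, (2 : ℤ) • y = (ψ ⟨(2 : ℤ) • x, h2 x⟩ : Fin h → ℤ) := by
    intro x
    set z : Fin h → ℤ := (ψ ⟨(2 : ℤ) • x, h2 x⟩ : Fin h → ℤ) with hz
    have hzz : c z z = 4 * b x x := by
      rw [hz, hψ]; simp only [map_smul, LinearMap.smul_apply, smul_eq_mul]; ring
    by_cases hx : x ∈ extSub b hbs
    · refine ⟨ψ ⟨x, hx⟩, ?_⟩
      rw [hz, ← Submodule.coe_smul, ← map_smul]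
      rfl
    have hxodd : Odd (b x x) := Int.not_even_iff_odd.1 hx
    have hK : ∀ y, Even (c y y) → Even (c z y) := by
      intro y hy
      obtain ⟨y', hy'⟩ := ψ.surjective ⟨y, hy⟩
      have e : y = (ψ y' : Fin h → ℤ) := by rw [hy']
      rw [e, hz, hψ]
      simp only [map_smul, LinearMap.smul_apply, smul_eq_mul]
      exact even_two_mul _
    by_cases hall : ∀ y, Even (c z y)
    · choose F hF using hall
      let f : (Fin h → ℤ) →ₗ[ℤ] ℤ :=
        { toFun := F
          map_add' := by
            intro p q
            have h1 := hF (p + q)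
            rw [map_add, hF p, hF q] at h1
            omega
          map_smul' := by
            intro r p
            have h1 := hF (r • p)
            rw [map_smul, hF p, smul_eq_mul] at h1
            simp only [smul_eq_mul, RingHom.id_apply]
            linarith }
      obtain ⟨y, hy⟩ := unimod_rep c hcuni f
      refine ⟨y, hinj _ _ fun p => ?_⟩
      rw [map_smul, LinearMap.smul_apply, hy, hF p, smul_eq_mul]
      change 2 * F p = _
      ring
    · exfalso
      push Not at hall
      obtain ⟨y0, hy0⟩ := hall
      have hy0' : ¬ Even (c y0 y0) := fun hh => hy0 (hK _ hh)
      have hchar : ∀ y, Even (c y y + c z y) := by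
        intro y
        by_cases hy : Even (c y y)
        · exact hy.add (hK y hy)
        · have h3 : Even (c (y - y0) (y - y0)) := by
            have e : c (y - y0) (y - y0) = c y y + c y0 y0 - 2 * c y y0 := by
              simp only [map_sub, LinearMap.sub_apply]; rw [hcs y0 y]; ring
            rw [e]
            simp only [Int.even_iff] at *
            omega
          have h4 := hK _ h3
          rw [map_sub] at h4
          simp only [Int.even_iff] at *
          omega
      obtain ⟨n, hn⟩ := vdb c hcs hcpos hcuni z hchar
      obtain ⟨t, ht⟩ := hxodd
      rw [hzz, ht] at hn
      omega
  choose F hF using hhalf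
  have hcancel : ∀ p q : Fin h → ℤ, (2 : ℤ) • p = (2 : ℤ) • q → p = q := by
    intro p q hpq
    exact smul_right_injective _ (by norm_num : (2 : ℤ) ≠ 0) hpq
  refine ⟨{ toFun := F, map_add' := ?_, map_smul' := ?_ }, hF⟩
  · intro p q
    apply hcancel
    rw [smul_add, hF, hF, hF, ← Submodule.coe_add, ← map_add]
    congr 2
    ext1
    simp
  · intro r p
    apply hcancel
    simp only [RingHom.id_apply]
    rw [smul_comm, hF, hF, ← Submodule.coe_smul, ← map_smul]
    congr 2
    ext1
    exact smul_comm _ _ _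

end lat

/-- if `b, c` are odd, positive definite, unimodular symmetric bilinear
forms on `ℤ^h` with `h % 8 ≠ 4`, and their exterior non-degenerate forms are isometric,
then `b` and `c` are isometric. -/
theorem stmt13 (h : ℕ) (hmod : h % 8 ≠ 4)
    (b c : (Fin h → ℤ) →ₗ[ℤ] (Fin h → ℤ) →ₗ[ℤ] ℤ)
    (hbs : ∀ x y, b x y = b y x) (hcs : ∀ x y, c x y = c y x)
    (hbodd : ∃ x, Odd (b x x)) (hcodd : ∃ x, Odd (c x x))
    (hbpos : ∀ x, x ≠ 0 → 0 < b x x) (hcpos : ∀ x, x ≠ 0 → 0 < c x x)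
    (hbuni : (gram b).det = 1 ∨ (gram b).det = -1)
    (hcuni : (gram c).det = 1 ∨ (gram c).det = -1)
    (hiso : ∃ ψ : ↥(extSub b hbs) ≃ₗ[ℤ] ↥(extSub c hcs),
      ∀ x y : ↥(extSub b hbs),
        c ((ψ x : Fin h → ℤ)) ((ψ y : Fin h → ℤ)) = b (x : Fin h → ℤ) (y : Fin h → ℤ)) :
    ∃ Ψ : (Fin h → ℤ) ≃ₗ[ℤ] (Fin h → ℤ), ∀ x y, c (Ψ x) (Ψ y) = b x y := by
  obtain ⟨ψ, hψ⟩ := hiso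
  have h2b : ∀ x : Fin h → ℤ, (2 : ℤ) • x ∈ extSub b hbs := by
    intro x
    change Even (b _ _)
    rw [map_smul, smul_eq_mul]
    exact even_two_mul _
  have h2c : ∀ x : Fin h → ℤ, (2 : ℤ) • x ∈ extSub c hcs := by
    intro x
    change Even (c _ _)
    rw [map_smul, smul_eq_mul]
    exact even_two_mul _
  obtain ⟨Ψ, hΨ⟩ := ext_exists hmod b c hbs hcs hcpos hcuni ψ hψ h2b
  have hψ' : ∀ x y : ↥(extSub c hcs),
      b ((ψ.symm x : Fin h → ℤ)) ((ψ.symm y : Fin h → ℤ)) = c (x : Fin h → ℤ) (y : Fin h → ℤ) := by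
    intro x y
    rw [← hψ]; simp
  obtain ⟨Φ, hΦ⟩ := ext_exists hmod c b hcs hbs hbpos hbuni ψ.symm hψ' h2c
  have hcancel : ∀ p q : Fin h → ℤ, (2 : ℤ) • p = (2 : ℤ) • q → p = q := by
    intro p q hpq
    exact smul_right_injective _ (by norm_num : (2 : ℤ) ≠ 0) hpq
  refine ⟨LinearEquiv.ofLinearMap Ψ Φ ?_ ?_, ?_⟩
  · apply LinearMap.ext
    intro x
    apply hcancel
    simp only [LinearMap.comp_apply, LinearMap.id_apply]
    rw [hΨ]
    have : (⟨(2 : ℤ) • Φ x, h2b _⟩ : extSub b hbs) = ψ.symm ⟨(2 : ℤ) • x, h2c x⟩ :=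
      Subtype.ext (hΦ x)
    rw [this]; simp
  · apply LinearMap.ext
    intro x
    apply hcancel
    simp only [LinearMap.comp_apply, LinearMap.id_apply]
    rw [hΦ]
    have : (⟨(2 : ℤ) • Ψ x, h2c _⟩ : extSub c hcs) = ψ ⟨(2 : ℤ) • x, h2b x⟩ :=
      Subtype.ext (hΨ x)
    rw [this]; simp
  · intro x y
    rw [LinearEquiv.coe_ofLinearMap]
    have h1 := hψ ⟨(2 : ℤ) • x, h2b x⟩ ⟨(2 : ℤ) • y, h2b y⟩
    rw [← hΨ, ← hΨ] at h1
    simp only [map_smul, LinearMap.smul_apply, smul_eq_mul] at h1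
    omega
end

section
/- Let h ≥ 1 with h % 8 ≠ 0 and h % 8 ≠ 4, let β be a positive definite symmetric ℚ-bilinear form on V := Fin h → ℚ, and let L ⊆ V be an odd unimodular integral lattice with respect to β. Then there is no unimodular integral lattice N ⊆ V with N ⊓ L = M₂(L). (An odd unimodular lattice of rank h ≢ 0, 4 mod 8 has no neighbours sharing the index-two sublattice M₂(L).) -/
/-- `L` is a unimodular integral lattice w.r.t. `β` if it equals its dual lattice
`L^∨ = {v | ∀ x ∈ L, β v x ∈ ℤ}`. -/
def IsUnimodularLattice {h : ℕ} (β : (Fin h → ℚ) →ₗ[ℚ] (Fin h → ℚ) →ₗ[ℚ] ℚ)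
    (L : Submodule ℤ (Fin h → ℚ)) : Prop :=
  ∀ v : Fin h → ℚ, v ∈ L ↔ ∀ x ∈ L, ∃ n : ℤ, β v x = (n : ℚ)

/-- `L` is odd: `β x x` is an odd integer for some `x ∈ L`. -/
def IsOddLattice {h : ℕ} (β : (Fin h → ℚ) →ₗ[ℚ] (Fin h → ℚ) →ₗ[ℚ] ℚ)
    (L : Submodule ℤ (Fin h → ℚ)) : Prop :=
  ∃ x ∈ L, ∃ n : ℤ, Odd n ∧ β x x = (n : ℚ)

/-- `L` is even: `β x x` is an even integer for every `x ∈ L`. -/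
def IsEvenLattice {h : ℕ} (β : (Fin h → ℚ) →ₗ[ℚ] (Fin h → ℚ) →ₗ[ℚ] ℚ)
    (L : Submodule ℤ (Fin h → ℚ)) : Prop :=
  ∀ x ∈ L, ∃ n : ℤ, Even n ∧ β x x = (n : ℚ)

/-- The index-two sublattice `M₂(L) = {x ∈ L | β x x is an even integer}` (as a set). -/
def M2set {h : ℕ} (β : (Fin h → ℚ) →ₗ[ℚ] (Fin h → ℚ) →ₗ[ℚ] ℚ)
    (L : Submodule ℤ (Fin h → ℚ)) : Set (Fin h → ℚ) :=
  {x | x ∈ L ∧ ∃ n : ℤ, Even n ∧ β x x = (n : ℚ)}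

open Matrix

lemma skew_det_sq (n : ℕ) : ∀ K : Matrix (Fin n) (Fin n) ℚ, Kᵀ = -K → IsSquare K.det := by
  induction n using Nat.strong_induction_on with
  | _ n ih =>
  intro K hK
  have hs : ∀ i j, K i j = - K j i := fun i j => by
    have := congrFun (congrFun hK j) i
    simpa using this
  have hd : ∀ i, K i i = 0 := fun i => by linarith [hs i i]
  rcases n with _ | _ | m
  · simp
  · rw [Matrix.det_fin_one, hd]; simp
  by_cases h0 : ∀ j, K 0 j = 0
  · rw [Matrix.det_eq_zero_of_row_eq_zero 0 h0]; simp
  push Not at h0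
  obtain ⟨j, hj⟩ := h0
  have hj0 : j ≠ 0 := by rintro rfl; exact hj (hd 0)
  let e0 : Fin 2 ⊕ Fin m ≃ Fin (m+2) := finSumFinEquiv.trans (finCongr (by omega))
  let e : Fin 2 ⊕ Fin m ≃ Fin (m+2) := e0.trans (Equiv.swap 1 j)
  have e1 : e (Sum.inl 0) = 0 := by
    have : e0 (Sum.inl 0) = 0 := by ext; simp [e0]
    simp only [e, Equiv.trans_apply, this]
    exact Equiv.swap_apply_of_ne_of_ne (by simp) hj0.symm
  have e2 : e (Sum.inl 1) = j := by
    have : e0 (Sum.inl 1) = 1 := by ext; simp [e0]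
    simp only [e, Equiv.trans_apply, this, Equiv.swap_apply_left]
  rw [← Matrix.det_submatrix_equiv_self e K]
  set M := K.submatrix e e with hM
  have hMs : ∀ i j, M i j = - M j i := fun i j => hs _ _
  rw [← Matrix.fromBlocks_toBlocks M]
  have hA : M.toBlocks₁₁.det = (K 0 j)^2 := by
    rw [Matrix.det_fin_two]
    simp only [toBlocks₁₁, of_apply, hM, submatrix_apply, e1, e2, hd]
    rw [hs j 0]; ring
  have : Invertible M.toBlocks₁₁ := Matrix.invertibleOfIsUnitDet _ (by rw [hA]; simpa using hj)
  rw [Matrix.det_fromBlocks₁₁, hA]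
  refine IsSquare.mul (IsSquare.sq _) (ih m (by omega) _ ?_)
  have t11 : M.toBlocks₁₁ᵀ = - M.toBlocks₁₁ := by ext a b; exact hMs _ _
  have t12 : M.toBlocks₁₂ᵀ = - M.toBlocks₂₁ := by ext a b; exact hMs _ _
  have t21 : M.toBlocks₂₁ᵀ = - M.toBlocks₁₂ := by ext a b; exact hMs _ _
  have t22 : M.toBlocks₂₂ᵀ = - M.toBlocks₂₂ := by ext a b; exact hMs _ _
  have ti : (M.toBlocks₁₁⁻¹)ᵀ = - M.toBlocks₁₁⁻¹ := by
    rw [Matrix.transpose_nonsing_inv, t11]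
    apply Matrix.inv_eq_left_inv
    simp
  rw [Matrix.invOf_eq_nonsing_inv]
  simp only [transpose_sub, transpose_mul, t12, t21, t22, ti]
  simp [Matrix.mul_assoc]
  abel

lemma skew_det_sq_int (n : ℕ) (K : Matrix (Fin n) (Fin n) ℤ) (hK : Kᵀ = -K) : IsSquare K.det := by
  have := skew_det_sq n (K.map (Int.castRingHom ℚ)) (by
    ext i j; have := congrFun (congrFun hK i) j
    simp at this ⊢; exact_mod_cast this)
  rw [← RingHom.mapMatrix_apply, ← RingHom.map_det] at this
  exact Rat.isSquare_intCast_iff.mp this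

lemma even_det (n : ℕ) (E : Matrix (Fin n) (Fin n) ℤ) (hE : Eᵀ = E) (hd : ∀ i, Even (E i i))
    (h1 : (E.det : ZMod 4) = 1) : (n : ZMod 4) = 0 := by
  let A : Matrix (Fin n) (Fin n) ℤ :=
    Matrix.of fun i j => if i < j then E i j else if i = j then E i i / 2 else 0
  have hs : ∀ i j, E i j = E j i := fun i j => congrFun (congrFun hE j) i
  have hA : E = A + Aᵀ := by
    ext i j
    simp only [Matrix.add_apply, transpose_apply, A, Matrix.of_apply]
    rcases lt_trichotomy i j with h | h | h
    · simp [h, h.not_gt, h.ne']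
    · subst h; have := hd i; simp; obtain ⟨r, hr⟩ := this; omega
    · simp [h, h.not_gt, h.ne', hs i j]
  set K := A - Aᵀ with hKdef
  have hK : Kᵀ = -K := by simp [hKdef]
  have hEK : E = K + (2:ℤ) • Aᵀ := by rw [hA, hKdef, two_smul]; abel
  have hEK' : ∀ i j, E i j = K i j + 2 * A j i := fun i j => by
    have := congrFun (congrFun hEK i) j
    rw [this, Matrix.add_apply, Matrix.smul_apply, transpose_apply, smul_eq_mul]
  obtain ⟨s, hsq⟩ := skew_det_sq_int n K hK
  have h2 : (E.det : ZMod 2) = K.det := by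
    have h := fun M : Matrix (Fin n) (Fin n) ℤ => RingHom.map_det (Int.castRingHom (ZMod 2)) M
    simp only [eq_intCast] at h
    rw [h, h]; congr 1
    ext i j
    simp [hEK', show (2 : ZMod 2) = 0 from rfl]
  have hE4 : E.det % 4 = 1 := by
    have : (E.det : ZMod 4) = ((1:ℤ) : ZMod 4) := by simpa using h1
    exact (ZMod.intCast_eq_intCast_iff _ _ 4).mp this
  have hK2 : K.det % 2 = 1 := by
    have := (ZMod.intCast_eq_intCast_iff _ _ 2).mp h2
    unfold Int.ModEq at this; push_cast at this; omega
  have hK4 : (K.det : ZMod 4) = 1 := by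
    have : K.det % 4 = 1 := by
      rcases Int.even_or_odd s with ⟨r, hr⟩ | ⟨r, hr⟩
      · subst hr; rw [hsq] at hK2; ring_nf at hK2; omega
      · subst hr; rw [hsq]; ring_nf; omega
    have := (ZMod.intCast_eq_intCast_iff K.det 1 4).mpr this
    simpa using this
  let f := Int.castRingHom (ZMod 4)
  let K' := f.mapMatrix K
  let A' := f.mapMatrix A
  have hKd : K'.det = 1 := by rw [← RingHom.map_det]; simpa [f] using hK4
  have hu : IsUnit K'.det := by rw [hKd]; exact isUnit_one
  have hEd : (f.mapMatrix E).det = 1 := by rw [← RingHom.map_det]; simpa [f] using h1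
  have hE' : f.mapMatrix E = K' + (2 : ZMod 4) • A'ᵀ := by
    ext i j; simp [hEK', K', A', f]
  have hK' : K'ᵀ = -K' := by
    ext i j; have := congrFun (congrFun hK i) j
    simp only [transpose_apply, Matrix.neg_apply] at this
    simp [K', this]
  have hKA : K' = A' - A'ᵀ := by ext i j; simp [K', A', hKdef]
  have hfac : f.mapMatrix E = K' * (1 + (2 : ZMod 4) • (K'⁻¹ * A'ᵀ)) := by
    rw [hE', mul_add, mul_one, mul_smul_comm, ← mul_assoc, Matrix.mul_nonsing_inv _ hu, one_mul]
  have hS : K'⁻¹ᵀ = -K'⁻¹ := by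
    rw [Matrix.transpose_nonsing_inv, hK']
    apply Matrix.inv_eq_left_inv
    simp [Matrix.nonsing_inv_mul _ hu]
  have ht : trace (K'⁻¹ * A'ᵀ) = - trace (K'⁻¹ * A') := by
    rw [← trace_transpose, transpose_mul, hS, transpose_transpose, Matrix.mul_neg, trace_neg, trace_mul_comm]
  have ht2 : 2 * trace (K'⁻¹ * A'ᵀ) = -(n : ZMod 4) := by
    have : trace (K'⁻¹ * K') = n := by rw [Matrix.nonsing_inv_mul _ hu]; simp
    nth_rewrite 2 [hKA] at this
    rw [Matrix.mul_sub, trace_sub] at this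
    rw [← this, two_mul]
    nth_rewrite 1 [ht]; ring
  rw [hfac, det_mul, hKd, one_mul, det_one_add_smul] at hEd
  have h4 : (2 : ZMod 4)^2 = 0 := rfl
  rw [h4, mul_zero, add_zero, mul_comm, ht2] at hEd
  linear_combination -hEd

lemma core (n : ℕ) (G : Matrix (Fin n) (Fin n) ℤ) (hG : Gᵀ = G) (h1 : G.det = 1) (w : Fin n → ℤ)
    (hc : ∀ i, Even (G i i - (G *ᵥ w) i)) (h4 : 4 ∣ (G *ᵥ w) ⬝ᵥ w) : 4 ∣ n := by
  rw [← ZMod.natCast_eq_zero_iff]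
  set d := G *ᵥ w with hd
  apply even_det n (G - vecMulVec d d)
  · ext i j
    have := congrFun (congrFun hG i) j
    simp only [transpose_apply] at this
    simp [vecMulVec_apply, this, mul_comm]
  · intro i
    have := hc i
    simp only [Matrix.sub_apply, vecMulVec_apply]
    rw [Int.even_sub] at this ⊢
    rw [Int.even_mul]
    tauto
  · have : G - vecMulVec d d = G * (1 - replicateCol Unit w * replicateRow Unit d) := by
      rw [mul_sub, mul_one, ← Matrix.mul_assoc, ← replicateCol_mulVec, ← hd, ← vecMulVec_eq]
    rw [this, det_mul, h1, one_mul, det_one_sub_mul_comm]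
    obtain ⟨c, hc⟩ := h4
    have h0 : (4 : ZMod 4) = 0 := rfl
    simp [hc, h0]

section
open Module

lemma gram_facts (h : ℕ)
    (β : (Fin h → ℚ) →ₗ[ℚ] (Fin h → ℚ) →ₗ[ℚ] ℚ)
    (hsymm : ∀ x y, β x y = β y x)
    (hpos : ∀ x, x ≠ 0 → 0 < β x x)
    (L : Submodule ℤ (Fin h → ℚ))
    (hL : IsUnimodularLattice β L) :
    ∃ (b : Basis (Fin h) ℤ L) (G : Matrix (Fin h) (Fin h) ℤ),
      (∀ i j, β (b i) (b j) = G i j) ∧ G.det = 1 := by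
  have hsep : ∀ v, (∀ x, β v x = 0) → v = 0 := fun v hv => by
    by_contra hne
    exact (hpos v hne).ne' (hv v)
  have hnd : LinearMap.BilinForm.Nondegenerate β :=
    ⟨hsep, fun v hv => hsep v fun x => by rw [hsymm]; exact hv x⟩
  have hint : ∀ x ∈ L, ∀ y ∈ L, ∃ n : ℤ, β x y = n := fun x hx => (hL x).mp hx
  -- `L` spans
  have hspan : Submodule.span ℚ (L : Set (Fin h → ℚ)) = ⊤ := by
    by_contra hne
    obtain ⟨f, hf, hle⟩ := Submodule.exists_le_ker_of_lt_top _ (lt_top_iff_ne_top.mpr hne)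
    let v := (LinearMap.BilinForm.toDual β hnd).symm f
    have hv : ∀ x, β v x = f x := fun x => by
      exact LinearMap.BilinForm.apply_toDual_symm_apply (hB := hnd) f x
    have hv0 : ∀ x ∈ L, β v x = 0 := fun x hx => by
      rw [hv]; exact hle (Submodule.subset_span hx)
    have hvL : v ∈ L := (hL v).mpr fun x hx => ⟨0, by simp [hv0 x hx]⟩
    have hvz : v = 0 := by
      by_contra hne
      exact (hpos v hne).ne' (hv0 v hvL)
    apply hf
    ext x
    simp [← hv, hvz]
  have hfg : L.FG := by
    obtain ⟨s, hs, hsp, hli⟩ := exists_linearIndependent ℚ (L : Set (Fin h → ℚ))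
    let c : Basis s ℚ (Fin h → ℚ) := Basis.mk hli (by simp [hsp, hspan])
    have : Finite s := Module.Finite.finite_basis c
    classical
    have hle : L ≤ Submodule.span ℤ (Set.range (LinearMap.BilinForm.dualBasis β hnd c)) := by
      rw [← LinearMap.BilinForm.dualSubmodule_span_of_basis]
      intro x hx
      rw [LinearMap.BilinForm.mem_dualSubmodule]
      intro y hy
      have hyL : y ∈ L := by
        refine (Submodule.span_le.mpr ?_) hy
        rintro _ ⟨i, rfl⟩
        simpa [c] using hs i.2
      obtain ⟨n, hn⟩ := hint x hx y hyL
      rw [hn]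
      exact Submodule.mem_one.mpr ⟨n, by simp⟩
    have : IsNoetherian ℤ (Submodule.span ℤ (Set.range (LinearMap.BilinForm.dualBasis β hnd c))) :=
      isNoetherian_span_of_finite _ (Set.finite_range _)
    have := isNoetherian_of_le hle
    exact Module.Finite.iff_fg.mp inferInstance
  have hlat : L.IsLattice ℚ := ⟨hfg, hspan⟩
  have : Module.Free ℤ L := Submodule.IsLattice.free ℚ L
  have : Module.Finite ℤ L := Module.Finite.iff_fg.mpr hfg
  let b : Basis (Fin h) ℤ L := Module.finBasisOfFinrankEq ℤ L (by
    simpa using Submodule.IsLattice.finrank_of_pi ℚ L)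
  let B : Basis (Fin h) ℚ (Fin h → ℚ) := b.extendOfIsLattice ℚ
  have hB : ∀ i, B i = b i := fun i => b.extendOfIsLattice_apply ℚ i
  choose G hG using fun i j => hint (b i) (b i).2 (b j) (b j).2
  refine ⟨b, Matrix.of G, hG, ?_⟩
  -- dual basis
  let D := LinearMap.BilinForm.dualBasis β hnd B
  have hD : ∀ i j, β (D i) (B j) = if j = i then 1 else 0 := fun i j =>
    LinearMap.BilinForm.apply_dualBasis_left hnd B i j
  have hsum : ∀ x : L, (x : Fin h → ℚ) = ∑ i, ((b.repr x i : ℤ) : ℚ) • B i := fun x => by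
    conv_lhs => rw [← b.sum_repr x]
    simp only [Submodule.coe_sum, Submodule.coe_smul, hB, Int.cast_smul_eq_zsmul]
  have hDL : ∀ i, D i ∈ L := fun i => by
    rw [hL]
    intro x hx
    refine ⟨b.repr ⟨x, hx⟩ i, ?_⟩
    have := congrArg (β (D i)) (hsum ⟨x, hx⟩)
    simpa [hD] using this
  let P : Matrix (Fin h) (Fin h) ℤ := Matrix.of fun i k => b.repr ⟨D i, hDL i⟩ k
  have hPG : P * Matrix.of G = 1 := by
    ext i j
    have h1 := hD i j
    have := hsum ⟨D i, hDL i⟩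
    simp only at this
    rw [this] at h1
    simp only [map_sum, LinearMap.sum_apply, map_smul, LinearMap.smul_apply, hB, hG, smul_eq_mul] at h1
    rw [Matrix.mul_apply, Matrix.one_apply]
    simp only [P, Matrix.of_apply]
    simp only [eq_comm (a := i)]
    exact_mod_cast h1
  have hu : IsUnit (Matrix.of G).det := by
    have := congrArg Matrix.det hPG
    rw [Matrix.det_mul, Matrix.det_one] at this
    exact IsUnit.of_mul_eq_one_right _ this
  have hposdet : 0 < (Matrix.of G).det := by
    obtain ⟨v0, hv0⟩ := LinearMap.BilinForm.exists_orthogonal_basis (B := β)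
      ⟨fun x y => by simp [hsymm x y]⟩
    have hcard : Module.finrank ℚ (Fin h → ℚ) = h := by simp
    let v := v0.reindex (finCongr hcard)
    have hv : ∀ i j, i ≠ j → β (v i) (v j) = 0 := fun i j hij => by
      simp only [v, Basis.reindex_apply]
      exact hv0 (fun hh => hij ((finCongr hcard).symm.injective hh))
    have e1 := LinearMap.BilinForm.toMatrix_mul_basis_toMatrix v B β
    have e2 : LinearMap.BilinForm.toMatrix v β = Matrix.diagonal fun i => β (v i) (v i) := by
      ext i j
      rw [LinearMap.BilinForm.toMatrix_apply]
      by_cases hij : i = j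
      · subst hij; simp
      · rw [Matrix.diagonal_apply_ne _ hij]; exact hv i j hij
    have e3 : LinearMap.BilinForm.toMatrix B β = (Int.castRingHom ℚ).mapMatrix (Matrix.of G) := by
      ext i j
      rw [LinearMap.BilinForm.toMatrix_apply, hB, hB, hG]; simp
    have e4 := congrArg Matrix.det e1
    rw [e2, e3, Matrix.det_mul, Matrix.det_mul, Matrix.det_transpose, Matrix.det_diagonal,
      ← RingHom.map_det] at e4
    have e5 : 0 < ∏ i, β (v i) (v i) := Finset.prod_pos fun i _ => hpos _ (v.ne_zero i)
    have e6 : (0 : ℚ) ≤ ((Matrix.of G).det : ℤ) := by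
      rw [eq_intCast] at e4
      rw [← e4]
      have := mul_nonneg e5.le (mul_self_nonneg (v.toMatrix B).det)
      linarith
    have e7 : 0 ≤ (Matrix.of G).det := by exact_mod_cast e6
    exact lt_of_le_of_ne e7 hu.ne_zero.symm
  rcases Int.isUnit_iff.mp hu with h | h
  · exact h
  · omega

end

/-- an odd unimodular integral lattice of rank `h` with
`h % 8 ≠ 0` and `h % 8 ≠ 4` has no neighbours sharing the index-two sublattice
`M₂(L)`. -/
theorem stmt14 (h : ℕ) (hh : 1 ≤ h) (h0 : h % 8 ≠ 0) (h4 : h % 8 ≠ 4)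
    (β : (Fin h → ℚ) →ₗ[ℚ] (Fin h → ℚ) →ₗ[ℚ] ℚ)
    (hsymm : ∀ x y, β x y = β y x)
    (hpos : ∀ x, x ≠ 0 → 0 < β x x)
    (L : Submodule ℤ (Fin h → ℚ))
    (hL : IsUnimodularLattice β L) (hodd : IsOddLattice β L) :
    ¬ ∃ N : Submodule ℤ (Fin h → ℚ),
        IsUnimodularLattice β N ∧
        ((N ⊓ L : Submodule ℤ (Fin h → ℚ)) : Set (Fin h → ℚ)) = M2set β L := by
  
  rintro ⟨N, hN, hNL⟩
  obtain ⟨b, G, hG, hdet⟩ := gram_facts h β hsymm hpos L hL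
  have hint : ∀ x ∈ L, ∀ y ∈ L, ∃ n : ℤ, β x y = n := fun x hx => (hL x).mp hx
  have hM : ∀ x, x ∈ L → ∀ n : ℤ, Even n → β x x = n → x ∈ N := fun x hx n hn e => by
    have : x ∈ M2set β L := ⟨hx, n, hn, e⟩
    rw [← hNL] at this
    exact this.1
  -- a vector in `N` but not in `L`
  have hex : ∃ v ∈ N, v ∉ L := by
    by_contra hcon
    push Not at hcon
    obtain ⟨x, hx, n, hn, hxn⟩ := hodd
    have hxN : x ∈ N := (hN x).mpr fun y hy => hint x hx y (hcon y hy)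
    have : x ∈ M2set β L := by rw [← hNL]; exact ⟨hxN, hx⟩
    obtain ⟨-, m, hm, hxm⟩ := this
    have : n = m := by exact_mod_cast hxn.symm.trans hxm
    subst this
    exact (Int.not_even_iff_odd.mpr hn) hm
  obtain ⟨v, hvN, hvL⟩ := hex
  have hNint : ∀ x ∈ N, ∀ y ∈ N, ∃ n : ℤ, β x y = n := fun x hx => (hN x).mp hx
  have hl2 : ∀ x y, β ((2:ℤ) • x) y = 2 * β x y := fun x y => by
    rw [two_zsmul, map_add, LinearMap.add_apply]; ring
  have hr2 : ∀ x y, β x ((2:ℤ) • y) = 2 * β x y := fun x y => by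
    rw [two_zsmul, map_add]; ring
  have hw : ∀ x ∈ L, ∃ n : ℤ, β ((2:ℤ) • v) x = n := fun x hx => by
    obtain ⟨m, hm⟩ := hint x hx x hx
    have : (2:ℤ) • x ∈ N := hM _ (L.smul_mem 2 hx) (4 * m) ⟨2 * m, by ring⟩ (by rw [hl2, hr2, hm]; push_cast; ring)
    obtain ⟨n, hn⟩ := hNint v hvN _ this
    exact ⟨n, by rw [← hn, hl2, hr2]⟩
  have hwL : (2:ℤ) • v ∈ L := (hL _).mpr hw
  have hy : ∃ y ∈ L, ∀ n : ℤ, β v y ≠ n := by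
    by_contra hcon
    push Not at hcon
    exact hvL ((hL v).mpr hcon)
  obtain ⟨y, hyL, hy⟩ := hy
  have hb2 : ∀ x, β ((2:ℤ) • v) x = 2 * β v x := fun x => hl2 v x
  have hMw : ∀ x ∈ L, ∀ n : ℤ, Even n → β x x = n → ∃ k : ℤ, β ((2:ℤ) • v) x = 2 * k :=
    fun x hx n hn e => by
      obtain ⟨k, hk⟩ := hNint v hvN x (hM x hx n hn e)
      exact ⟨k, by rw [hb2, hk]⟩
  have hchar : ∀ x ∈ L, ∀ n m : ℤ, β x x = n → β ((2:ℤ) • v) x = m → Even (n - m) := by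
    intro x hx n m hn hm
    rcases Int.even_or_odd n with hev | hod
    · obtain ⟨k, hk⟩ := hMw x hx n hev hn
      have : m = 2 * k := by exact_mod_cast hm.symm.trans hk
      subst this
      exact hev.sub ⟨k, by ring⟩
    · obtain ⟨p, hp⟩ := hint y hyL y hyL
      have hpo : Odd p := by
        by_contra hpe
        rw [Int.not_odd_iff_even] at hpe
        obtain ⟨k, hk⟩ := hNint v hvN y (hM y hyL p hpe hp)
        exact hy k hk
      obtain ⟨q, hq⟩ := hint x hx y hyL
      obtain ⟨k, hk⟩ := hMw (x + y) (L.add_mem hx hyL) (n + p + 2 * q)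
        ((hod.add_odd hpo).add ⟨q, by ring⟩) (by
          simp only [map_add, LinearMap.add_apply, hsymm y x, hn, hp, hq]; push_cast; ring)
      obtain ⟨r, hr⟩ := hw y hyL
      have hro : Odd r := by
        by_contra hre
        rw [Int.not_odd_iff_even] at hre
        obtain ⟨t, rfl⟩ := hre
        refine hy t ?_
        rw [hb2] at hr
        push_cast at hr
        linarith
      rw [map_add, hm, hr] at hk
      have hk' : m + r = 2 * k := by exact_mod_cast hk
      have : Odd m := by
        obtain ⟨t, rfl⟩ := hro
        exact ⟨k - t - 1, by omega⟩
      exact hod.sub_odd this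
  let W : L := ⟨(2:ℤ) • v, hwL⟩
  let w : Fin h → ℤ := fun i => b.repr W i
  have hsum : (2:ℤ) • v = ∑ i, ((w i : ℤ) : ℚ) • (b i : Fin h → ℚ) := by
    change (W : Fin h → ℚ) = _
    conv_lhs => rw [← b.sum_repr W]
    simp only [Submodule.coe_sum, Submodule.coe_smul, Int.cast_smul_eq_zsmul, w]
  have hGs : ∀ i j, G i j = G j i := fun i j => by
    have : (G i j : ℚ) = G j i := by rw [← hG, ← hG, hsymm]
    exact_mod_cast this
  have hGw : ∀ i, β ((2:ℤ) • v) (b i) = ((G *ᵥ w) i : ℤ) := fun i => by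
    rw [hsum]
    simp only [map_sum, LinearMap.sum_apply, map_smul, LinearMap.smul_apply, hG, smul_eq_mul,
      Matrix.mulVec, dotProduct, Int.cast_sum, Int.cast_mul, hGs i]
    exact Finset.sum_congr rfl fun j _ => mul_comm _ _
  have h4n : 4 ∣ h := by
    refine core h G (by ext i j; exact hGs j i) hdet w ?_ ?_
    · intro i
      exact hchar (b i) (b i).2 _ _ (hG i i) (hGw i)
    · obtain ⟨k, hk⟩ := hNint v hvN v hvN
      refine ⟨k, ?_⟩
      have e1 : β ((2:ℤ) • v) ((2:ℤ) • v) = 4 * k := by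
        rw [hl2, hr2, hk]; ring
      have e2 : β ((2:ℤ) • v) ((2:ℤ) • v) = ((G *ᵥ w) ⬝ᵥ w : ℤ) := by
        nth_rewrite 2 [hsum]
        simp only [map_sum, map_smul, hGw, smul_eq_mul, dotProduct, Int.cast_sum, Int.cast_mul]
        exact Finset.sum_congr rfl fun j _ => mul_comm _ _
      exact_mod_cast e2.symm.trans e1
  omega
end
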